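/- arXiv:1101.2570 — 3 statements merged into one kernel-verified Lean document; each statement's English description precedes it below -/
import Mathlib

section
/- Assume s₀ ≥ 1. Let (p_n)_{n≥0} be a sequence of real numbers with p_n = O(n log n) such that, for some n* and all n ≥ n*, p_n = b·Σ_{k=0}^{n−s₀} P(I_n = k)·p_k + n − s₀. Then there exists a constant c_p ∈ ℝ such that p_n = (1/μ)·n·log n + c_p·n + o(n) as n → ∞. -/
open MeasureTheory Filter Topology Asymptotics

/-- expectation of `h` under the weights `w n` -/
noncomputable def EE (w : ℕ → ℕ → ℝ) (n : ℕ) (h : ℕ → ℝ) : ℝ := ∑ k ∈ Finset.range n, w n k * h k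

lemma EE_add (w : ℕ → ℕ → ℝ) (n : ℕ) (f g : ℕ → ℝ) :
    EE w n (fun k => f k + g k) = EE w n f + EE w n g := by
  simp [EE, mul_add, Finset.sum_add_distrib]

lemma EE_smul (w : ℕ → ℕ → ℝ) (n : ℕ) (c : ℝ) (f : ℕ → ℝ) :
    EE w n (fun k => c * f k) = c * EE w n f := by
  simp only [EE, Finset.mul_sum]
  exact Finset.sum_congr rfl fun k _ => by ring

lemma EE_mono {w : ℕ → ℕ → ℝ} (hw : ∀ n k, 0 ≤ w n k) (n : ℕ) {f g : ℕ → ℝ}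
    (h : ∀ k < n, f k ≤ g k) : EE w n f ≤ EE w n g :=
  Finset.sum_le_sum fun k hk => mul_le_mul_of_nonneg_left (h k (Finset.mem_range.1 hk)) (hw n k)

/-- slow variation -/
def SV (A : ℕ → ℝ) : Prop :=
  ∀ ε > 0, ∃ δ : ℝ, 0 < δ ∧ δ < 1 ∧ ∃ N : ℕ, ∀ n ≥ N, ∀ k : ℕ, (1 - δ) * n ≤ k → k ≤ n →
    |A n - A k| ≤ ε

/-- comparison principle -/
lemma comparison {w : ℕ → ℕ → ℝ} (hw : ∀ n k, 0 ≤ w n k) {b : ℝ} (hb : 0 ≤ b) (D : ℕ → ℝ) (N : ℕ)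
    (h0 : ∀ k ≤ N, 0 ≤ D k) (h1 : ∀ m > N, b * EE w m D ≤ D m) : ∀ m, 0 ≤ D m := by
  intro m
  induction m using Nat.strong_induction_on with
  | _ m ih =>
    by_cases h : m ≤ N
    · exact h0 m h
    · refine le_trans ?_ (h1 m (by omega))
      refine mul_nonneg hb (Finset.sum_nonneg fun k hk => ?_)
      exact mul_nonneg (hw _ _) (ih k (Finset.mem_range.1 hk))

/-- the log function is o(n) -/
lemma log_small (ε : ℝ) (hε : 0 < ε) : ∃ N : ℕ, ∀ n ≥ N, Real.log (1 + n) ≤ ε * n := by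
  have h : (fun n : ℕ => Real.log (1 + n)) =o[atTop] fun n : ℕ => (1 + n : ℝ) :=
    Real.isLittleO_log_id_atTop.comp_tendsto
      (tendsto_atTop_add_const_left _ 1 tendsto_natCast_atTop_atTop)
  have h2 := h.def (c := ε / 2) (by positivity)
  obtain ⟨N, hN⟩ := eventually_atTop.1 h2
  refine ⟨max N 1, fun n hn => ?_⟩
  have h3 := hN n (le_trans (le_max_left _ _) hn)
  have h4 : (1 : ℝ) ≤ n := by exact_mod_cast le_trans (le_max_right _ _) hn
  rw [Real.norm_eq_abs, Real.norm_eq_abs, abs_of_nonneg (by linarith : (0:ℝ) ≤ 1 + n)] at h3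
  nlinarith [le_abs_self (Real.log (1 + n))]

lemma log_nonneg' (n : ℕ) : 0 ≤ Real.log (1 + n) :=
  Real.log_nonneg (by have : (0:ℝ) ≤ n := n.cast_nonneg
                      linarith)

lemma log_le' (n : ℕ) : Real.log (1 + n) ≤ n := by
  have : (0:ℝ) ≤ n := n.cast_nonneg
  have := Real.log_le_sub_one_of_pos (by linarith : (0:ℝ) < 1 + n)
  linarith

/-- small mass property -/
def SmallMass (w : ℕ → ℕ → ℝ) : Prop :=
  ∀ δ > 0, ∃ κ : ℝ, 0 < κ ∧ κ < 1 ∧ ∃ N : ℕ, ∀ n ≥ N,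
    EE w n (fun k => if (k : ℝ) < κ * n then 1 else 0) ≤ δ

/-- window mass property -/
def WindowMass (w : ℕ → ℕ → ℝ) : Prop :=
  ∀ δ : ℝ, 0 < δ → δ < 1 → ∃ δ' : ℝ, 0 < δ' ∧ δ' < 1 ∧ ∃ c > 0, ∃ N : ℕ, ∀ n ≥ N,
    c ≤ EE w n (fun k => if (1 - δ) * n ≤ (k : ℝ) ∧ (k : ℝ) ≤ (1 - δ') * n then 1 else 0)

lemma log_gain {w : ℕ → ℕ → ℝ} (hw : ∀ n k, 0 ≤ w n k) {b : ℝ} (hb : 2 ≤ b) {N0 : ℕ}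
    (h1 : ∀ n ≥ N0, EE w n (fun _ => 1) = 1) (hc : SmallMass w) :
    ∃ N : ℕ, ∀ n ≥ N, (5 / 4) * Real.log (1 + n) ≤ b * EE w n (fun k => Real.log (1 + k)) := by
  obtain ⟨κ, hκ, hκ1, N1, hN1⟩ := hc (1 / 4) (by norm_num)
  have ht : Tendsto (fun n : ℕ => Real.log (1 + n)) atTop atTop :=
    Real.tendsto_log_atTop.comp (tendsto_atTop_add_const_left _ 1 tendsto_natCast_atTop_atTop)
  obtain ⟨N2, hN2⟩ := eventually_atTop.1 (ht.eventually_ge_atTop (6 * (-Real.log κ)))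
  refine ⟨max N0 (max N1 N2), fun n hn => ?_⟩
  have hn0 : N0 ≤ n := le_trans (le_max_left _ _) hn
  have hn1 : N1 ≤ n := le_trans (le_trans (le_max_left _ _) (le_max_right _ _)) hn
  have hn2 : N2 ≤ n := le_trans (le_trans (le_max_right _ _) (le_max_right _ _)) hn
  have hlk : Real.log κ < 0 := Real.log_neg hκ hκ1
  have e1 := hN1 n hn1
  have e2 := hN2 n hn2
  have e3 := h1 n hn0
  set a : ℝ := Real.log (1 + n) + Real.log κ with ha
  have ha0 : 0 ≤ a := by linarith
  have key : EE w n (fun k => a * 1 + (-a) * (if (k : ℝ) < κ * n then 1 else 0)) ≤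
      EE w n (fun k => Real.log (1 + k)) := by
    refine EE_mono hw n fun k _ => ?_
    split_ifs with hk
    · have := log_nonneg' k
      linarith
    · push Not at hk
      have hn' : (0:ℝ) ≤ n := n.cast_nonneg
      have : a = Real.log ((1 + n) * κ) := by
        rw [ha, Real.log_mul (by positivity) hκ.ne']
      rw [mul_one, mul_zero, add_zero, this]
      apply Real.log_le_log (by positivity)
      nlinarith
  rw [EE_add, EE_smul, EE_smul, e3] at key
  have : (3/4) * a ≤ EE w n (fun k => Real.log (1 + k)) := by nlinarith
  nlinarith

lemma r_bounded {w : ℕ → ℕ → ℝ} (hw : ∀ n k, 0 ≤ w n k) {b s T : ℝ} (hb : 2 ≤ b) (hs : 0 ≤ s)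
    (hT : 0 ≤ T) {N0 : ℕ}
    (h1 : ∀ n ≥ N0, EE w n (fun _ => 1) = 1) (h2 : ∀ n ≥ N0, b * EE w n (fun k => (k : ℝ)) = n - s)
    (hc : SmallMass w) (r : ℕ → ℝ) (hr0 : r 0 = 0)
    (hr : ∀ n ≥ N0, |r n - b * EE w n r| ≤ T * Real.log (1 + n)) :
    ∃ C : ℝ, 0 ≤ C ∧ ∀ n : ℕ, |r n| ≤ C * n := by
  obtain ⟨N1, hN1⟩ := log_gain hw hb h1 hc
  set N := max N0 N1 with hN
  set A : ℝ := 4 * T + ∑ k ∈ Finset.range (N + 1), |r k| with hA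
  have hS : ∀ k ≤ N, |r k| ≤ ∑ k ∈ Finset.range (N + 1), |r k| := fun k hk =>
    Finset.single_le_sum (f := fun k => |r k|) (fun i _ => abs_nonneg _)
      (Finset.mem_range.2 (by omega))
  have hS0 : 0 ≤ ∑ k ∈ Finset.range (N + 1), |r k| := Finset.sum_nonneg fun i _ => abs_nonneg _
  have hA0 : 0 ≤ A := by positivity
  have main : ∀ σ : ℝ, (σ = 1 ∨ σ = -1) → ∀ m : ℕ,
      0 ≤ A * m + ((-(4 * T)) * Real.log (1 + m) + σ * r m) := by
    intro σ hσ
    have hσr : ∀ x : ℝ, -|x| ≤ σ * x := by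
      intro x
      rcases hσ with rfl | rfl
      · linarith [neg_abs_le x]
      · linarith [le_abs_self x]
    refine comparison hw (by linarith : 0 ≤ b)
      (fun m : ℕ => A * m + ((-(4 * T)) * Real.log (1 + m) + σ * r m)) N ?_ ?_
    · intro k hk
      rcases Nat.eq_zero_or_pos k with rfl | hkp
      · simp [hr0]
      · have hk1 : (1:ℝ) ≤ k := by exact_mod_cast hkp
        have := hS k hk
        have := hσr (r k)
        have := log_le' k
        have : (4 * T) * Real.log (1 + k) ≤ (4 * T) * k := by gcongr
        have : A * k = 4 * T * k + (∑ k ∈ Finset.range (N + 1), |r k|) * k := by rw [hA]; ring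
        nlinarith
    · intro m hm
      have hm0 : N0 ≤ m := by omega
      have hm1 : N1 ≤ m := by omega
      simp only [EE_add, EE_smul]
      have e1 := h2 m hm0
      have e2 := hN1 m hm1
      have e3 := hr m hm0
      have e4 := hσr (r m - b * EE w m r)
      have e5 : (4 * T) * ((5 / 4) * Real.log (1 + m)) ≤
        (4 * T) * (b * EE w m (fun k => Real.log (1 + k))) := by gcongr
      have e6 : A * (b * EE w m (fun k => (k : ℝ))) = A * (m - s) := by rw [e1]
      have e7 : 0 ≤ A * s := by positivity
      nlinarith
  refine ⟨A, hA0, fun n => abs_le.2 ⟨?_, ?_⟩⟩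
  · have := main 1 (Or.inl rfl) n
    have := mul_nonneg hT (log_nonneg' n)
    linarith
  · have := main (-1) (Or.inr rfl) n
    have := mul_nonneg hT (log_nonneg' n)
    linarith

set_option maxHeartbeats 1000000 in
lemma barrier {w : ℕ → ℕ → ℝ} (hw : ∀ n k, 0 ≤ w n k) {b s T C : ℝ} (hb : 2 ≤ b) (hs : 0 ≤ s)
    (hT : 0 ≤ T) (hC : 0 ≤ C) {N0 : ℕ}
    (h1 : ∀ n ≥ N0, EE w n (fun _ => 1) = 1) (h2 : ∀ n ≥ N0, b * EE w n (fun k => (k : ℝ)) = n - s)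
    (hc : SmallMass w) (r : ℕ → ℝ)
    (hr : ∀ n ≥ N0, |r n - b * EE w n r| ≤ T * Real.log (1 + n))
    (hrC : ∀ n : ℕ, |r n| ≤ C * n) (ε : ℝ) (hε : 0 < ε) (hε1 : ε ≤ 1) :
    ∃ κ : ℝ, 0 < κ ∧ κ < 1 ∧ ∃ N : ℕ, ∀ n ≥ N, ∀ a : ℝ, |a| ≤ C + 1 →
      (∀ k : ℕ, κ * n ≤ k → k ≤ n → a * k ≤ r k) → ∀ m ≥ n, (a - ε) * m ≤ r m := by
  obtain ⟨N1, hN1⟩ := log_gain hw hb h1 hc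
  -- constants
  set T' : ℝ := 4 * (T + s * (C + 2)) with hT'
  have hT'0 : 0 ≤ T' := by positivity
  set B : ℝ := 2 * C + 2 + T' with hB
  have hB0 : 0 < B := by positivity
  set δ : ℝ := min (1 / (2 * b)) (ε / (8 * b * B)) with hδ
  have hbp : 0 < b := by linarith
  have hδ0 : 0 < δ := by rw [hδ]; positivity
  have hδ1 : b * δ ≤ 1 / 2 := by
    have : δ ≤ 1 / (2 * b) := min_le_left _ _
    rw [le_div_iff₀ (by positivity)] at this
    linarith
  have hδ2 : 8 * b * B * δ ≤ ε := by
    have : δ ≤ ε / (8 * b * B) := min_le_right _ _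
    rw [le_div_iff₀ (by positivity)] at this
    linarith
  obtain ⟨κ, hκ, hκ1, N2, hN2⟩ := hc δ hδ0
  obtain ⟨N3, hN3⟩ := log_small (ε / 2 / (T' + 1)) (by positivity)
  obtain ⟨N4, hN4⟩ := exists_nat_ge ((N3 : ℝ) / κ)
  refine ⟨κ, hκ, hκ1, max (max N0 N1) (max (max N2 2) N4), fun n hn a ha hwin => ?_⟩
  have hn0 : N0 ≤ n := le_trans (by simp) hn
  have hn1 : N1 ≤ n := le_trans (by simp) hn
  have hn2 : N2 ≤ n := le_trans (by simp) hn
  have hn3 : 2 ≤ n := le_trans (by simp) hn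
  have hn4 : N4 ≤ n := le_trans (by simp) hn
  have hnN3 : (N3 : ℝ) ≤ κ * n := by
    have : (N4 : ℝ) ≤ n := by exact_mod_cast hn4
    have h5 : (N3 : ℝ) / κ ≤ n := hN4.trans this
    rw [div_le_iff₀ hκ] at h5
    linarith
  have hnp : (0:ℝ) ≤ n := n.cast_nonneg
  set γ : ℝ := 2 * b * δ * κ with hγ
  have hγ0 : 0 < γ := by positivity
  set a' : ℝ := a - ε / 2 with ha'
  have ha'b : |a'| ≤ C + 2 := by
    rw [abs_le] at ha ⊢
    constructor <;> linarith [ha.1, ha.2]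
  set H : ℕ → ℝ := fun k => if (k : ℝ) < κ * n then (k : ℝ) else γ * (k / κ - n) with hH
  have D0 : ∀ m, 0 ≤ r m + ((-a') * m + (B * H m + (-T') * Real.log (1 + m))) := by
    refine comparison hw (by linarith : 0 ≤ b)
      (fun m => r m + ((-a') * m + (B * H m + (-T') * Real.log (1 + m)))) n ?_ ?_
    · intro k hk
      have hk0 : (0:ℝ) ≤ k := k.cast_nonneg
      show 0 ≤ r k + ((-a') * k + (B * H k + (-T') * Real.log (1 + k)))
      by_cases hkk : (k : ℝ) < κ * n
      · have e1 : H k = k := by simp only [hH]; rw [if_pos hkk]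
        rw [e1]
        have e2 := neg_le_of_abs_le (hrC k)
        have e3 : a' * k ≤ (C + 2) * k := by
          gcongr; exact (le_abs_self _).trans ha'b
        have e4 : T' * Real.log (1 + k) ≤ T' * k := by gcongr; exact log_le' k
        rw [hB]; nlinarith
      · have e1 : H k = γ * (k / κ - n) := by simp only [hH]; rw [if_neg hkk]
        push Not at hkk
        have e2 : 0 ≤ H k := by
          rw [e1]
          refine mul_nonneg hγ0.le ?_
          rw [sub_nonneg, le_div_iff₀ hκ]; linarith
        have e3 := hwin k hkk hk
        have e4 := hN3 k (by exact_mod_cast hnN3.trans hkk)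
        have e5 : T' * Real.log (1 + k) ≤ ε / 2 * k := by
          calc T' * Real.log (1 + k) ≤ (T' + 1) * Real.log (1 + k) := by
                have := log_nonneg' k
                nlinarith
            _ ≤ (T' + 1) * (ε / 2 / (T' + 1) * k) := by gcongr
            _ = ε / 2 * k := by field_simp
        have e6 : 0 ≤ B * H k := mul_nonneg hB0.le e2
        rw [ha']; linarith
    · intro m hm
      have hm0 : N0 ≤ m := by omega
      have hnm : (n : ℝ) ≤ m := by exact_mod_cast hm.le
      simp only [EE_add, EE_smul]
      -- H is a supersolution
      have f1 : b * EE w m H ≤ H m := by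
        have g1 : EE w m H ≤ EE w m (fun k => γ / κ * (k : ℝ) + ((-(γ * n)) * 1 +
            (κ * n + γ * n) * (if (k : ℝ) < κ * m then 1 else 0))) := by
          refine EE_mono hw m fun k _ => ?_
          have hk0 : (0:ℝ) ≤ k := k.cast_nonneg
          have hkd : 0 ≤ γ / κ * (k : ℝ) := by positivity
          simp only [hH]
          by_cases hkk : (k : ℝ) < κ * n
          · have : (k : ℝ) < κ * m := lt_of_lt_of_le hkk (by gcongr)
            rw [if_pos hkk, if_pos this]
            nlinarith
          · rw [if_neg hkk]
            have : 0 ≤ (κ * n + γ * n) * (if (k : ℝ) < κ * m then (1:ℝ) else 0) := by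
              split_ifs
              · positivity
              · simp
            have e : γ * (k / κ - n) = γ / κ * (k : ℝ) - γ * n := by ring
            linarith
        rw [EE_add, EE_smul, EE_add, EE_smul, EE_smul, h1 m hm0] at g1
        have g2 := hN2 m (by omega)
        have g3 : H m = γ * (m / κ - n) := by
          simp only [hH]
          rw [if_neg]
          have : κ * n ≤ 1 * m := by gcongr
          linarith
        have g4 := h2 m hm0
        have g5 : (κ * n + γ * n) * EE w m (fun k => if (k : ℝ) < κ * m then 1 else 0) ≤
          (κ * n + γ * n) * δ := by gcongr
        have g6 : b * EE w m H ≤ γ / κ * (b * EE w m (fun k => (k : ℝ))) - b * (γ * n) +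
          b * ((κ * n + γ * n) * δ) := by
          have : b * EE w m H ≤ b * (γ / κ * EE w m (fun k => (k : ℝ)) + (-(γ * n) * 1 +
            (κ * n + γ * n) * δ)) := by
            gcongr; linarith
          linarith
        rw [g4] at g6
        rw [g3]
        have g7 : b * ((κ * n + γ * n) * δ) = γ / 2 * n + (b * δ) * (γ * n) := by rw [hγ]; ring
        have g8 : (b * δ) * (γ * n) ≤ 1 / 2 * (γ * n) := by gcongr
        have g9 : 0 ≤ γ / κ * s := by positivity
        have g10 : 2 * (γ * n) ≤ b * (γ * n) := by gcongr
        have g11 : γ / κ * (m - s) = γ * (m / κ) - γ / κ * s := by ring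
        have g12 : 0 ≤ γ * n := by positivity
        linarith
      have f2 := h2 m hm0
      have f3 := neg_le_of_abs_le (hr m hm0)
      have f4 := hN1 m (by omega)
      have f5 : T' * ((5 / 4) * Real.log (1 + m)) ≤
        T' * (b * EE w m (fun k => Real.log (1 + k))) := by gcongr
      have f6 : B * (b * EE w m H) ≤ B * H m := by gcongr
      have f7 : 1 ≤ Real.log (1 + m) := by
        rw [Real.le_log_iff_exp_le (by positivity)]
        have : (2:ℝ) ≤ m := by exact_mod_cast (by omega : 2 ≤ m)
        linarith [Real.exp_one_lt_d9]
      have f8 : a' * s ≤ s * (C + 2) * Real.log (1 + m) := by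
        calc a' * s ≤ (C + 2) * s := by gcongr; exact (le_abs_self _).trans ha'b
          _ = s * (C + 2) * 1 := by ring
          _ ≤ _ := by gcongr
      have f9 : a' * (b * EE w m (fun k => (k : ℝ))) = a' * m - a' * s := by rw [f2]; ring
      have f10 : T' * Real.log (1 + m) = 4 * (T * Real.log (1 + m)) +
        4 * (s * (C + 2) * Real.log (1 + m)) := by rw [hT']; ring
      linarith
  intro m hm
  have e1 := D0 m
  have hnm : (n : ℝ) ≤ m := by exact_mod_cast hm
  have hm0 : (0:ℝ) ≤ m := m.cast_nonneg
  have e2 : H m = γ * (m / κ - n) := by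
    simp only [hH]
    rw [if_neg]
    have : κ * n ≤ 1 * m := by gcongr
    linarith
  have e3 : B * H m ≤ ε / 2 * m := by
    have : B * H m = 2 * b * B * δ * m - B * (γ * n) := by
      rw [e2, hγ]; field_simp
    rw [this]
    have : 0 ≤ B * (γ * n) := by positivity
    have : 8 * b * B * δ * m ≤ ε * m := by gcongr
    nlinarith
  have e4 : 0 ≤ T' * Real.log (1 + m) := mul_nonneg hT'0 (log_nonneg' m)
  rw [ha'] at e1
  linarith

set_option maxHeartbeats 1000000 in
lemma step {w : ℕ → ℕ → ℝ} (hw : ∀ n k, 0 ≤ w n k) {b s T C : ℝ} (hb : 2 ≤ b) (hs : 0 ≤ s)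
    (hT : 0 ≤ T) (hC : 0 ≤ C) {N0 : ℕ}
    (h1 : ∀ n ≥ N0, EE w n (fun _ => 1) = 1) (h2 : ∀ n ≥ N0, b * EE w n (fun k => (k : ℝ)) = n - s)
    (r : ℕ → ℝ)
    (hr : ∀ n ≥ N0, |r n - b * EE w n r| ≤ T * Real.log (1 + n))
    (hrC : ∀ n : ℕ, |r n| ≤ C * n) (L : ℝ)
    (hL : ∀ ε > 0, ∃ N : ℕ, ∀ n ≥ N, r n ≤ (L + ε) * n)
    {δ δ' c : ℝ} (hδ : 0 < δ) (hδ1 : δ < 1) (hc : 0 < c) {N1 : ℕ}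
    (hwin : ∀ n ≥ N1,
      c ≤ EE w n (fun k => if (1 - δ) * n ≤ (k : ℝ) ∧ (k : ℝ) ≤ (1 - δ') * n then 1 else 0))
    (ε : ℝ) (hε : 0 < ε) :
    ∃ ε' > 0, ∃ N : ℕ, ∀ n ≥ N, (L - ε') * n ≤ r n →
      ∃ k : ℕ, (1 - δ) * n ≤ (k : ℝ) ∧ (k : ℝ) ≤ (1 - δ') * n ∧ (L - ε) * k ≤ r k := by
  have hbp : 0 < b := by linarith
  have h1δ : 0 < 1 - δ := by linarith
  set ε' : ℝ := ε * c * (1 - δ) * b / 4 with hε'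
  have hε'0 : 0 < ε' := by positivity
  obtain ⟨N2, hN2⟩ := hL ε' hε'0
  obtain ⟨N3, hN3⟩ := log_small (ε' / (T + 1)) (by positivity)
  set K : ℝ := (C + |L| + ε') * N2 with hK
  have hK0 : 0 ≤ K := by positivity
  obtain ⟨N4, hN4⟩ := exists_nat_ge ((b * K + |L + ε'| * s + 1) / ε')
  refine ⟨ε', hε'0, max (max N0 N1) (max N3 N4), fun n hn hrn => ?_⟩
  have hn0 : N0 ≤ n := le_trans (by simp) hn
  have hn1 : N1 ≤ n := le_trans (by simp) hn
  have hn3 : N3 ≤ n := le_trans (by simp) hn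
  have hn4 : N4 ≤ n := le_trans (by simp) hn
  by_contra hcon
  push Not at hcon
  have hnp : (0:ℝ) ≤ n := n.cast_nonneg
  have hall : ∀ k : ℕ, r k ≤ (L + ε') * k + K := by
    intro k
    have hk0 : (0:ℝ) ≤ k := k.cast_nonneg
    by_cases hk : N2 ≤ k
    · linarith [hN2 k hk]
    · have hk2 : (k : ℝ) ≤ N2 := by exact_mod_cast (by omega : k ≤ N2)
      have e1 := (abs_le.1 (hrC k)).2
      have e2 : (C + |L| + ε') * k ≤ K := by rw [hK]; gcongr
      have e3 : -|L| * k ≤ L * k := by gcongr; exact neg_abs_le L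
      have e4 : 0 ≤ ε' * k := by positivity
      nlinarith
  have key : EE w n r ≤ EE w n (fun k => (L + ε') * (k : ℝ) + (K * 1 +
      (-(ε * ((1 - δ) * n))) *
        (if (1 - δ) * n ≤ (k : ℝ) ∧ (k : ℝ) ≤ (1 - δ') * n then 1 else 0))) := by
    refine EE_mono hw n fun k _ => ?_
    have hk0 : (0:ℝ) ≤ k := k.cast_nonneg
    split_ifs with hk
    · have e1 := hcon k hk.1 hk.2
      have e2 : ε * ((1 - δ) * n) ≤ ε * k := by gcongr; exact hk.1
      have e4 : 0 ≤ ε' * k := by positivity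
      linarith
    · linarith [hall k]
  rw [EE_add, EE_smul, EE_add, EE_smul, EE_smul, h1 n hn0] at key
  have f1 := hwin n hn1
  have f2 := (abs_le.1 (hr n hn0)).2
  have f3 := h2 n hn0
  have f4 : T * Real.log (1 + n) ≤ ε' * n := by
    calc T * Real.log (1 + n) ≤ (T + 1) * Real.log (1 + n) := by
          have := log_nonneg' n
          nlinarith
      _ ≤ (T + 1) * (ε' / (T + 1) * n) := by gcongr; exact hN3 n hn3
      _ = ε' * n := by field_simp
  have f5 : (ε * ((1 - δ) * n)) * c ≤ (ε * ((1 - δ) * n)) *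
    EE w n (fun k => if (1 - δ) * n ≤ (k : ℝ) ∧ (k : ℝ) ≤ (1 - δ') * n then 1 else 0) := by
    have : 0 ≤ (ε * ((1 - δ) * n)) := by positivity
    gcongr
  have f6 : b * EE w n r ≤ b * ((L + ε') * EE w n (fun k => (k:ℝ)) + K - (ε * ((1 - δ) * n)) * c) := by
    gcongr; linarith
  have f7 : (L + ε') * (b * EE w n (fun k => (k:ℝ))) = (L + ε') * n - (L + ε') * s := by
    rw [f3]; ring
  have f8 : b * ((ε * ((1 - δ) * n)) * c) = 4 * ε' * n := by rw [hε']; ring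
  have f9 : b * K + |L + ε'| * s + 1 ≤ ε' * n := by
    have : (N4 : ℝ) ≤ n := by exact_mod_cast hn4
    have h5 := hN4.trans this
    rw [div_le_iff₀ hε'0] at h5
    linarith
  have f10 : -(L + ε') * s ≤ |L + ε'| * s := by gcongr; exact neg_le_abs _
  nlinarith

lemma window {r : ℕ → ℝ} (L ε₀ δ δ' : ℝ) (hδ1 : δ < 1) (hδ'0 : 0 < δ') (hδ' : δ' < 1)
    (N0 : ℕ) (hsv : ∀ n ≥ N0, ∀ k : ℕ, (1 - δ) * n ≤ k → k ≤ n → |r n / n - r k / k| ≤ ε₀)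
    (hε₀ : 0 < ε₀)
    (hstep : ∀ ε > 0, ∃ ε' > 0, ∃ N : ℕ, ∀ n ≥ N, (L - ε') * n ≤ r n →
      ∃ k : ℕ, (1 - δ) * n ≤ (k : ℝ) ∧ (k : ℝ) ≤ (1 - δ') * n ∧ (L - ε) * k ≤ r k) (J : ℕ) :
    ∀ ε > 0, ∃ ε' > 0, ∃ N : ℕ, ∀ n ≥ N, (L - ε') * n ≤ r n →
      ∀ k : ℕ, (1 - δ') ^ J * n ≤ k → k ≤ n → (L - ε - ε₀) * k ≤ r k := by
  have h1δ : 0 < 1 - δ := by linarith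
  have h1δ' : 0 < 1 - δ' := by linarith
  induction J with
  | zero =>
    intro ε hε
    refine ⟨ε, hε, 0, fun n _ hn k hk1 hk2 => ?_⟩
    have hk : k = n := by
      apply le_antisymm hk2
      have : (n : ℝ) ≤ k := by simpa using hk1
      exact_mod_cast this
    subst hk
    have : 0 ≤ ε₀ * k := by positivity
    linarith
  | succ J ih =>
    intro ε hε
    obtain ⟨ε1, hε1, N1, hN1⟩ := ih ε hε
    obtain ⟨ε2, hε2, N2, hN2⟩ := hstep ε1 hε1
    obtain ⟨N3, hN3⟩ := exists_nat_ge ((N1 : ℝ) / (1 - δ))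
    refine ⟨min ε ε2, lt_min hε hε2, max (max N0 1) (max N2 N3), fun n hn hrn k hk1 hk2 => ?_⟩
    have hn0 : N0 ≤ n := le_trans (by simp) hn
    have hn1 : 1 ≤ n := le_trans (by simp) hn
    have hn2 : N2 ≤ n := le_trans (by simp) hn
    have hn3 : N3 ≤ n := le_trans (by simp) hn
    have hnp : (0:ℝ) < n := by exact_mod_cast hn1
    by_cases hk : (1 - δ) * n ≤ k
    · have hkp : (0:ℝ) < k := lt_of_lt_of_le (by positivity) hk
      have e1 := (abs_le.1 (hsv n hn0 k hk hk2)).2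
      have e2 : L - ε ≤ r n / n := by
        rw [le_div_iff₀ hnp]
        refine le_trans ?_ hrn
        gcongr
        exact min_le_left _ _
      have e3 : L - ε - ε₀ ≤ r k / k := by linarith
      rwa [le_div_iff₀ hkp] at e3
    · push Not at hk
      obtain ⟨n', hn'1, hn'2, hn'3⟩ := hN2 n hn2 (le_trans (by gcongr; exact min_le_right _ _) hrn)
      refine hN1 n' ?_ hn'3 k ?_ ?_
      · have : (N3 : ℝ) ≤ n := by exact_mod_cast hn3
        have h5 := hN3.trans this
        rw [div_le_iff₀ h1δ] at h5
        have : (N1 : ℝ) ≤ n' := by linarith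
        exact_mod_cast this
      · calc (1 - δ') ^ J * n' ≤ (1 - δ') ^ J * ((1 - δ') * n) := by gcongr
          _ = (1 - δ') ^ (J + 1) * n := by ring
          _ ≤ k := hk1
      · have : (k : ℝ) ≤ n' := by linarith
        exact_mod_cast this

theorem abstract_conv {w : ℕ → ℕ → ℝ} (hw : ∀ n k, 0 ≤ w n k) {b s T : ℝ} (hb : 2 ≤ b) (hs : 0 ≤ s)
    (hT : 0 ≤ T) {N0 : ℕ}
    (h1 : ∀ n ≥ N0, EE w n (fun _ => 1) = 1) (h2 : ∀ n ≥ N0, b * EE w n (fun k => (k : ℝ)) = n - s)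
    (hc : SmallMass w) (hd : WindowMass w)
    (hsv : ∀ (h : ℕ → ℝ) (C : ℝ), (∀ k : ℕ, |h k| ≤ C * k) → SV (fun n => EE w n h / n))
    (r : ℕ → ℝ) (hr0 : r 0 = 0)
    (hr : ∀ n ≥ N0, |r n - b * EE w n r| ≤ T * Real.log (1 + n)) :
    ∃ L : ℝ, Tendsto (fun n : ℕ => r n / n) atTop (𝓝 L) := by
  have hbp : 0 < b := by linarith
  obtain ⟨C, hC, hrC⟩ := r_bounded hw hb hs hT h1 h2 hc r hr0 hr
  have hq : ∀ n : ℕ, |r n / n| ≤ C := by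
    intro n
    rw [abs_div, Nat.abs_cast]
    exact div_le_of_le_mul₀ n.cast_nonneg hC (hrC n)
  -- slow variation of r n / n
  have hSV : SV (fun n => r n / n) := by
    intro ε hε
    obtain ⟨δ, hδ0, hδ1, N1, hN1⟩ := hsv r C hrC (ε / (3 * b)) (by positivity)
    obtain ⟨N2, hN2⟩ := log_small (ε / 3 / (T + 1)) (by positivity)
    set N3 := max N0 (max N2 1) with hN3
    obtain ⟨N4, hN4⟩ := exists_nat_ge ((N3 : ℝ) / (1 - δ))
    have h1δ : 0 < 1 - δ := by linarith
    have herr : ∀ n ≥ N3, |r n / n - b * (EE w n r / n)| ≤ ε / 3 := by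
      intro n hn
      have hn0 : N0 ≤ n := le_trans (by simp [hN3]) hn
      have hn2 : N2 ≤ n := le_trans (by simp [hN3]) hn
      have hn1 : 1 ≤ n := le_trans (by simp [hN3]) hn
      have hnp : (0:ℝ) < n := by exact_mod_cast hn1
      have : r n / n - b * (EE w n r / n) = (r n - b * EE w n r) / n := by ring
      rw [this, abs_div, Nat.abs_cast, div_le_iff₀ hnp]
      refine (hr n hn0).trans ?_
      calc T * Real.log (1 + n) ≤ (T + 1) * Real.log (1 + n) := by
            have := log_nonneg' n
            nlinarith
        _ ≤ (T + 1) * (ε / 3 / (T + 1) * n) := by gcongr; exact hN2 n hn2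
        _ = ε / 3 * n := by field_simp
    refine ⟨δ, hδ0, hδ1, max N1 (max N3 N4), fun n hn k hk1 hk2 => ?_⟩
    have hn1 : N1 ≤ n := le_trans (by simp) hn
    have hn3 : N3 ≤ n := le_trans (by simp) hn
    have hn4 : N4 ≤ n := le_trans (by simp) hn
    have hk3 : N3 ≤ k := by
      have : (N4 : ℝ) ≤ n := by exact_mod_cast hn4
      have h5 := hN4.trans this
      rw [div_le_iff₀ h1δ] at h5
      have : (N3 : ℝ) ≤ k := by linarith
      exact_mod_cast this
    have e1 := abs_le.1 (herr n hn3)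
    have e2 := abs_le.1 (herr k hk3)
    have e3 := hN1 n hn1 k hk1 hk2
    have e4 : |b * (EE w n r / n) - b * (EE w k r / k)| ≤ ε / 3 := by
      rw [← mul_sub, abs_mul, abs_of_pos hbp]
      calc b * |EE w n r / n - EE w k r / k| ≤ b * (ε / (3 * b)) := by gcongr
        _ = ε / 3 := by field_simp
    rw [abs_le] at e4 ⊢
    constructor <;> linarith [e1.1, e1.2, e2.1, e2.2, e4.1, e4.2]
  set q : ℕ → ℝ := fun n => r n / n with hqdef
  have hbu : IsBoundedUnder (· ≤ ·) atTop q := isBoundedUnder_of ⟨C, fun n => (abs_le.1 (hq n)).2⟩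
  have hbl : IsBoundedUnder (· ≥ ·) atTop q := isBoundedUnder_of ⟨-C, fun n => (abs_le.1 (hq n)).1⟩
  set L := limsup q atTop with hLdef
  have hLup : ∀ ε > 0, ∀ᶠ n in atTop, q n < L + ε := fun ε hε =>
    eventually_lt_of_limsup_lt (by linarith) hbu
  have hLfr : ∀ ε > 0, ∃ᶠ n in atTop, L - ε < q n := fun ε hε =>
    frequently_lt_of_lt_limsup hbl.isCoboundedUnder_le (by linarith)
  have hLC : |L| ≤ C := by
    rw [abs_le]
    constructor
    · by_contra hcon
      push Not at hcon
      obtain ⟨n, hn⟩ := (hLup ((-C - L) / 2) (by linarith)).exists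
      linarith [(abs_le.1 (hq n)).1]
    · by_contra hcon
      push Not at hcon
      obtain ⟨n, hn⟩ := (hLfr (L - C) (by linarith)).exists
      linarith [(abs_le.1 (hq n)).2]
  have hLr : ∀ ε > 0, ∃ N : ℕ, ∀ n ≥ N, r n ≤ (L + ε) * n := by
    intro ε hε
    obtain ⟨N, hN⟩ := eventually_atTop.1 (hLup ε hε)
    refine ⟨max N 1, fun n hn => ?_⟩
    have hnp : (0:ℝ) < n := by exact_mod_cast (lt_of_lt_of_le Nat.one_pos ((le_max_right _ _).trans hn))
    have := (hN n ((le_max_left _ _).trans hn)).le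
    rwa [hqdef, div_le_iff₀ hnp] at this
  refine ⟨L, ?_⟩
  have hlow : ∀ ε : ℝ, 0 < ε → ε ≤ 1 / 2 → ∀ᶠ n in atTop, L - 3 * ε ≤ q n := by
    intro ε hε hε1
    obtain ⟨κ, hκ, hκ1, N1, hN1⟩ := barrier hw hb hs hT hC h1 h2 hc r hr hrC ε hε (by linarith)
    obtain ⟨δ, hδ0, hδ1, N2, hN2⟩ := hSV ε hε
    obtain ⟨δ', hδ'0, hδ'1, c, hc0, N3, hN3⟩ := hd δ hδ0 hδ1
    obtain ⟨J, hJ⟩ := exists_pow_lt_of_lt_one hκ (by linarith : 1 - δ' < 1)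
    obtain ⟨ε', hε', N4, hN4⟩ := window L ε δ δ' hδ1 hδ'0 hδ'1 N2 hN2 hε
      (step hw hb hs hT hC h1 h2 r hr hrC L hLr hδ0 hδ1 hc0 hN3) J ε hε
    obtain ⟨n, hn, hqn⟩ := (frequently_atTop.1 (hLfr ε' hε')) (max N1 (max N4 1))
    have hn1 : N1 ≤ n := le_trans (by simp) hn
    have hn4 : N4 ≤ n := le_trans (by simp) hn
    have hnp : (0:ℝ) < n := by exact_mod_cast (le_trans (by simp) hn : 1 ≤ n)
    rw [hqdef, lt_div_iff₀ hnp] at hqn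
    have hwd := hN4 n hn4 hqn.le
    have hfin := hN1 n hn1 (L - ε - ε) (by
      rw [abs_le] at hLC ⊢
      constructor <;> linarith [hLC.1, hLC.2]) (fun k hk1 hk2 => hwd k (le_trans (by gcongr) hk1) hk2)
    refine eventually_atTop.2 ⟨n, fun m hm => ?_⟩
    have hmp : (0:ℝ) < m := lt_of_lt_of_le hnp (by exact_mod_cast hm)
    rw [hqdef, le_div_iff₀ hmp]
    have := hfin m hm
    linarith
  rw [Metric.tendsto_nhds]
  intro ε hε
  set ε1 := min (ε / 4) (1 / 2) with hε1
  have hε10 : 0 < ε1 := by positivity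
  have hε12 : ε1 ≤ ε / 4 := min_le_left _ _
  filter_upwards [hlow ε1 hε10 (min_le_right _ _), hLup ε1 hε10] with n hn1 hn2
  rw [Real.dist_eq, abs_lt]
  constructor <;> linarith

/-- Bernstein weights -/
noncomputable def bern (m k : ℕ) (x : ℝ) : ℝ := (m.choose k : ℝ) * x ^ k * (1 - x) ^ (m - k)

/-- Bernstein operator -/
noncomputable def Bm (m : ℕ) (g : ℕ → ℝ) (x : ℝ) : ℝ := ∑ k ∈ Finset.range (m + 1), bern m k x * g k

lemma bern_eq (m k : ℕ) (x : ℝ) : (bernsteinPolynomial ℝ m k).eval x = bern m k x := by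
  simp [bernsteinPolynomial, bern]

lemma bern_nonneg {m k : ℕ} {x : ℝ} (hx : x ∈ Set.Icc (0:ℝ) 1) : 0 ≤ bern m k x := by
  have h0 := hx.1
  have h1 : 0 ≤ 1 - x := by linarith [hx.2]
  unfold bern; positivity

lemma Bm_one (m : ℕ) (x : ℝ) : Bm m (fun _ => 1) x = 1 := by
  have := congrArg (Polynomial.eval x) (bernsteinPolynomial.sum ℝ m)
  rw [Polynomial.eval_finsetSum] at this
  simpa [Bm, bern_eq] using this

lemma Bm_id (m : ℕ) (x : ℝ) : Bm m (fun k => (k : ℝ)) x = m * x := by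
  have := congrArg (Polynomial.eval x) (bernsteinPolynomial.sum_smul ℝ m)
  rw [Polynomial.eval_finsetSum] at this
  simp only [bern_eq, nsmul_eq_mul, Polynomial.eval_mul, 
    Polynomial.eval_natCast, Polynomial.eval_X] at this
  rw [← this, Bm]
  exact Finset.sum_congr rfl fun k _ => by ring

lemma Bm_var (m : ℕ) (x : ℝ) : Bm m (fun k => (k - m * x) ^ 2) x = m * x * (1 - x) := by
  have := congrArg (Polynomial.eval x) (bernsteinPolynomial.variance ℝ m)
  rw [Polynomial.eval_finsetSum] at this
  simp only [bern_eq, nsmul_eq_mul, Polynomial.eval_mul, Polynomial.eval_sub,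
    Polynomial.eval_natCast, Polynomial.eval_X, Polynomial.eval_pow, Polynomial.eval_one] at this
  rw [← this, Bm]
  exact Finset.sum_congr rfl fun k _ => by ring

lemma Bm_add (m : ℕ) (f g : ℕ → ℝ) (x : ℝ) :
    Bm m (fun k => f k + g k) x = Bm m f x + Bm m g x := by
  simp [Bm, mul_add, Finset.sum_add_distrib]

lemma Bm_smul (m : ℕ) (c : ℝ) (f : ℕ → ℝ) (x : ℝ) :
    Bm m (fun k => c * f k) x = c * Bm m f x := by
  simp only [Bm, Finset.mul_sum]
  exact Finset.sum_congr rfl fun k _ => by ring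

lemma Bm_mono {m : ℕ} {f g : ℕ → ℝ} {x : ℝ} (hx : x ∈ Set.Icc (0:ℝ) 1) (h : ∀ k ≤ m, f k ≤ g k) :
    Bm m f x ≤ Bm m g x :=
  Finset.sum_le_sum fun k hk =>
    mul_le_mul_of_nonneg_left (h k (by have := Finset.mem_range.1 hk; omega)) (bern_nonneg hx)

lemma Bm_abs {m : ℕ} {f : ℕ → ℝ} {C x : ℝ} (hx : x ∈ Set.Icc (0:ℝ) 1) (h : ∀ k ≤ m, |f k| ≤ C) :
    |Bm m f x| ≤ C := by
  rw [abs_le]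
  have e1 : Bm m (fun _ => C * 1) x = C := by rw [Bm_smul, Bm_one, mul_one]
  have e2 : Bm m (fun _ => (-C) * 1) x = -C := by rw [Bm_smul, Bm_one, mul_one]
  constructor
  · rw [← e2]; exact Bm_mono hx fun k hk => by linarith [(abs_le.1 (h k hk)).1]
  · rw [← e1]; exact Bm_mono hx fun k hk => by linarith [(abs_le.1 (h k hk)).2]

lemma Bm_cont (m : ℕ) (g : ℕ → ℝ) : Continuous (Bm m g) := by
  unfold Bm bern
  fun_prop

/-- Lipschitz estimate -/
lemma Bm_lip {φ : ℝ → ℝ} {K : ℝ} (hK : 0 ≤ K) (hφ : ∀ x y, |φ x - φ y| ≤ K * |x - y|)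
    {m s n : ℕ} (hn : 0 < n) (hmn : m ≤ n) {x : ℝ} (hx : x ∈ Set.Icc (0:ℝ) 1) :
    |Bm m (fun k => φ (((k + s : ℕ) : ℝ) / n)) x - φ x| ≤
      K * ((Real.sqrt n + (s + (n - m : ℝ))) / n) := by
  have hnp : (0:ℝ) < n := by exact_mod_cast hn
  have hmn' : (m : ℝ) ≤ n := by exact_mod_cast hmn
  set q := Real.sqrt n with hq
  have hq0 : 0 < q := Real.sqrt_pos.2 hnp
  have hqq : q * q = n := Real.mul_self_sqrt hnp.le
  have key : ∀ k : ℕ, |φ (((k + s : ℕ) : ℝ) / n) - φ x| ≤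
      K / (2 * n * q) * (k - m * x) ^ 2 + K / n * (q / 2 + (s + (n - m))) * 1 := by
    intro k
    refine (hφ _ _).trans ?_
    have e1 : ((k + s : ℕ) : ℝ) / n - x = ((k - m * x) + (s - (n - m) * x)) / n := by
      push_cast; field_simp; ring
    have e2 : |(k : ℝ) - m * x| ≤ (k - m * x) ^ 2 / (2 * q) + q / 2 := by
      have : (k - m * x) ^ 2 / (2 * q) + q / 2 = ((k - m * x) ^ 2 + q ^ 2) / (2 * q) := by
        field_simp
      rw [this, le_div_iff₀ (by positivity), ← sq_abs (k - m * x)]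
      nlinarith [sq_nonneg (|(k : ℝ) - m * x| - q)]
    have e3 : |(s : ℝ) - (n - m) * x| ≤ s + (n - m) := by
      have h0 : 0 ≤ ((n:ℝ) - m) * x := mul_nonneg (by linarith) hx.1
      have h1 : ((n:ℝ) - m) * x ≤ (n - m) * 1 := mul_le_mul_of_nonneg_left hx.2 (by linarith)
      have h2 : (0:ℝ) ≤ s := s.cast_nonneg
      rw [abs_le]; constructor <;> linarith
    rw [e1, abs_div, abs_of_pos hnp]
    have e4 : |(k - m * x) + (s - (n - m) * x)| ≤
      (k - m * x) ^ 2 / (2 * q) + q / 2 + (s + (n - m)) := (abs_add_le _ _).trans (by linarith)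
    calc K * (|(k - m * x) + (s - (n - m) * x)| / n) ≤
        K * (((k - m * x) ^ 2 / (2 * q) + q / 2 + (s + (n - m))) / n) := by gcongr
      _ = _ := by field_simp; ring
  have hsub : Bm m (fun k => φ (((k + s : ℕ) : ℝ) / n)) x - φ x =
      Bm m (fun k => φ (((k + s : ℕ) : ℝ) / n) + (-φ x) * 1) x := by
    rw [Bm_add, Bm_smul, Bm_one]; ring
  have hup : Bm m (fun k => K / (2 * n * q) * (k - m * x) ^ 2 +
      K / n * (q / 2 + (s + (n - m))) * 1) x ≤ K * ((q + (s + (n - m : ℝ))) / n) := by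
    rw [Bm_add, Bm_smul, Bm_smul, Bm_one, Bm_var]
    have h1 : (m : ℝ) * x * (1 - x) ≤ q * q := by
      rw [hqq]
      have : 0 ≤ 1 - x := by linarith [hx.2]
      have h3 : x * (1 - x) ≤ 1 := by nlinarith [hx.1]
      have : (m : ℝ) * (x * (1 - x)) ≤ m * 1 := by gcongr
      linarith
    calc K / (2 * n * q) * (m * x * (1 - x)) + K / n * (q / 2 + (s + (n - m))) * 1
        ≤ K / (2 * n * q) * (q * q) + K / n * (q / 2 + (s + (n - m))) * 1 := by gcongr
      _ = _ := by field_simp; ring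
  rw [hsub]
  refine le_trans ?_ hup
  rw [abs_le]
  constructor
  · rw [neg_le, ← neg_one_mul, ← Bm_smul]
    refine Bm_mono hx fun k _ => ?_
    have := (abs_le.1 (key k)).1
    linarith
  · refine Bm_mono hx fun k _ => ?_
    have := (abs_le.1 (key k)).2
    linarith

lemma Bm_xlogx {m : ℕ} {x : ℝ} (hx : x ∈ Set.Icc (0:ℝ) 1) :
    (m * x) * Real.log (m * x) ≤ Bm m (fun k => k * Real.log k) x ∧
    Bm m (fun k => k * Real.log k) x ≤ (m * x) * Real.log (m * x) + 1 := by
  rcases eq_or_lt_of_le (mul_nonneg m.cast_nonneg hx.1 : (0:ℝ) ≤ m * x) with h0 | hy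
  · rw [← h0]
    have hz : Bm m (fun k => k * Real.log k) x = 0 := by
      rcases Nat.eq_zero_or_pos m with rfl | hm
      · simp [Bm]
      · have hx0 : x = 0 := by
          have : (m : ℝ) ≠ 0 := by positivity
          rcases mul_eq_zero.1 h0.symm with h | h
          · exact absurd h this
          · exact h
        subst hx0
        unfold Bm
        refine Finset.sum_eq_zero fun k _ => ?_
        rcases Nat.eq_zero_or_pos k with rfl | hk
        · simp
        · simp [bern, hk.ne']
    rw [hz]; simp
  · set y : ℝ := m * x with hyd
    have hid := Bm_id m x
    have hvar := Bm_var m x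
    have hone := Bm_one m x
    constructor
    · have h : Bm m (fun k => (1 + Real.log y) * (k : ℝ) + (-y) * 1) x ≤
          Bm m (fun k => k * Real.log k) x := by
        refine Bm_mono hx fun k _ => ?_
        rcases Nat.eq_zero_or_pos k with rfl | hk
        · simp; exact hy.le
        · have hk : (0:ℝ) < k := by exact_mod_cast hk
          have := Real.log_le_sub_one_of_pos (div_pos hy hk)
          rw [Real.log_div hy.ne' hk.ne'] at this
          have h2 : k * (Real.log y - Real.log k) ≤ k * (y / k - 1) := by gcongr
          have h3 : k * (y / k - 1) = y - k := by field_simp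
          linarith
      rw [Bm_add, Bm_smul, Bm_smul, hid, hone] at h
      linarith
    · have h : Bm m (fun k => k * Real.log k) x ≤
          Bm m (fun k => (1 + Real.log y) * (k : ℝ) + ((-y) * 1 + (1 / y) * (k - m * x) ^ 2)) x := by
        refine Bm_mono hx fun k _ => ?_
        rw [← hyd]
        rcases Nat.eq_zero_or_pos k with rfl | hk
        · simp; field_simp; simp
        · have hk : (0:ℝ) < k := by exact_mod_cast hk
          have := Real.log_le_sub_one_of_pos (div_pos hk hy)
          rw [Real.log_div hk.ne' hy.ne'] at this
          have h2 : k * (Real.log k - Real.log y) ≤ k * (k / y - 1) := by gcongr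
          have h3 : k * (k / y - 1) = k - y + 1 / y * (k - y) ^ 2 := by field_simp; ring
          linarith
      rw [Bm_add, Bm_smul, Bm_add, Bm_smul, Bm_smul, hid, hone, hvar, ← hyd] at h
      have : 1 / y * (y * (1 - x)) = 1 - x := by field_simp
      linarith [hx.1]

lemma xlogx_shift (k s n : ℕ) (h : k + s ≤ n) (hn : 1 ≤ n) :
    (k : ℝ) * Real.log k ≤ ((k + s : ℕ) : ℝ) * Real.log ((k + s : ℕ) : ℝ) ∧
    ((k + s : ℕ) : ℝ) * Real.log ((k + s : ℕ) : ℝ) ≤ k * Real.log k + s * (1 + Real.log n) := by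
  have hnp : (1:ℝ) ≤ n := by exact_mod_cast hn
  have hln : 0 ≤ Real.log n := Real.log_nonneg hnp
  have hs0 : (0:ℝ) ≤ s := s.cast_nonneg
  rcases Nat.eq_zero_or_pos k with rfl | hk
  · simp only [Nat.cast_zero, zero_mul, zero_add]
    rcases Nat.eq_zero_or_pos s with rfl | hs
    · simp
    · have hs1 : (1:ℝ) ≤ s := by exact_mod_cast hs
      have : Real.log s ≤ Real.log n := Real.log_le_log (by positivity) (by
        exact_mod_cast (by omega : s ≤ n))
      have h0 := Real.log_nonneg hs1
      constructor
      · positivity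
      · have : (s:ℝ) * Real.log s ≤ s * (1 + Real.log n) := by gcongr; linarith
        exact this
  · have hk1 : (1:ℝ) ≤ k := by exact_mod_cast hk
    have hkp : (0:ℝ) < k := by linarith
    push_cast
    have hkn : (k:ℝ) + s ≤ n := by exact_mod_cast h
    have l1 : Real.log k ≤ Real.log (k + s) := Real.log_le_log hkp (by linarith)
    have l2 : Real.log (k + s) ≤ Real.log n := Real.log_le_log (by linarith) hkn
    have l0 := Real.log_nonneg hk1
    constructor
    · gcongr; linarith
    · have := Real.log_le_sub_one_of_pos (div_pos (by linarith : (0:ℝ) < k + s) hkp)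
      rw [Real.log_div (by linarith) hkp.ne'] at this
      have h2 : k * (Real.log (k + s) - Real.log k) ≤ k * ((k + s) / k - 1) := by gcongr
      have h3 : k * (((k:ℝ) + s) / k - 1) = s := by field_simp; ring
      have h4 : s * Real.log (k + s) ≤ s * Real.log n := by gcongr
      nlinarith

/-- beta integral at integers -/
lemma beta_nat (i j : ℕ) : ∫ x in (0:ℝ)..1, x ^ i * (1 - x) ^ j =
    (i.factorial * j.factorial : ℝ) / ((i + j + 1).factorial : ℝ) := by
  induction j generalizing i with
  | zero =>
    simp only [pow_zero, mul_one, integral_pow, Nat.factorial_zero, Nat.add_zero, Nat.factorial_succ]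
    push_cast
    have : (i.factorial : ℝ) ≠ 0 := by positivity
    field_simp; simp
  | succ j ih =>
    have hder : ∀ x ∈ Set.uIcc (0:ℝ) 1, HasDerivAt (fun x : ℝ => x ^ (i + 1) * (1 - x) ^ (j + 1))
        ((i + 1) * (x ^ i * (1 - x) ^ (j + 1)) - (j + 1) * (x ^ (i + 1) * (1 - x) ^ j)) x := by
      intro x _
      have h1 := hasDerivAt_pow (i + 1) x
      have h2 := (((hasDerivAt_id x).const_sub 1).pow (j + 1))
      convert! h1.mul h2 using 1
      simp; ring
    have hInt := intervalIntegral.integral_eq_sub_of_hasDerivAt hder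
      (by apply Continuous.intervalIntegrable; fun_prop)
    rw [intervalIntegral.integral_sub (by apply Continuous.intervalIntegrable; fun_prop)
      (by apply Continuous.intervalIntegrable; fun_prop), intervalIntegral.integral_const_mul,
      intervalIntegral.integral_const_mul, ih (i + 1)] at hInt
    simp only [one_pow, sub_self, ne_eq, Nat.add_eq_zero_iff, one_ne_zero, and_false,
      not_false_eq_true, zero_pow, mul_zero, zero_mul] at hInt
    have e : i + 1 + j + 1 = i + (j + 1) + 1 := by ring
    rw [e] at hInt
    have hi : ((i:ℝ) + 1) ≠ 0 := by positivity
    apply mul_left_cancel₀ hi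
    rw [sub_eq_zero.1 hInt, Nat.factorial_succ i, Nat.factorial_succ j]
    push_cast
    ring

lemma SV_of_step {A : ℕ → ℝ} {K : ℝ} (hK : 0 ≤ K) {N : ℕ}
    (h : ∀ n ≥ N, |A (n + 1) - A n| ≤ K / n) : SV A := by
  intro ε hε
  refine ⟨min (1 / 2) (ε / (2 * K + 1)), by positivity, lt_of_le_of_lt (min_le_left _ _) (by norm_num),
    max (2 * N) 1, fun n hn k hk1 hk2 => ?_⟩
  set δ := min (1 / 2) (ε / (2 * K + 1)) with hδ
  have hδ1 : δ ≤ 1 / 2 := min_le_left _ _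
  have hδ2 : δ * (2 * K + 1) ≤ ε := by
    rw [← le_div_iff₀ (by positivity)]; exact min_le_right _ _
  have hδ0 : 0 < δ := by positivity
  have hn0 : (0:ℝ) < n := by exact_mod_cast (le_max_right _ _).trans hn
  have hkh : (n : ℝ) / 2 ≤ k := by nlinarith
  have hk0 : (0:ℝ) < k := by linarith
  have hNk : N ≤ k := by
    have : ((2 * N : ℕ) : ℝ) ≤ n := by exact_mod_cast (le_max_left _ _).trans hn
    push_cast at this
    have : (N:ℝ) ≤ k := by linarith
    exact_mod_cast this
  have ind : ∀ d : ℕ, |A (k + d) - A k| ≤ d * (K / k) := by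
    intro d
    induction d with
    | zero => simp
    | succ d ih =>
      have e1 := h (k + d) (by omega)
      have e2 : K / ((k + d : ℕ) : ℝ) ≤ K / k := by
        gcongr; push_cast; linarith [(d.cast_nonneg : (0:ℝ) ≤ d)]
      have e3 : A (k + (d + 1)) - A k = (A (k + d + 1) - A (k + d)) + (A (k + d) - A k) := by
        rw [← add_assoc]; ring
      rw [e3]
      refine (abs_add_le _ _).trans ?_
      push_cast
      linarith
  have e1 := ind (n - k)
  rw [Nat.add_sub_cancel' hk2, Nat.cast_sub hk2] at e1
  refine e1.trans ?_
  have e2 : ((n:ℝ) - k) * (K / k) = ((n - k) * K) / k := by ring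
  rw [e2, div_le_iff₀ hk0]
  have e3 : ((n:ℝ) - k) * K ≤ δ * n * K := by gcongr; linarith
  have e4 : δ * n * K ≤ δ * (2 * k) * K := by gcongr; linarith
  have e5 : δ * (2 * K + 1) * k ≤ ε * k := by gcongr
  nlinarith [mul_pos hδ0 hk0]

lemma SV_congr {A B : ℕ → ℝ} (hA : SV A) (N0 : ℕ) (h : ∀ n ≥ N0, A n = B n) : SV B := by
  intro ε hε
  obtain ⟨δ, h0, h1, N, hN⟩ := hA ε hε
  obtain ⟨N4, hN4⟩ := exists_nat_ge ((N0 : ℝ) / (1 - δ))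
  refine ⟨δ, h0, h1, max N (max N0 N4), fun n hn k hk1 hk2 => ?_⟩
  have hn1 : N ≤ n := le_trans (by simp) hn
  have hn3 : N0 ≤ n := le_trans (by simp) hn
  have hn4 : N4 ≤ n := le_trans (by simp) hn
  have hk3 : N0 ≤ k := by
    have : (N4 : ℝ) ≤ n := by exact_mod_cast hn4
    have h5 := hN4.trans this
    rw [div_le_iff₀ (by linarith)] at h5
    have : (N0 : ℝ) ≤ k := by linarith
    exact_mod_cast this
  rw [← h n hn3, ← h k hk3]
  exact hN n hn1 k hk1 hk2

lemma SV_approx {A : ℕ → ℝ} (N0 : ℕ)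
    (h : ∀ ε > 0, ∃ B, SV B ∧ ∀ n ≥ N0, |A n - B n| ≤ ε) : SV A := by
  intro ε hε
  obtain ⟨B, hB, hAB⟩ := h (ε / 3) (by positivity)
  obtain ⟨δ, h0, h1, N, hN⟩ := hB (ε / 3) (by positivity)
  obtain ⟨N4, hN4⟩ := exists_nat_ge ((N0 : ℝ) / (1 - δ))
  refine ⟨δ, h0, h1, max N (max N0 N4), fun n hn k hk1 hk2 => ?_⟩
  have hn1 : N ≤ n := le_trans (by simp) hn
  have hn3 : N0 ≤ n := le_trans (by simp) hn
  have hn4 : N4 ≤ n := le_trans (by simp) hn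
  have hk3 : N0 ≤ k := by
    have : (N4 : ℝ) ≤ n := by exact_mod_cast hn4
    have h5 := hN4.trans this
    rw [div_le_iff₀ (by linarith)] at h5
    have : (N0 : ℝ) ≤ k := by linarith
    exact_mod_cast this
  have e1 := abs_le.1 (hAB n hn3)
  have e2 := abs_le.1 (hAB k hk3)
  have e3 := abs_le.1 (hN n hn1 k hk1 hk2)
  rw [abs_le]
  constructor <;> linarith [e1.1, e1.2, e2.1, e2.2, e3.1, e3.2]

lemma SV_add {A B : ℕ → ℝ} (hA : SV A) (hB : SV B) : SV (fun n => A n + B n) := by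
  intro ε hε
  obtain ⟨δ, h0, h1, N, hN⟩ := hA (ε / 2) (by positivity)
  obtain ⟨δ', h0', h1', N', hN'⟩ := hB (ε / 2) (by positivity)
  refine ⟨min δ δ', lt_min h0 h0', lt_of_le_of_lt (min_le_left _ _) h1, max N N',
    fun n hn k hk1 hk2 => ?_⟩
  have hn0 : (0:ℝ) ≤ n := n.cast_nonneg
  have e1 := hN n ((le_max_left _ _).trans hn) k (le_trans (by gcongr; exact min_le_left _ _) hk1) hk2
  have e2 := hN' n ((le_max_right _ _).trans hn) k (le_trans (by gcongr; exact min_le_right _ _) hk1) hk2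
  rw [abs_le] at e1 e2 ⊢
  constructor <;> linarith [e1.1, e1.2, e2.1, e2.2]

lemma SV_smul {A : ℕ → ℝ} (c : ℝ) (hA : SV A) : SV (fun n => c * A n) := by
  intro ε hε
  obtain ⟨δ, h0, h1, N, hN⟩ := hA (ε / (|c| + 1)) (by positivity)
  refine ⟨δ, h0, h1, N, fun n hn k hk1 hk2 => ?_⟩
  have e1 := hN n hn k hk1 hk2
  rw [← mul_sub, abs_mul]
  rw [le_div_iff₀ (by positivity)] at e1
  nlinarith [abs_nonneg (A n - A k)]

lemma SV_zero : SV (fun _ => 0) := by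
  intro ε hε
  exact ⟨1 / 2, by norm_num, by norm_num, 0, fun n _ k _ _ => by simpa using hε.le⟩

lemma SV_sum {ι : Type*} (s : Finset ι) (A : ι → ℕ → ℝ) (h : ∀ i ∈ s, SV (A i)) :
    SV (fun n => ∑ i ∈ s, A i n) := by
  classical
  induction s using Finset.induction_on with
  | empty => simpa using SV_zero
  | insert i s hi ih =>
    have : (fun n => ∑ j ∈ insert i s, A j n) = fun n => A i n + ∑ j ∈ s, A j n := by
      funext n; exact Finset.sum_insert hi
    rw [this]
    exact SV_add (h i (by simp)) (ih fun j hj => h j (by simp [hj]))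

/-- integral of Bernstein operator against monomial -/
lemma int_Bm_mono (m a : ℕ) (g : ℕ → ℝ) : ∫ x in (0:ℝ)..1, x ^ a * Bm m g x =
    (∑ k ∈ Finset.range (m + 1), ((k + 1).ascFactorial a : ℝ) * g k) /
      ((m + 1).ascFactorial (a + 1) : ℝ) := by
  have e : ∀ x : ℝ, x ^ a * Bm m g x =
      ∑ k ∈ Finset.range (m + 1), ((m.choose k : ℝ) * g k) * (x ^ (k + a) * (1 - x) ^ (m - k)) := by
    intro x
    rw [Bm, Finset.mul_sum]
    exact Finset.sum_congr rfl fun k _ => by rw [bern]; ring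
  simp_rw [e]
  rw [intervalIntegral.integral_finsetSum
    (fun k _ => by apply Continuous.intervalIntegrable; fun_prop), Finset.sum_div]
  refine Finset.sum_congr rfl fun k hk => ?_
  have hkm : k ≤ m := by have := Finset.mem_range.1 hk; omega
  rw [intervalIntegral.integral_const_mul, beta_nat]
  have e1 : k + a + (m - k) + 1 = m + (a + 1) := by omega
  rw [e1]
  have h1 : ((k.factorial * (k + 1).ascFactorial a : ℕ) : ℝ) = ((k + a).factorial : ℕ) := by
    rw [Nat.factorial_mul_ascFactorial]
  have h2 : ((m.factorial * (m + 1).ascFactorial (a + 1) : ℕ) : ℝ) = ((m + (a + 1)).factorial : ℕ) := by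
    rw [Nat.factorial_mul_ascFactorial]
  have h3 : ((m.choose k * k.factorial * (m - k).factorial : ℕ) : ℝ) = (m.factorial : ℕ) := by
    rw [Nat.choose_mul_factorial_mul_factorial hkm]
  push_cast at h1 h2 h3
  rw [← h1, ← h2, ← h3]
  have : (k.factorial : ℝ) ≠ 0 := by positivity
  have : ((m-k).factorial : ℝ) ≠ 0 := by positivity
  have : (m.choose k : ℝ) ≠ 0 := by
    have := Nat.choose_pos hkm
    positivity
  have : ((m + 1).ascFactorial (a + 1) : ℝ) ≠ 0 := by
    have := Nat.ascFactorial_pos m (a + 1)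
    positivity
  field_simp

lemma ascF_mono {i j : ℕ} (h : i ≤ j) (a : ℕ) : i.ascFactorial a ≤ j.ascFactorial a := by
  induction a with
  | zero => simp
  | succ a ih =>
    rw [Nat.ascFactorial_succ, Nat.ascFactorial_succ]
    exact Nat.mul_le_mul (by omega) ih

lemma SV_mono (s c a : ℕ) (hsc : s ≤ c) (h : ℕ → ℝ) (C : ℝ) (hC : ∀ k : ℕ, |h k| ≤ C * k) :
    SV (fun n => ∫ x in (0:ℝ)..1, x ^ a * (Bm (n - c) (fun k => h (k + s)) x / n)) := by
  have hC0 : 0 ≤ C := by have := (abs_nonneg _).trans (hC 1); simpa using this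
  refine SV_of_step (K := 2 * (C * (a + 3))) (by positivity) (N := 2 * c + 1) ?_
  intro n hn
  obtain ⟨m, rfl⟩ : ∃ m, n = m + c := ⟨n - c, by omega⟩
  have hsub1 : m + c + 1 - c = m + 1 := by omega
  have hsub : m + c - c = m := by omega
  simp only [hsub1, hsub, ← mul_div_assoc]
  rw [intervalIntegral.integral_div, intervalIntegral.integral_div, int_Bm_mono, int_Bm_mono,
    Finset.sum_range_succ _ (m + 1)]
  set S := ∑ k ∈ Finset.range (m + 1), ((k + 1).ascFactorial a : ℝ) * h (k + s) with hS
  have p1 : 0 < ((m + 1).ascFactorial a : ℝ) := by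
    exact_mod_cast Nat.ascFactorial_pos m a
  have p2 : 0 < ((m + 1 + 1).ascFactorial a : ℝ) := by
    exact_mod_cast Nat.ascFactorial_pos (m + 1) a
  have q1 : ((m + 1).ascFactorial (a + 1) : ℝ) = (m + 1 + a) * (m + 1).ascFactorial a := by
    rw [Nat.ascFactorial_succ]; push_cast; ring
  have q2 : ((m + 1 + 1).ascFactorial (a + 1) : ℝ) = (m + 2 + a) * (m + 1 + 1).ascFactorial a := by
    rw [Nat.ascFactorial_succ]; push_cast; ring
  have q3 : ((m:ℝ) + 1) * (m + 1 + 1).ascFactorial a = (m + 1 + a) * (m + 1).ascFactorial a := by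
    have := Nat.succ_ascFactorial (m + 1) a
    exact_mod_cast this
  rw [q2, q1]
  set P := ((m + 1).ascFactorial a : ℝ)
  set Q := ((m + 1 + 1).ascFactorial a : ℝ)
  have hm0 : (0:ℝ) ≤ m := m.cast_nonneg
  have hc0 : (0:ℝ) ≤ c := c.cast_nonneg
  have ha0 : (0:ℝ) ≤ a := a.cast_nonneg
  have hsc' : (s:ℝ) ≤ c := by exact_mod_cast hsc
  have hn' : (c : ℝ) + 1 ≤ m := by exact_mod_cast (by omega : c + 1 ≤ m)
  have hn0 : (0:ℝ) < m + c := by linarith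
  have hSb : |S| ≤ (m + 1) * (P * (C * (m + c))) := by
    rw [hS]
    refine (Finset.abs_sum_le_sum_abs _ _).trans ?_
    have : ∀ k ∈ Finset.range (m + 1), |((k + 1).ascFactorial a : ℝ) * h (k + s)| ≤
        P * (C * (m + c)) := by
      intro k hk
      have hkm : k ≤ m := by have := Finset.mem_range.1 hk; omega
      have hkm' : (k:ℝ) ≤ m := by exact_mod_cast hkm
      rw [abs_mul, Nat.abs_cast]
      have e1 : ((k + 1).ascFactorial a : ℝ) ≤ P := by
        exact Nat.cast_le.2 (ascF_mono (by omega : k + 1 ≤ m + 1) a)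
      have e2 : |h (k + s)| ≤ C * (m + c) := by
        refine (hC _).trans ?_
        push_cast
        gcongr
      gcongr
    refine (Finset.sum_le_card_nsmul _ _ _ this).trans ?_
    rw [Finset.card_range, nsmul_eq_mul]; push_cast; exact le_rfl
  set X := S / ((m + 1 + a) * P) / ((m + c : ℕ) : ℝ) with hX
  have hXb : |X| ≤ C := by
    have hd : 0 < ((m:ℝ) + 1 + a) * P * (m + c) := by positivity
    rw [hX, div_div]; push_cast
    rw [abs_div, abs_of_pos hd, div_le_iff₀ hd]
    refine hSb.trans ?_
    have : 0 ≤ a * (P * (C * (m + c))) := by positivity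
    nlinarith
  set y := h (m + 1 + s) with hy
  have hyb : |y| ≤ C * (m + c + 1) := by
    refine (hC _).trans ?_
    push_cast
    exact mul_le_mul_of_nonneg_left (by linarith) hC0
  have hQ : Q = (m + 1 + a) * P / (m + 1) := by
    rw [← q3]; field_simp
  have hmain : (S + Q * y) / ((m + 2 + a) * Q) / ((m + c + 1 : ℕ) : ℝ) - X =
      -(((m + c) * (a + 1) + (m + a + 2)) / ((m + c + 1) * (m + a + 2)) * X) +
        y / ((m + c + 1) * (m + a + 2)) := by
    rw [hX, hQ]; push_cast
    field_simp
    ring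
  rw [hmain]
  refine (abs_add_le _ _).trans ?_
  rw [abs_neg, abs_mul, abs_div y]
  have hdp : 0 < ((m:ℝ) + c + 1) * (m + a + 2) := by positivity
  rw [abs_of_pos hdp, abs_of_nonneg (by positivity :
    (0:ℝ) ≤ ((m + c) * (a + 1) + (m + a + 2)) / ((m + c + 1) * (m + a + 2)))]
  have f1 : (((m:ℝ) + c) * (a + 1) + (m + a + 2)) / ((m + c + 1) * (m + a + 2)) ≤ (a + 2) / (m + 1) := by
    rw [div_le_div_iff₀ hdp (by positivity)]
    have t1 : ((m:ℝ) + c) * (a + 1) * (m + 1) ≤ (m + c + 1) * (a + 1) * (m + a + 2) :=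
      mul_le_mul (by nlinarith) (by linarith) (by positivity) (by positivity)
    have t2 : ((m:ℝ) + a + 2) * (m + 1) ≤ (m + a + 2) * (m + c + 1) :=
      mul_le_mul_of_nonneg_left (by linarith) (by positivity)
    nlinarith
  have f2 : |y| / (((m:ℝ) + c + 1) * (m + a + 2)) ≤ C / (m + 1) := by
    rw [div_le_div_iff₀ hdp (by positivity)]
    calc |y| * ((m:ℝ) + 1) ≤ C * (m + c + 1) * (m + a + 2) :=
          mul_le_mul hyb (by linarith) (by positivity) (by positivity)
      _ = _ := by ring
  have f3 : (((m:ℝ) + c) * (a + 1) + (m + a + 2)) / ((m + c + 1) * (m + a + 2)) * |X| ≤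
      (a + 2) / (m + 1) * C := by gcongr
  have f4 : ((a:ℝ) + 2) / (m + 1) * C + C / (m + 1) ≤ 2 * (C * (a + 3)) / ((m + c : ℕ) : ℝ) := by
    have : ((a:ℝ) + 2) / (m + 1) * C + C / (m + 1) = C * (a + 3) / (m + 1) := by ring
    rw [this]; push_cast
    rw [div_le_div_iff₀ (by positivity) hn0]
    have : C * (a + 3) * ((m:ℝ) + c) ≤ C * (a + 3) * (2 * (m + 1)) := by gcongr; linarith
    linarith
  linarith

lemma dens_approx (ν : Measure ℝ) [IsProbabilityMeasure ν] (hν : ν ≪ (volume : Measure ℝ))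
    (hsupp : ∀ᵐ x ∂ν, x ∈ Set.Icc (0:ℝ) 1) (ε : ℝ) (hε : 0 < ε) :
    ∃ P : Polynomial ℝ, ∀ (G : ℝ → ℝ) (M : ℝ), Continuous G → (∀ x ∈ Set.Icc (0:ℝ) 1, |G x| ≤ M) →
      |∫ x, G x ∂ν - ∫ x in (0:ℝ)..1, P.eval x * G x| ≤ ε * M := by
  set f : ℝ → ℝ := fun x => (ν.rnDeriv volume x).toReal with hf
  have hfi : Integrable f volume := Measure.integrable_toReal_rnDeriv
  obtain ⟨g, _, hg1, hg2, hg3⟩ := hfi.exists_hasCompactSupport_integral_sub_le (half_pos hε)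
  obtain ⟨P, hP⟩ := exists_polynomial_near_of_continuousOn 0 1 g hg2.continuousOn (ε / 2) (half_pos hε)
  refine ⟨P, fun G M hG hM => ?_⟩
  have hM0 : 0 ≤ M := (abs_nonneg _).trans (hM 0 (by simp))
  have e1 : ∫ x, G x ∂ν = ∫ x in Set.Icc (0:ℝ) 1, f x * G x := by
    calc ∫ x, G x ∂ν = ∫ x, (Set.Icc (0:ℝ) 1).indicator G x ∂ν := by
          apply integral_congr_ae
          filter_upwards [hsupp] with x hx
          rw [Set.indicator_of_mem hx]
      _ = ∫ x, f x • (Set.Icc (0:ℝ) 1).indicator G x := (integral_rnDeriv_smul hν).symm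
      _ = ∫ x, (Set.Icc (0:ℝ) 1).indicator (fun x => f x * G x) x := by
          congr 1; funext x
          by_cases hx : x ∈ Set.Icc (0:ℝ) 1
          · simp [Set.indicator_of_mem hx]
          · simp [Set.indicator_of_notMem hx]
      _ = _ := integral_indicator measurableSet_Icc
  have e2 : ∫ x in (0:ℝ)..1, P.eval x * G x = ∫ x in Set.Icc (0:ℝ) 1, P.eval x * G x := by
    rw [intervalIntegral.integral_of_le zero_le_one, integral_Icc_eq_integral_Ioc]
  have hPc : Continuous fun x => P.eval x := P.continuous
  have hiP : IntegrableOn (fun x => P.eval x) (Set.Icc (0:ℝ) 1) :=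
    hPc.continuousOn.integrableOn_Icc
  have hifP : IntegrableOn (fun x => f x - P.eval x) (Set.Icc (0:ℝ) 1) :=
    hfi.integrableOn.sub hiP
  have hbd : ∀ᵐ x ∂(volume.restrict (Set.Icc (0:ℝ) 1)), ‖G x‖ ≤ M := by
    filter_upwards [ae_restrict_mem measurableSet_Icc] with x hx using hM x hx
  have i1 : IntegrableOn (fun x => f x * G x) (Set.Icc (0:ℝ) 1) :=
    hfi.integrableOn.mul_bdd hG.aestronglyMeasurable hbd
  have i2 : IntegrableOn (fun x => P.eval x * G x) (Set.Icc (0:ℝ) 1) :=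
    hiP.mul_bdd hG.aestronglyMeasurable hbd
  rw [e1, e2, ← integral_sub i1 i2]
  have i3 : IntegrableOn (fun x => ‖f x - g x‖) (Set.Icc (0:ℝ) 1) := (hfi.sub hg3).norm.integrableOn
  calc |∫ x in Set.Icc (0:ℝ) 1, (f x * G x - P.eval x * G x)|
      ≤ ∫ x in Set.Icc (0:ℝ) 1, (‖f x - g x‖ + ε / 2) * M := by
        rw [← Real.norm_eq_abs]
        apply norm_integral_le_of_norm_le
        · exact (i3.add (integrableOn_const (by simp))).mul_const M
        · filter_upwards [ae_restrict_mem measurableSet_Icc] with x hx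
          rw [← sub_mul, norm_mul]
          have h1 := hP x hx
          have h2 : ‖f x - P.eval x‖ ≤ ‖f x - g x‖ + ε / 2 := by
            have : f x - P.eval x = (f x - g x) - (P.eval x - g x) := by ring
            rw [this]
            refine (norm_sub_le _ _).trans ?_
            rw [Real.norm_eq_abs (P.eval x - g x)]
            linarith
          exact mul_le_mul h2 (hM x hx) (norm_nonneg _) (by positivity)
    _ = ((∫ x in Set.Icc (0:ℝ) 1, ‖f x - g x‖) + ε / 2) * M := by
        rw [integral_mul_const, integral_add i3 (integrableOn_const (by simp))]
        simp
    _ ≤ (ε / 2 + ε / 2) * M := by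
        gcongr
        refine le_trans ?_ hg1
        exact setIntegral_le_integral (hfi.sub hg3).norm (Eventually.of_forall fun x => norm_nonneg _)
    _ = ε * M := by ring

lemma sum_formula {Ω : Type*} [MeasurableSpace Ω] (ℙ : Measure Ω) [IsProbabilityMeasure ℙ]
    (V : Ω → ℝ) (hVmeas : Measurable V) (hV01 : ∀ ω, V ω ∈ Set.Icc (0:ℝ) 1)
    (J : Ω → ℕ) (hJ : Measurable J) (m s : ℕ)
    (hdist : ∀ k ≤ m, (ℙ {ω | J ω = k + s}).toReal
      = ∫ ω, (m.choose k : ℝ) * V ω ^ k * (1 - V ω) ^ (m - k) ∂ℙ)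
    (F : Finset ℕ) (hF : ∀ k ≤ m, k + s ∈ F) (h : ℕ → ℝ) :
    ∑ k ∈ F, (ℙ {ω | J ω = k}).toReal * h k = ∫ ω, Bm m (fun k => h (k + s)) (V ω) ∂ℙ := by
  classical
  have hInt : ∀ k, Integrable (fun ω => bern m k (V ω)) ℙ := by
    intro k
    have hc : Continuous (bern m k) := by unfold bern; fun_prop
    refine Integrable.of_bound (hc.measurable.comp hVmeas).aestronglyMeasurable
      (m.choose k : ℝ) (Eventually.of_forall fun ω => ?_)
    have h0 := (hV01 ω).1
    have h1 := (hV01 ω).2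
    have h2 : 0 ≤ 1 - V ω := by linarith
    rw [Real.norm_eq_abs, abs_of_nonneg (bern_nonneg (hV01 ω)), bern]
    have a1 : V ω ^ k ≤ 1 := pow_le_one₀ h0 h1
    have a2 : (1 - V ω) ^ (m - k) ≤ 1 := pow_le_one₀ h2 (by linarith)
    calc (m.choose k : ℝ) * V ω ^ k * (1 - V ω) ^ (m - k) ≤ (m.choose k : ℝ) * 1 * 1 := by gcongr
      _ = _ := by ring
  have hgen : ∀ h : ℕ → ℝ, ∑ k ∈ Finset.range (m + 1), (ℙ {ω | J ω = k + s}).toReal * h (k + s) =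
      ∫ ω, Bm m (fun k => h (k + s)) (V ω) ∂ℙ := by
    intro h
    unfold Bm
    rw [integral_finsetSum _ (fun k _ => (hInt k).mul_const _)]
    refine Finset.sum_congr rfl fun k hk => ?_
    rw [integral_mul_const, hdist k (by have := Finset.mem_range.1 hk; omega)]
    rfl
  have hone : ∑ k ∈ Finset.range (m + 1), (ℙ {ω | J ω = k + s}).toReal = 1 := by
    have := hgen (fun _ => 1)
    simp only [Bm_one, mul_one] at this
    rw [this]; simp
  set S : Finset ℕ := (Finset.range (m + 1)).map (addRightEmbedding s) with hS
  have hSsum : ∀ g : ℕ → ℝ, ∑ k ∈ S, g k = ∑ k ∈ Finset.range (m + 1), g (k + s) := by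
    intro g; rw [hS, Finset.sum_map]; rfl
  have htot : ∀ F : Finset ℕ, ∑ k ∈ F, (ℙ {ω | J ω = k}).toReal ≤ 1 := by
    intro F
    have := sum_measureReal_preimage_singleton (μ := ℙ) F (f := J)
      (fun y _ => hJ (measurableSet_singleton y))
    calc ∑ k ∈ F, (ℙ {ω | J ω = k}).toReal = ∑ b ∈ F, ℙ.real (J ⁻¹' {b}) := rfl
      _ = _ := this
      _ ≤ 1 := measureReal_le_one
  have hzero : ∀ k ∉ S, (ℙ {ω | J ω = k}).toReal = 0 := by
    intro k hk
    have h1 := htot (insert k S)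
    rw [Finset.sum_insert hk, hSsum, hone] at h1
    have h2 : 0 ≤ (ℙ {ω | J ω = k}).toReal := ENNReal.toReal_nonneg
    linarith
  rw [← hgen h, ← hSsum (fun k => (ℙ {ω | J ω = k}).toReal * h k)]
  symm
  apply Finset.sum_subset
  · intro k hk
    rw [hS, Finset.mem_map] at hk
    obtain ⟨j, hj, rfl⟩ := hk
    exact hF j (by have := Finset.mem_range.1 hj; omega)
  · intro k _ hk
    rw [hzero k hk, zero_mul]

lemma abs_max_zero_sub (x y : ℝ) : |max 0 x - max 0 y| ≤ |x - y| := by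
  simpa using abs_max_sub_max_le_max 0 x 0 y

lemma abs_min_one_sub (x y : ℝ) : |min 1 x - min 1 y| ≤ |x - y| := by
  simpa using abs_min_sub_min_le_max 1 x 1 y

lemma int_of_cont {Ω : Type*} [MeasurableSpace Ω] (ℙ : Measure Ω) [IsProbabilityMeasure ℙ]
    {V : Ω → ℝ} (hVmeas : Measurable V) (hV01 : ∀ ω, V ω ∈ Set.Icc (0:ℝ) 1)
    {G : ℝ → ℝ} (hG : Continuous G) : Integrable (fun ω => G (V ω)) ℙ := by
  obtain ⟨C, hC⟩ := isCompact_Icc.exists_bound_of_continuousOn (hG.continuousOn (s := Set.Icc (0:ℝ) 1))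
  exact Integrable.of_bound (hG.measurable.comp hVmeas).aestronglyMeasurable C
    (Eventually.of_forall fun ω => hC _ (hV01 ω))

/-- convergence for Lipschitz test functions -/
lemma lip_conv {Ω : Type*} [MeasurableSpace Ω] (ℙ : Measure Ω) [IsProbabilityMeasure ℙ]
    {V : Ω → ℝ} (hVmeas : Measurable V) (hV01 : ∀ ω, V ω ∈ Set.Icc (0:ℝ) 1)
    {w : ℕ → ℕ → ℝ} {N0 c s : ℕ} (hcN : c < N0)
    (hEE : ∀ n ≥ N0, ∀ h : ℕ → ℝ, EE w n h = ∫ ω, Bm (n - c) (fun k => h (k + s)) (V ω) ∂ℙ)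
    {φ : ℝ → ℝ} {K : ℝ} (hK : 0 ≤ K) (hφ : ∀ x y, |φ x - φ y| ≤ K * |x - y|)
    (ε : ℝ) (hε : 0 < ε) :
    ∃ N : ℕ, ∀ n ≥ N, |EE w n (fun k => φ ((k : ℝ) / n)) - ∫ ω, φ (V ω) ∂ℙ| ≤ ε := by
  have hφc : Continuous φ := by
    have : LipschitzWith (Real.toNNReal K) φ := LipschitzWith.of_dist_le_mul fun x y => by
      rw [Real.coe_toNNReal K hK]; exact hφ x y
    exact this.continuous
  have hsq : Tendsto (fun n : ℕ => Real.sqrt n / n) atTop (𝓝 0) := by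
    have h1 : Tendsto (fun n : ℕ => (Real.sqrt n)⁻¹) atTop (𝓝 0) :=
      tendsto_inv_atTop_zero.comp (Real.tendsto_sqrt_atTop.comp tendsto_natCast_atTop_atTop)
    refine h1.congr fun n => ?_
    rw [Real.sqrt_div_self']; simp
  have hcn : Tendsto (fun n : ℕ => (s + c : ℝ) / n) atTop (𝓝 0) :=
    tendsto_const_div_atTop_nhds_zero_nat _
  have ht : Tendsto (fun n : ℕ => K * (Real.sqrt n / n + (s + c : ℝ) / n)) atTop (𝓝 0) := by
    simpa using (hsq.add hcn).const_mul K
  obtain ⟨N, hN⟩ := eventually_atTop.1 (ht.eventually (ge_mem_nhds hε))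
  refine ⟨max N N0, fun n hn => ?_⟩
  have hn0 : N0 ≤ n := le_trans (le_max_right _ _) hn
  have hcn' : c ≤ n := by omega
  rw [hEE n hn0, ← integral_sub (int_of_cont ℙ hVmeas hV01 (Bm_cont _ _)) (int_of_cont ℙ hVmeas hV01 hφc)]
  have hb : ∀ ω, ‖Bm (n - c) (fun k => φ (((k + s : ℕ) : ℝ) / n)) (V ω) - φ (V ω)‖ ≤ ε := by
    intro ω
    refine (Bm_lip hK hφ (by omega) (by omega) (hV01 ω)).trans ?_
    refine le_trans (le_of_eq ?_) (hN n (le_trans (le_max_left _ _) hn))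
    push_cast [hcn']; ring
  have := norm_integral_le_of_norm_le_const (μ := ℙ) (Eventually.of_forall hb)
  simpa using this

lemma small_mass {Ω : Type*} [MeasurableSpace Ω] (ℙ : Measure Ω) [IsProbabilityMeasure ℙ]
    {V : Ω → ℝ} (hVmeas : Measurable V) (hV01 : ∀ ω, V ω ∈ Set.Icc (0:ℝ) 1)
    (hV0 : ∀ᵐ ω ∂ℙ, V ω ≠ 0)
    {w : ℕ → ℕ → ℝ} (hw : ∀ n k, 0 ≤ w n k) {N0 c s : ℕ} (hcN : c < N0)
    (hEE : ∀ n ≥ N0, ∀ h : ℕ → ℝ, EE w n h = ∫ ω, Bm (n - c) (fun k => h (k + s)) (V ω) ∂ℙ) :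
    SmallMass w := by
  intro δ hδ
  set φ : ℝ → ℝ → ℝ := fun κ x => max 0 (min 1 (2 - x / κ)) with hφd
  have hlim : Tendsto (fun j : ℕ => ∫ ω, φ (1 / ((j : ℝ) + 2)) (V ω) ∂ℙ) atTop (𝓝 (∫ _ω, (0:ℝ) ∂ℙ)) := by
    apply tendsto_integral_of_dominated_convergence (fun _ => (1:ℝ))
    · intro j
      have : Continuous (φ (1 / ((j : ℝ) + 2))) := by simp only [hφd]; fun_prop
      exact (this.measurable.comp hVmeas).aestronglyMeasurable
    · exact integrable_const _
    · intro j
      refine Eventually.of_forall fun ω => ?_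
      simp only [hφd]
      rw [Real.norm_eq_abs, abs_of_nonneg (le_max_left _ _)]
      exact max_le zero_le_one (min_le_left _ _)
    · filter_upwards [hV0] with ω hω
      have hpos : 0 < V ω := lt_of_le_of_ne (hV01 ω).1 (Ne.symm hω)
      apply tendsto_const_nhds.congr'
      obtain ⟨J, hJ⟩ := exists_nat_gt (2 / V ω)
      filter_upwards [eventually_ge_atTop J] with j hj
      simp only [hφd]
      symm
      apply max_eq_left
      refine (min_le_right _ _).trans ?_
      have h1 : (J : ℝ) ≤ j := by exact_mod_cast hj
      rw [div_lt_iff₀ hpos] at hJ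
      rw [div_div_eq_mul_div, div_one]
      nlinarith
  rw [integral_zero] at hlim
  obtain ⟨j, hj⟩ := (hlim.eventually (gt_mem_nhds (half_pos hδ))).exists
  set κ : ℝ := 1 / ((j : ℝ) + 2) with hκ
  have hj0 : (0:ℝ) ≤ j := j.cast_nonneg
  have hκ0 : 0 < κ := by positivity
  have hκ1 : κ < 1 := by rw [hκ, div_lt_one (by positivity)]; linarith
  have hlip : ∀ x y, |φ κ x - φ κ y| ≤ (1 / κ) * |x - y| := by
    intro x y
    have e : (1 / κ) * |x - y| = |(2 - y / κ) - (2 - x / κ)| := by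
      rw [show (2 - y / κ) - (2 - x / κ) = (1 / κ) * (x - y) by ring, abs_mul, abs_of_pos (by positivity : 0 < 1 / κ)]
    rw [e, abs_sub_comm (2 - y / κ)]
    simp only [hφd]
    refine (abs_max_zero_sub _ _).trans ?_
    exact abs_min_one_sub _ _
  obtain ⟨N, hN⟩ := lip_conv ℙ hVmeas hV01 hcN hEE (by positivity : 0 ≤ 1 / κ) hlip (δ / 2) (half_pos hδ)
  refine ⟨κ, hκ0, hκ1, max N 1, fun n hn => ?_⟩
  have h1 := hN n (le_trans (le_max_left _ _) hn)
  have hnp : (0:ℝ) < n := by exact_mod_cast (le_trans (le_max_right _ _) hn)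
  refine le_trans (EE_mono hw n (g := fun k => φ κ ((k : ℝ) / n)) fun k _ => ?_) ?_
  · simp only [hφd]
    split_ifs with h
    · have : (k : ℝ) / n / κ ≤ 1 := by
        rw [div_div, div_le_one (by positivity)]; nlinarith
      exact le_max_of_le_right (le_min le_rfl (by linarith))
    · exact le_max_left _ _
  · have := (abs_le.1 h1).2
    linarith

lemma window_mass {Ω : Type*} [MeasurableSpace Ω] (ℙ : Measure Ω) [IsProbabilityMeasure ℙ]
    {V : Ω → ℝ} (hVmeas : Measurable V) (hV01 : ∀ ω, V ω ∈ Set.Icc (0:ℝ) 1)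
    (hV1 : ∀ᵐ ω ∂ℙ, V ω ≠ 1) (hVtail : ∀ x : ℝ, x < 1 → ℙ {ω | V ω ≤ x} < 1)
    {w : ℕ → ℕ → ℝ} (hw : ∀ n k, 0 ≤ w n k) {N0 c s : ℕ} (hcN : c < N0)
    (hEE : ∀ n ≥ N0, ∀ h : ℕ → ℝ, EE w n h = ∫ ω, Bm (n - c) (fun k => h (k + s)) (V ω) ∂ℙ) :
    WindowMass w := by
  intro δ hδ hδ1
  set φ : ℝ → ℝ → ℝ := fun d x => max 0 (min (x - (1 - δ)) (1 - d - x)) with hφd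
  have hφc : ∀ d, Continuous (φ d) := fun d => by simp only [hφd]; fun_prop
  have hφ0 : ∀ d x, 0 ≤ φ d x := fun d x => le_max_left _ _
  have hpos : 0 < ∫ ω, φ 0 (V ω) ∂ℙ := by
    rw [integral_pos_iff_support_of_nonneg (fun ω => hφ0 0 (V ω)) (int_of_cont ℙ hVmeas hV01 (hφc 0))]
    rw [pos_iff_ne_zero]
    intro hz
    have hae : ∀ᵐ ω ∂ℙ, V ω ≤ 1 - δ := by
      have h2 : ∀ᵐ ω ∂ℙ, ω ∉ Function.support fun ω => φ 0 (V ω) := measure_eq_zero_iff_ae_notMem.1 hz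
      filter_upwards [h2, hV1] with ω h3 h4
      by_contra hcon
      push Not at hcon
      apply h3
      have h5 : V ω < 1 := lt_of_le_of_ne (hV01 ω).2 h4
      rw [Function.mem_support]
      apply ne_of_gt
      exact lt_max_of_lt_right (lt_min (by linarith) (by linarith))
    have h6 := hVtail (1 - δ) (by linarith)
    have h7 : ℙ {ω | V ω ≤ 1 - δ} = 1 := by
      rw [measure_congr (eventuallyEq_univ.2 hae), measure_univ]
    rw [h7] at h6
    exact lt_irrefl _ h6
  set q := ∫ ω, φ 0 (V ω) ∂ℙ with hq
  set d : ℝ := min (q / 2) (1 / 2) with hd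
  have hd0 : 0 < d := lt_min (by linarith) (by norm_num)
  have hdq : d ≤ q / 2 := min_le_left _ _
  have hd1 : d < 1 := lt_of_le_of_lt (min_le_right _ _) (by norm_num)
  have hlip : ∀ x y, |φ d x - φ d y| ≤ 1 * |x - y| := by
    intro x y
    simp only [hφd]
    refine (abs_max_zero_sub _ _).trans ?_
    refine (abs_min_sub_min_le_max _ _ _ _).trans ?_
    rw [one_mul]
    refine max_le (le_of_eq (by congr 1; ring)) (le_of_eq ?_)
    rw [abs_sub_comm x y]; congr 1; ring
  have hInt : q / 2 ≤ ∫ ω, φ d (V ω) ∂ℙ := by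
    have h1 : q - d ≤ ∫ ω, φ d (V ω) ∂ℙ := by
      have e : q - d = ∫ ω, (φ 0 (V ω) - d) ∂ℙ := by
        rw [integral_sub (int_of_cont ℙ hVmeas hV01 (hφc 0)) (integrable_const _)]; simp [hq]
      rw [e]
      apply integral_mono ((int_of_cont ℙ hVmeas hV01 (hφc 0)).sub (integrable_const _))
        (int_of_cont ℙ hVmeas hV01 (hφc d))
      intro ω
      change max 0 (min (V ω - (1 - δ)) (1 - 0 - V ω)) - d ≤ max 0 (min (V ω - (1 - δ)) (1 - d - V ω))
      rw [sub_le_iff_le_add]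
      refine max_le (by linarith [le_max_left 0 (min (V ω - (1 - δ)) (1 - d - V ω))]) ?_
      have h2 : min (V ω - (1 - δ)) (1 - 0 - V ω) - d ≤ min (V ω - (1 - δ)) (1 - d - V ω) :=
        le_min (by linarith [min_le_left (V ω - (1 - δ)) (1 - 0 - V ω)])
          (by linarith [min_le_right (V ω - (1 - δ)) (1 - 0 - V ω)])
      linarith [le_max_right 0 (min (V ω - (1 - δ)) (1 - d - V ω))]
    linarith
  obtain ⟨N, hN⟩ := lip_conv ℙ hVmeas hV01 hcN hEE zero_le_one hlip (q / 4) (by linarith)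
  refine ⟨d, hd0, hd1, q / 4, by linarith, max N 1, fun n hn => ?_⟩
  have h1 := hN n (le_trans (le_max_left _ _) hn)
  have hnp : (0:ℝ) < n := by exact_mod_cast (le_trans (le_max_right _ _) hn)
  refine le_trans ?_ (EE_mono hw n (f := fun k => φ d ((k : ℝ) / n)) fun k hk => ?_)
  · have := (abs_le.1 h1).1
    linarith
  · simp only [hφd]
    split_ifs with h
    · refine max_le zero_le_one ((min_le_left _ _).trans ?_)
      have : (k : ℝ) / n ≤ 1 := by
        rw [div_le_one hnp]; exact_mod_cast hk.le
      linarith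
    · refine max_le le_rfl ?_
      by_contra hcon
      push Not at hcon
      obtain ⟨h2, h3⟩ := lt_min_iff.1 hcon
      apply h
      constructor
      · have : 1 - δ < (k : ℝ) / n := by linarith
        exact ((lt_div_iff₀ hnp).1 this).le
      · have : (k : ℝ) / n < 1 - d := by linarith
        exact ((div_lt_iff₀ hnp).1 this).le

lemma sv_all {Ω : Type*} [MeasurableSpace Ω] (ℙ : Measure Ω) [IsProbabilityMeasure ℙ]
    {V : Ω → ℝ} (hVmeas : Measurable V) (hV01 : ∀ ω, V ω ∈ Set.Icc (0:ℝ) 1)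
    (hVdens : ℙ.map V ≪ (volume : Measure ℝ))
    {w : ℕ → ℕ → ℝ} {N0 c s : ℕ} (hcN : c < N0) (hsc : s ≤ c)
    (hEE : ∀ n ≥ N0, ∀ h : ℕ → ℝ, EE w n h = ∫ ω, Bm (n - c) (fun k => h (k + s)) (V ω) ∂ℙ)
    (h : ℕ → ℝ) (C : ℝ) (hC : ∀ k : ℕ, |h k| ≤ C * k) : SV (fun n => EE w n h / n) := by
  have hC0 : 0 ≤ C := by simpa using (abs_nonneg _).trans (hC 1)
  apply SV_approx N0
  intro ε hε
  have : IsProbabilityMeasure (ℙ.map V) := Measure.isProbabilityMeasure_map hVmeas.aemeasurable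
  have hsupp : ∀ᵐ x ∂(ℙ.map V), x ∈ Set.Icc (0:ℝ) 1 :=
    (ae_map_iff hVmeas.aemeasurable measurableSet_Icc).2 (Eventually.of_forall hV01)
  obtain ⟨P, hP⟩ := dens_approx (ℙ.map V) hVdens hsupp (ε / (C + 1)) (by positivity)
  have hGc : ∀ n : ℕ, Continuous fun x => Bm (n - c) (fun k => h (k + s)) x / n :=
    fun n => (Bm_cont _ _).div_const _
  refine ⟨fun n => ∫ x in (0:ℝ)..1, P.eval x * (Bm (n - c) (fun k => h (k + s)) x / n), ?_, ?_⟩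
  · have e : (fun n : ℕ => ∫ x in (0:ℝ)..1, P.eval x * (Bm (n - c) (fun k => h (k + s)) x / n)) =
        fun n : ℕ => ∑ a ∈ Finset.range (P.natDegree + 1), P.coeff a *
          ∫ x in (0:ℝ)..1, x ^ a * (Bm (n - c) (fun k => h (k + s)) x / n) := by
      funext n
      simp_rw [← intervalIntegral.integral_const_mul]
      rw [← intervalIntegral.integral_finsetSum]
      · congr 1; funext x
        rw [Polynomial.eval_eq_sum_range, Finset.sum_mul]
        exact Finset.sum_congr rfl fun a _ => by ring
      · intro a _
        have := hGc n
        exact Continuous.intervalIntegrable (by fun_prop) _ _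
    rw [e]
    exact SV_sum _ _ fun a _ => SV_smul _ (SV_mono s c a hsc h C hC)
  · intro n hn
    have hnp : (0:ℝ) < n := by exact_mod_cast (by omega : 0 < n)
    have hb := hP _ C (hGc n) (fun x hx => by
      rw [abs_div, abs_of_pos hnp, div_le_iff₀ hnp]
      refine Bm_abs hx fun k hk => (hC _).trans ?_
      have : ((k + s : ℕ) : ℝ) ≤ n := by exact_mod_cast (by omega : k + s ≤ n)
      exact mul_le_mul_of_nonneg_left this hC0)
    have e2 : EE w n h / n = ∫ x, Bm (n - c) (fun k => h (k + s)) x / n ∂(ℙ.map V) := by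
      rw [integral_map hVmeas.aemeasurable (hGc n).aestronglyMeasurable, integral_div, hEE n hn]
    rw [e2]
    refine hb.trans ?_
    rw [div_mul_eq_mul_div, div_le_iff₀ (by positivity)]
    nlinarith

lemma log_moment {Ω : Type*} [MeasurableSpace Ω] (ℙ : Measure Ω) [IsProbabilityMeasure ℙ]
    {V : Ω → ℝ} (hVmeas : Measurable V) (hV01 : ∀ ω, V ω ∈ Set.Icc (0:ℝ) 1)
    {w : ℕ → ℕ → ℝ} {N0 c s : ℕ} (hcN : c + 1 < N0) (hsc : s ≤ c)
    (hEE : ∀ n ≥ N0, ∀ h : ℕ → ℝ, EE w n h = ∫ ω, Bm (n - c) (fun k => h (k + s)) (V ω) ∂ℙ)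
    {b μ : ℝ} (hb : 2 ≤ b) (hEV : (∫ ω, V ω ∂ℙ) = 1 / b)
    (hμ : μ = -b * ∫ ω, V ω * Real.log (V ω) ∂ℙ) (hμ0 : 0 < μ) :
    ∃ T : ℝ, 0 ≤ T ∧ ∀ n ≥ N0, |b * EE w n (fun k => (k : ℝ) * Real.log k) -
      ((n : ℝ) * Real.log n - μ * n)| ≤ T * Real.log (1 + n) := by
  refine ⟨b * (1 + 2 * s) + 2 * c + μ * c, by positivity, fun n hn => ?_⟩
  set m := n - c with hm
  have hmc : (m : ℝ) + c = n := by rw [hm]; exact_mod_cast (by omega : n - c + c = n)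
  have hm1 : 1 ≤ m := by omega
  have hmr : (1:ℝ) ≤ m := by exact_mod_cast hm1
  have hn2 : (2:ℝ) ≤ n := by exact_mod_cast (by omega : 2 ≤ n)
  have hc0 : (0:ℝ) ≤ c := c.cast_nonneg
  have hs0 : (0:ℝ) ≤ s := s.cast_nonneg
  set l := Real.log (1 + n) with hl
  have hl1 : 1 ≤ l := by
    rw [hl, Real.le_log_iff_exp_le (by linarith)]
    linarith [Real.exp_one_lt_d9]
  have hln : Real.log n ≤ l := Real.log_le_log (by linarith) (by linarith)
  have hln0 : 0 ≤ Real.log n := Real.log_nonneg (by linarith)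
  have hVi : Integrable V ℙ := int_of_cont ℙ hVmeas hV01 continuous_id
  have hVli : Integrable (fun ω => V ω * Real.log (V ω)) ℙ :=
    int_of_cont ℙ hVmeas hV01 Real.continuous_mul_log
  have hxi : Integrable (fun ω => (m * V ω) * Real.log (m * V ω)) ℙ :=
    int_of_cont ℙ hVmeas hV01 (G := fun x => (m * x) * Real.log (m * x))
      (Real.continuous_mul_log.comp (continuous_const.mul continuous_id))
  have hxe : b * ∫ ω, (m * V ω) * Real.log (m * V ω) ∂ℙ = m * Real.log m - μ * m := by
    have e : ∀ ω, (m * V ω) * Real.log (m * V ω) = (m * Real.log m) * V ω + m * (V ω * Real.log (V ω)) := by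
      intro ω
      rcases eq_or_ne (V ω) 0 with h | h
      · simp [h]
      · rw [Real.log_mul (by positivity) h]; ring
    simp_rw [e]
    rw [integral_add (hVi.const_mul _) (hVli.const_mul _), integral_const_mul, integral_const_mul, hEV, hμ]
    field_simp
    ring
  have hBi : Integrable (fun ω => Bm m (fun k => ((k + s : ℕ) : ℝ) * Real.log ((k + s : ℕ) : ℝ)) (V ω)) ℙ :=
    int_of_cont ℙ hVmeas hV01 (Bm_cont _ _)
  set X := ∫ ω, (m * V ω) * Real.log (m * V ω) ∂ℙ with hX
  have lo : X ≤ EE w n (fun k => (k : ℝ) * Real.log k) := by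
    rw [hEE n hn, hX]
    apply integral_mono hxi hBi
    intro ω
    exact (Bm_xlogx (hV01 ω)).1.trans (Bm_mono (hV01 ω) fun k hk => (xlogx_shift k s n (by omega) (by omega)).1)
  have hi : EE w n (fun k => (k : ℝ) * Real.log k) ≤ X + (1 + s * (1 + Real.log n)) := by
    have e : X + (1 + s * (1 + Real.log n)) =
        ∫ ω, ((m * V ω) * Real.log (m * V ω) + (1 + s * (1 + Real.log n))) ∂ℙ := by
      rw [integral_add hxi (integrable_const _)]; simp [hX]
    rw [hEE n hn, e]
    apply integral_mono hBi (hxi.add (integrable_const _))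
    intro ω
    refine le_trans (Bm_mono (g := fun k => (k : ℝ) * Real.log k + (s * (1 + Real.log n)) * 1) (hV01 ω)
      fun k hk => ?_) ?_
    · rw [mul_one]; exact (xlogx_shift k s n (by omega) (by omega)).2
    · rw [Bm_add, Bm_smul, Bm_one]
      have := (Bm_xlogx (m := m) (hV01 ω)).2
      simp only [Pi.add_apply]
      linarith
  have hsh := xlogx_shift m c n (by omega) (by omega)
  have hmn : m + c = n := by omega
  rw [hmn] at hsh
  have hμc : μ * n = μ * m + μ * c := by rw [← hmc]; ring
  have g1 : s * (1 + Real.log n) ≤ 2 * s * l := by nlinarith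
  have g2 : c * (1 + Real.log n) ≤ 2 * c * l := by nlinarith
  have g3 : μ * c ≤ μ * c * l := by nlinarith [mul_nonneg hμ0.le hc0]
  have g4 : b * (1 + s * (1 + Real.log n)) ≤ b * (1 + 2 * s) * l := by
    rw [mul_assoc]; apply mul_le_mul_of_nonneg_left _ (by linarith); linarith
  have g5 : 0 ≤ b * (1 + 2 * s) * l := by positivity
  have g6 : 0 ≤ c * l := by positivity
  have g7 : 0 ≤ μ * c * l := by positivity
  have lo' := mul_le_mul_of_nonneg_left lo (by linarith : 0 ≤ b)
  have hi' := mul_le_mul_of_nonneg_left hi (by linarith : 0 ≤ b)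
  rw [mul_add] at hi'
  rw [abs_le]
  constructor <;> nlinarith [hsh.1, hsh.2]

/-- (Theorem 1, expected internal path length of random split trees.)
Assume `s₀ ≥ 1`. If `(p_n)` satisfies `p_n = O(n log n)` and, for all large `n`, the recursion
`p_n = b·Σ_{k=0}^{n-s₀} P(I_n = k)·p_k + n - s₀`, where `I_n` is the size of the first subtree
of a random split tree with `n` balls with splitter `V`, then there is a constant `c_p` with
`p_n = (1/μ)·n·log n + c_p·n + o(n)`, where `μ = -b·E[V·log V]`. -/
theorem stmt0
    (b s₀ s₁ : ℕ) (hb : 2 ≤ b) (hs₀ : 1 ≤ s₀)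
    {Ω : Type*} [MeasurableSpace Ω] (ℙ : Measure Ω) [IsProbabilityMeasure ℙ]
    (V : Ω → ℝ) (hVmeas : Measurable V)
    (hV01 : ∀ ω, V ω ∈ Set.Icc (0:ℝ) 1)
    (hVdens : ℙ.map V ≪ (volume : Measure ℝ))
    (hVtail : ∀ x : ℝ, x < 1 → ℙ {ω | V ω ≤ x} < 1)
    (hEV : (∫ ω, V ω ∂ℙ) = 1 / b)
    (I : ℕ → Ω → ℕ) (hImeas : ∀ n, Measurable (I n))
    (hIdist : ∀ n : ℕ, s₀ + b * s₁ ≤ n → ∀ k : ℕ, k ≤ n - s₀ - b * s₁ →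
      (ℙ {ω | I n ω = k + s₁}).toReal
        = ∫ ω, ((n - s₀ - b * s₁).choose k : ℝ) * V ω ^ k
            * (1 - V ω) ^ (n - s₀ - b * s₁ - k) ∂ℙ)
    (μ : ℝ) (hμ : μ = -(b : ℝ) * ∫ ω, V ω * Real.log (V ω) ∂ℙ) (hμpos : 0 < μ)
    (p : ℕ → ℝ)
    (hpO : (fun n : ℕ => p n) =O[atTop] fun n : ℕ => (n : ℝ) * Real.log n)
    (nstar : ℕ)
    (hrec : ∀ n : ℕ, nstar ≤ n →
      p n = (b : ℝ) * (∑ k ∈ Finset.range (n - s₀ + 1), (ℙ {ω | I n ω = k}).toReal * p k)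
              + ((n : ℝ) - s₀)) :
    ∃ cp : ℝ,
      (fun n : ℕ => p n - (1 / μ) * n * Real.log n - cp * n) =o[atTop] fun n : ℕ => (n : ℝ) := by

  set c : ℕ := s₀ + b * s₁ with hc
  have hsc : s₁ ≤ c := by nlinarith
  set N0 : ℕ := max nstar (c + 2) with hN0
  have hcN : c + 1 < N0 := lt_of_lt_of_le (by omega) (le_max_right _ _)
  set w : ℕ → ℕ → ℝ := fun n k => (ℙ {ω | I n ω = k}).toReal with hwd
  have hw : ∀ n k, 0 ≤ w n k := fun n k => ENNReal.toReal_nonneg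
  have hbr : (2:ℝ) ≤ b := by exact_mod_cast hb
  have hdist : ∀ n ≥ N0, ∀ k ≤ n - c, (ℙ {ω | I n ω = k + s₁}).toReal
      = ∫ ω, ((n - c).choose k : ℝ) * V ω ^ k * (1 - V ω) ^ (n - c - k) ∂ℙ := by
    intro n hn k hk
    have h := hIdist n (by omega) k (by rw [Nat.sub_sub]; exact hk)
    rw [Nat.sub_sub] at h
    exact h
  have hmul : s₁ ≤ b * s₁ := by nlinarith
  have hEE : ∀ n ≥ N0, ∀ h : ℕ → ℝ, EE w n h = ∫ ω, Bm (n - c) (fun k => h (k + s₁)) (V ω) ∂ℙ := by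
    intro n hn h
    exact sum_formula ℙ V hVmeas hV01 (I n) (hImeas n) (n - c) s₁ (hdist n hn) (Finset.range n)
      (fun k hk => Finset.mem_range.2 (by omega)) h
  have hEE' : ∀ n ≥ N0, ∀ h : ℕ → ℝ,
      ∑ k ∈ Finset.range (n - s₀ + 1), (ℙ {ω | I n ω = k}).toReal * h k = EE w n h := by
    intro n hn h
    rw [hEE n hn h]
    exact sum_formula ℙ V hVmeas hV01 (I n) (hImeas n) (n - c) s₁ (hdist n hn) _
      (fun k hk => Finset.mem_range.2 (by omega)) h
  have hne : ∀ a : ℝ, ∀ᵐ ω ∂ℙ, V ω ≠ a := by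
    intro a
    have h1 : ∀ᵐ x ∂(ℙ.map V), x ≠ a := hVdens.ae_le (Measure.ae_ne volume a)
    exact ae_of_ae_map hVmeas.aemeasurable h1
  have h1 : ∀ n ≥ N0, EE w n (fun _ => 1) = 1 := by
    intro n hn
    rw [hEE n hn]; simp [Bm_one]
  have hVi : Integrable V ℙ := int_of_cont ℙ hVmeas hV01 continuous_id
  have h2 : ∀ n ≥ N0, (b:ℝ) * EE w n (fun k => (k:ℝ)) = n - (s₀ : ℝ) := by
    intro n hn
    have e : ∀ x, Bm (n - c) (fun k => ((k + s₁ : ℕ) : ℝ)) x = ((n - c : ℕ) : ℝ) * x + s₁ := by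
      intro x
      have : (fun k : ℕ => ((k + s₁ : ℕ) : ℝ)) = fun k : ℕ => (k : ℝ) + s₁ * 1 := by
        funext k; push_cast; ring
      rw [this, Bm_add, Bm_smul, Bm_one, Bm_id, mul_one]
    have hcn : c ≤ n := by omega
    rw [hEE n hn]
    simp_rw [e]
    rw [integral_add (hVi.const_mul _) (integrable_const _), integral_const_mul, hEV, Nat.cast_sub hcn, hc]
    simp only [integral_const, probReal_univ, smul_eq_mul, one_mul]
    push_cast
    field_simp
    ring
  obtain ⟨T, hT0, hT⟩ := log_moment ℙ hVmeas hV01 hcN hsc hEE hbr hEV hμ hμpos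
  set r : ℕ → ℝ := fun k => if k = 0 then 0 else p k - (1 / μ) * (k * Real.log k) with hrd
  have hrp : ∀ k, r k = p k + (-(1 / μ)) * (k * Real.log k) + (-(p 0)) * (if k = 0 then 1 else 0) := by
    intro k
    by_cases hk : k = 0
    · simp [hrd, hk]
    · simp only [hrd, hk, if_false]; ring
  have hr : ∀ n ≥ N0, |r n - b * EE w n r| ≤ ((1 / μ) * T + b * |p 0| + s₀) * Real.log (1 + n) := by
    intro n hn
    have hn0 : n ≠ 0 := by omega
    have hn2 : (2:ℝ) ≤ n := by exact_mod_cast (by omega : 2 ≤ n)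
    have hl1 : 1 ≤ Real.log (1 + n) := by
      rw [Real.le_log_iff_exp_le (by linarith)]
      linarith [Real.exp_one_lt_d9]
    have e0 : EE w n r = EE w n p + (-(1 / μ)) * EE w n (fun k => (k:ℝ) * Real.log k)
        + (-(p 0)) * EE w n (fun k => if k = 0 then 1 else 0) := by
      rw [← EE_smul, ← EE_smul, ← EE_add, ← EE_add]
      congr 1; funext k; exact hrp k
    have e1 : p n = b * EE w n p + ((n:ℝ) - s₀) := by
      rw [← hEE' n hn p]; exact hrec n (le_trans (le_max_left _ _) hn)
    have e2 : r n = p n - (1 / μ) * (n * Real.log n) := by simp [hrd, hn0]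
    have z0 : 0 ≤ EE w n (fun k => if k = 0 then 1 else 0) := by
      refine Finset.sum_nonneg fun k _ => mul_nonneg (hw _ _) ?_
      dsimp only
      split_ifs <;> norm_num
    have z1 : EE w n (fun k => if k = 0 then 1 else 0) ≤ 1 := by
      refine le_trans (EE_mono hw n fun k _ => ?_) (h1 n hn).le
      split_ifs <;> norm_num
    set Z := EE w n (fun k => if k = 0 then 1 else 0) with hZ
    set Y := EE w n (fun k => (k:ℝ) * Real.log k) with hY
    have e3 : r n - b * EE w n r = (1 / μ) * (b * Y - ((n:ℝ) * Real.log n - μ * n)) + b * p 0 * Z - s₀ := by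
      rw [e2, e0]
      have : (1 / μ) * (μ * n) = n := by field_simp
      linear_combination e1 - this
    rw [e3]
    have t1 : |(1 / μ) * (b * Y - ((n:ℝ) * Real.log n - μ * n))| ≤ (1 / μ) * T * Real.log (1 + n) := by
      rw [abs_mul, abs_of_pos (by positivity : 0 < 1 / μ), mul_assoc]
      exact mul_le_mul_of_nonneg_left (hT n hn) (by positivity)
    have t2 : |b * p 0 * Z| ≤ b * |p 0| * Real.log (1 + n) := by
      rw [abs_mul, abs_mul, abs_of_nonneg z0, abs_of_nonneg (by linarith : (0:ℝ) ≤ b)]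
      exact mul_le_mul_of_nonneg_left (z1.trans hl1) (by positivity)
    have t3 : |(s₀:ℝ)| ≤ s₀ * Real.log (1 + n) := by
      rw [abs_of_nonneg s₀.cast_nonneg]
      nlinarith [(s₀.cast_nonneg : (0:ℝ) ≤ s₀)]
    refine (abs_sub _ _).trans ?_
    refine (add_le_add (abs_add_le _ _) le_rfl).trans ?_
    linarith
  obtain ⟨L, hL⟩ := abstract_conv hw hbr s₀.cast_nonneg (by positivity) h1 h2
    (small_mass ℙ hVmeas hV01 (hne 0) hw (by omega) hEE)
    (window_mass ℙ hVmeas hV01 (hne 1) hVtail hw (by omega) hEE)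
    (fun h C hC => sv_all ℙ hVmeas hV01 hVdens (by omega) hsc hEE h C hC)
    r (by simp [hrd]) hr
  refine ⟨L, ?_⟩
  have hLo : (fun n : ℕ => r n / n - L) =o[atTop] fun _ : ℕ => (1:ℝ) := by
    rw [isLittleO_one_iff]
    simpa using hL.sub_const L
  have hmulo := hLo.mul_isBigO (isBigO_refl (fun n : ℕ => (n:ℝ)) atTop)
  refine hmulo.congr' ?_ (Eventually.of_forall fun n => by simp)
  filter_upwards [eventually_ge_atTop 1] with n hn
  have hn0 : n ≠ 0 := by omega
  have hnr : (n:ℝ) ≠ 0 := by exact_mod_cast hn0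
  simp only [hrd, hn0, if_false]
  field_simp
end

section
/- There exists exactly one probability measure ρ on ℝ with mean 0 and finite second moment with the following property: if X^(1), …, X^(b) are i.i.d. random variables with law ρ, independent of (V_1, …, V_b), then the random variable Σ_{k=1}^b V_k·X^(k) + 1 + (1/μ)·Σ_{k=1}^b V_k·log V_k also has law ρ. -/
open MeasureTheory Filter Topology Asymptotics


theorem aux_option {α Ω : Type*} [MeasurableSpace Ω] (ℙ : Measure Ω) [IsProbabilityMeasure ℙ] :
    Measure.map (fun q : (α → Ω) × Ω => fun o : Option α => o.elim q.2 q.1)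
      ((Measure.infinitePi fun _ : α => ℙ).prod ℙ) = Measure.infinitePi fun _ : Option α => ℙ := by
  classical
  have hm : Measurable (fun q : (α → Ω) × Ω => fun o : Option α => o.elim q.2 q.1) := by
    refine measurable_pi_lambda _ fun o => ?_
    cases o with
    | none => exact measurable_snd
    | some a => exact (measurable_pi_apply a).comp measurable_fst
  refine Measure.eq_infinitePi _ fun s t ht => ?_
  rw [Measure.map_apply hm (MeasurableSet.pi s.countable_toSet fun i _ => ht i)]
  have : (fun q : (α → Ω) × Ω => fun o : Option α => o.elim q.2 q.1) ⁻¹' (Set.pi s t) =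
      (Set.pi (Finset.eraseNone s) fun a => t (some a)) ×ˢ
        (if none ∈ s then t none else Set.univ) := by
    ext ⟨x, w⟩
    simp only [Set.mem_preimage, Set.mem_pi, Set.mem_prod, Finset.mem_coe, Finset.mem_eraseNone,
      Option.forall]
    split_ifs with h <;> simp [h, and_comm]
  rw [this, Measure.prod_prod, Measure.infinitePi_pi _ (fun i _ => ht _)]
  by_cases h : none ∈ s
  · have h2 : s = Finset.insertNone (Finset.eraseNone s) := by
      rw [Finset.insertNone_eraseNone, Finset.insert_eq_of_mem h]
    conv_rhs => rw [h2]
    rw [Finset.prod_insertNone, if_pos h, mul_comm]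
  · have h2 : s = (Finset.eraseNone s).map Function.Embedding.some := by
      rw [Finset.map_some_eraseNone, Finset.erase_eq_of_notMem h]
    conv_rhs => rw [h2]
    rw [Finset.prod_map, if_neg h]
    simp

theorem exists_selfsim (b : ℕ) (hb : 0 < b) {Ω : Type*} [MeasurableSpace Ω] (ℙ : Measure Ω)
    [IsProbabilityMeasure ℙ] :
    ∃ (P : Measure (ℕ → Ω)) (_ : IsProbabilityMeasure P)
      (G : (ℕ → Ω) → (Fin b → ℕ → Ω) × Ω),
      MeasurePreserving G P ((Measure.pi fun _ => P).prod ℙ) := by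
  have : NeZero b := ⟨hb.ne'⟩
  obtain ⟨e⟩ : Nonempty (Option (Fin b × ℕ) ≃ ℕ) := nonempty_equiv_of_countable
  refine ⟨Measure.infinitePi fun _ => ℙ, inferInstance,
    fun s => (fun k n => s (e (some (k, n))), s (e none)), ?_, ?_⟩
  · fun_prop
  · have h1 := Measure.infinitePi_map_piCongrLeft (X := fun _ => Ω) (fun _ : ℕ => ℙ) e
    have h2 := aux_option (α := Fin b × ℕ) ℙ
    have h3 := Measure.infinitePi_map_curry (fun (_ : Fin b) (_ : ℕ) => ℙ)
    rw [Measure.infinitePi_eq_pi (ι := Fin b)] at h3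
    have hm : Measurable (fun q : (Fin b × ℕ → Ω) × Ω =>
        fun o : Option (Fin b × ℕ) => o.elim q.2 q.1) := by
      refine measurable_pi_lambda _ fun o => ?_
      cases o with
      | none => exact measurable_snd
      | some a => exact (measurable_pi_apply a).comp measurable_fst
    rw [← h3, ← h1, ← h2, Measure.map_map (MeasurableEquiv.measurable _) hm, Measure.map_map (by fun_prop) ((MeasurableEquiv.measurable _).comp hm)]
    have h4 := Measure.map_prod_map (Measure.infinitePi fun _ : Fin b × ℕ => ℙ) ℙ
      (MeasurableEquiv.curry (Fin b) ℕ Ω).measurable measurable_id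
    rw [Measure.map_id] at h4
    rw [h4]
    congr 1
    funext q
    have key : ∀ (y : Option (Fin b × ℕ) → Ω) o,
      (MeasurableEquiv.piCongrLeft (fun _ => Ω) e) y (e o) = y o := fun y o => by
        exact Equiv.piCongrLeft_apply_apply (fun _ => Ω) e y o
    simp only [Function.comp, key]
    rfl

theorem aux_term {b : ℕ} {S Ω : Type*} [MeasurableSpace Ω] [MeasurableSpace S] (ℙ : Measure Ω)
    [IsProbabilityMeasure ℙ] (P : Measure S) [IsProbabilityMeasure P]
    (V : Ω → Fin b → ℝ) (hVmeas : Measurable V)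
    (hV01 : ∀ ω i, V ω i ∈ Set.Icc (0:ℝ) 1) (f : S → ℝ) (hf : MemLp f 2 P) :
    MemLp (fun q : (Fin b → S) × Ω => ∑ k, V q.2 k * f (q.1 k)) 2
      ((Measure.pi fun _ => P).prod ℙ) := by
  refine memLp_finsetSum _ fun k _ => ?_
  have h1 : MeasurePreserving (fun q : (Fin b → S) × Ω => q.1 k)
      ((Measure.pi fun _ => P).prod ℙ) P :=
    (measurePreserving_eval (fun _ => P) k).comp measurePreserving_fst
  have h2 := hf.comp_measurePreserving h1
  refine h2.of_le ?_ ?_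
  · exact (by fun_prop : Measurable fun q : (Fin b → S) × Ω => V q.2 k).aestronglyMeasurable.mul h2.1
  · refine ae_of_all _ fun q => ?_
    rw [norm_mul]
    have := hV01 q.2 k
    have h3 : ‖V q.2 k‖ ≤ 1 := by rw [Real.norm_eq_abs, abs_le]; constructor <;> linarith [this.1, this.2]
    exact mul_le_of_le_one_left (norm_nonneg _) h3

theorem aux_mean {b : ℕ} {S Ω : Type*} [MeasurableSpace Ω] [MeasurableSpace S] (ℙ : Measure Ω)
    [IsProbabilityMeasure ℙ] (P : Measure S) [IsProbabilityMeasure P]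
    (V : Ω → Fin b → ℝ) (f : S → ℝ) (hf : MemLp f 2 P) (h0 : ∫ s, f s ∂P = 0) (ω : Ω) :
    ∫ x : Fin b → S, ∑ k, V ω k * f (x k) ∂(Measure.pi fun _ => P) = 0 := by
  have hmp : ∀ k, MeasurePreserving (fun x : Fin b → S => x k) (Measure.pi fun _ => P) P :=
    fun k => measurePreserving_eval (fun _ => P) k
  have hi : ∀ k, ∫ x : Fin b → S, f (x k) ∂(Measure.pi fun _ => P) = 0 := fun k => by
    have h := integral_map (hmp k).aemeasurable (f := f) (by rw [(hmp k).map_eq]; exact hf.1)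
    rw [(hmp k).map_eq] at h
    exact h.symm.trans h0
  rw [integral_finsetSum]
  · simp [integral_const_mul, hi]
  · intro k _
    exact ((hf.comp_measurePreserving (hmp k)).integrable (by norm_num)).const_mul _

theorem aux_mean2 {b : ℕ} {S Ω : Type*} [MeasurableSpace Ω] [MeasurableSpace S] (ℙ : Measure Ω)
    [IsProbabilityMeasure ℙ] (P : Measure S) [IsProbabilityMeasure P]
    (V : Ω → Fin b → ℝ) (hVmeas : Measurable V)
    (hV01 : ∀ ω i, V ω i ∈ Set.Icc (0:ℝ) 1)
    (f : S → ℝ) (hf : MemLp f 2 P) (h0 : ∫ s, f s ∂P = 0) :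
    ∫ q : (Fin b → S) × Ω, ∑ k, V q.2 k * f (q.1 k) ∂((Measure.pi fun _ => P).prod ℙ) = 0 := by
  have h := aux_term ℙ P V hVmeas hV01 f hf
  rw [integral_prod_symm _ (h.integrable (by norm_num))]
  simp [aux_mean ℙ P V f hf h0]

theorem aux_sq {b : ℕ} {S Ω : Type*} [MeasurableSpace Ω] [MeasurableSpace S] (ℙ : Measure Ω)
    [IsProbabilityMeasure ℙ] (P : Measure S) [IsProbabilityMeasure P]
    (V : Ω → Fin b → ℝ) (hVmeas : Measurable V)
    (hV01 : ∀ ω i, V ω i ∈ Set.Icc (0:ℝ) 1)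
    (f : S → ℝ) (hf : MemLp f 2 P) (h0 : ∫ s, f s ∂P = 0) :
    ∫ q : (Fin b → S) × Ω, (∑ k, V q.2 k * f (q.1 k))^2 ∂((Measure.pi fun _ => P).prod ℙ) =
      (∫ ω, ∑ k, V ω k ^ 2 ∂ℙ) * ∫ s, f s ^ 2 ∂P := by
  have h := aux_term ℙ P V hVmeas hV01 f hf
  rw [integral_prod_symm _ h.integrable_sq, ← integral_mul_const]
  congr 1
  funext ω
  have hv := ProbabilityTheory.variance_sum_pi (μ := fun _ : Fin b => P)
    (X := fun k s => V ω k * f s) (fun k => hf.const_mul _)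
  have hmp : ∀ k, MeasurePreserving (fun x : Fin b → S => x k) (Measure.pi fun _ => P) P :=
    fun k => measurePreserving_eval (fun _ => P) k
  have e : (∑ i : Fin b, fun (x : Fin b → S) => V ω i * f (x i)) = 
    fun x => ∑ i, V ω i * f (x i) := by
      ext x; simp
  rw [e, ProbabilityTheory.variance_of_integral_eq_zero _ (aux_mean ℙ P V f hf h0 ω)] at hv
  · rw [hv, Finset.sum_mul]
    refine Finset.sum_congr rfl fun k _ => ?_
    rw [ProbabilityTheory.variance_const_mul, ProbabilityTheory.variance_of_integral_eq_zero hf.1.aemeasurable h0]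
  · refine Finset.aemeasurable_fun_sum _ fun k _ => ?_
    exact ((hf.comp_measurePreserving (hmp k)).1.aemeasurable).const_mul _

theorem aux_norm {S : Type*} [MeasurableSpace S] (P : Measure S) (f : Lp ℝ 2 P) :
    ‖f‖ ^ 2 = ∫ s, f s ^ 2 ∂P := by
  rw [← real_inner_self_eq_norm_sq, L2.inner_def]
  simp [sq]

theorem exists_fix {b : ℕ} {S Ω : Type*} [MeasurableSpace Ω] [MeasurableSpace S] (ℙ : Measure Ω)
    [IsProbabilityMeasure ℙ] (P : Measure S) [IsProbabilityMeasure P]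
    (V : Ω → Fin b → ℝ) (hVmeas : Measurable V)
    (hV01 : ∀ ω i, V ω i ∈ Set.Icc (0:ℝ) 1)
    (hc : ∫ ω, ∑ k, V ω k ^ 2 ∂ℙ < 1)
    (C : Ω → ℝ) (hC : MemLp C 2 ℙ) (hC0 : ∫ ω, C ω ∂ℙ = 0)
    (G : S → (Fin b → S) × Ω) (hG : MeasurePreserving G P ((Measure.pi fun _ => P).prod ℙ)) :
    ∃ f : S → ℝ, Measurable f ∧ MemLp f 2 P ∧ ∫ s, f s ∂P = 0 ∧
      f =ᵐ[P] fun s => (∑ k, V (G s).2 k * f ((G s).1 k)) + C (G s).2 := by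
  set c := ∫ ω, ∑ k, V ω k ^ 2 ∂ℙ with hcdef
  have hc0 : 0 ≤ c := integral_nonneg fun ω => Finset.sum_nonneg fun k _ => sq_nonneg _
  let Q := (Measure.pi fun _ : Fin b => P).prod ℙ
  let F : (S → ℝ) → (Fin b → S) × Ω → ℝ := fun f q => (∑ k, V q.2 k * f (q.1 k)) + C q.2
  have hCQ : MemLp (fun q : (Fin b → S) × Ω => C q.2) 2 Q :=
    hC.comp_measurePreserving measurePreserving_snd
  have hF : ∀ f : S → ℝ, MemLp f 2 P → MemLp (F f) 2 Q := fun f hf =>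
    (aux_term ℙ P V hVmeas hV01 f hf).add hCQ
  let cen : Lp ℝ 2 P → S → ℝ := fun f s => f s - ∫ u, f u ∂P
  have hcen : ∀ f, MemLp (cen f) 2 P := fun f => (Lp.memLp f).sub (memLp_const _)
  have hcen0 : ∀ f, ∫ s, cen f s ∂P = 0 := fun f => by
    simp only [cen]
    rw [integral_sub ((Lp.memLp f).integrable (by norm_num)) (integrable_const _)]
    simp
  let T : Lp ℝ 2 P → Lp ℝ 2 P := fun f =>
    ((hF _ (hcen f)).comp_measurePreserving hG).toLp
  have hT : ∀ f, T f =ᵐ[P] fun s => F (cen f) (G s) := fun f => MemLp.coeFn_toLp _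
  have hdist : ∀ f h, ‖T f - T h‖ ^ 2 ≤ c * ‖f - h‖ ^ 2 := by
    intro f h
    have hg := (hcen f).sub (hcen h)
    have hg0 : ∫ s, (cen f - cen h) s ∂P = 0 := by
      simp only [Pi.sub_apply]
      rw [integral_sub ((hcen f).integrable (by norm_num)) ((hcen h).integrable (by norm_num)),
        hcen0, hcen0, sub_zero]
    have e1 : ‖T f - T h‖ ^ 2 =
        ∫ s, (∑ k, V (G s).2 k * (cen f - cen h) ((G s).1 k)) ^ 2 ∂P := by
      rw [aux_norm]
      refine integral_congr_ae ?_
      filter_upwards [hT f, hT h, Lp.coeFn_sub (T f) (T h)] with s h1 h2 h3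
      rw [h3, Pi.sub_apply, h1, h2]
      simp only [F, Pi.sub_apply, mul_sub, Finset.sum_sub_distrib]
      ring
    have e2 := aux_sq ℙ P V hVmeas hV01 _ hg hg0
    have hme := (aux_term ℙ P V hVmeas hV01 _ hg).integrable_sq.1
    rw [← hG.map_eq, integral_map hG.aemeasurable (by rw [hG.map_eq]; exact hme)] at e2
    rw [e1, e2]
    refine mul_le_mul_of_nonneg_left ?_ hc0
    have e3 : ∫ s, (cen f - cen h) s ^ 2 ∂P = ProbabilityTheory.variance (f - h : Lp ℝ 2 P) P := by
      rw [ProbabilityTheory.variance_eq_integral (Lp.memLp _).1.aemeasurable]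
      have : ∫ u, (f - h : Lp ℝ 2 P) u ∂P = (∫ u, f u ∂P) - ∫ u, h u ∂P := by
        rw [← integral_sub ((Lp.memLp f).integrable (by norm_num))
          ((Lp.memLp h).integrable (by norm_num))]
        exact integral_congr_ae (Lp.coeFn_sub f h)
      refine integral_congr_ae ?_
      filter_upwards [Lp.coeFn_sub f h] with s hs
      simp only [Pi.sub_apply, cen, this, hs]
      ring
    rw [e3, aux_norm]
    exact ProbabilityTheory.variance_le_expectation_sq (Lp.memLp _).1
  have hK : ContractingWith (Real.toNNReal (Real.sqrt c)) T := by
    refine ⟨?_, LipschitzWith.of_dist_le_mul fun f h => ?_⟩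
    · rw [← NNReal.coe_lt_coe]
      rw [Real.coe_toNNReal _ (Real.sqrt_nonneg c), NNReal.coe_one]
      rw [Real.sqrt_lt' one_pos]; simpa using hc
    · rw [Real.coe_toNNReal _ (Real.sqrt_nonneg c), dist_eq_norm, dist_eq_norm]
      refine abs_le_of_sq_le_sq' ?_ (by positivity) |>.2
      rw [mul_pow, Real.sq_sqrt hc0]
      exact hdist f h
  let f := hK.fixedPoint
  have hf : T f = f := hK.fixedPoint_isFixedPt
  have hfae : f =ᵐ[P] fun s => F (cen f) (G s) := by
    have := hT f
    rwa [hf] at this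
  have hm0 : ∫ s, f s ∂P = 0 := by
    rw [integral_congr_ae hfae]
    have hme := (hF _ (hcen f)).1
    have : ∫ s, F (cen f) (G s) ∂P = ∫ q, F (cen f) q ∂Q := by
      rw [show Q = P.map G from hG.map_eq.symm, integral_map hG.aemeasurable]
      rw [hG.map_eq]; exact hme
    rw [this]
    simp only [F]
    rw [integral_add ((aux_term ℙ P V hVmeas hV01 _ (hcen f)).integrable (by norm_num))
      (hCQ.integrable (by norm_num)), aux_mean2 ℙ P V hVmeas hV01 _ (hcen f) (hcen0 f)]
    have h2 := integral_map (measurePreserving_snd (μ := Measure.pi fun _ : Fin b => P) (ν := ℙ)).aemeasurable (f := C)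
      (by rw [measurePreserving_snd.map_eq]; exact hC.1)
    rw [measurePreserving_snd.map_eq] at h2
    rw [← h2, hC0, zero_add]
  refine ⟨f, (Lp.stronglyMeasurable f).measurable, Lp.memLp f, hm0, ?_⟩
  have : cen f = f := by funext s; simp [cen, hm0]
  rw [this] at hfae
  exact hfae

theorem aux_conv {b : ℕ} {Ω : Type*} [MeasurableSpace Ω] (ℙ : Measure Ω)
    [IsProbabilityMeasure ℙ] (V : Ω → Fin b → ℝ) (hVmeas : Measurable V) (μ : ℝ)
    (ρ : Measure ℝ) [IsProbabilityMeasure ρ] :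
    Measure.map
          (fun q : (Fin b → ℝ) × (Fin b → ℝ) =>
            (∑ k, q.2 k * q.1 k) + 1 + (1 / μ) * ∑ k, q.2 k * Real.log (q.2 k))
          ((Measure.pi fun _ : Fin b => ρ).prod (ℙ.map V)) =
    Measure.map
          (fun q : (Fin b → ℝ) × Ω =>
            (∑ k, V q.2 k * q.1 k) + (1 + (1 / μ) * ∑ k, V q.2 k * Real.log (V q.2 k)))
          ((Measure.pi fun _ : Fin b => ρ).prod ℙ) := by
  have h4 := Measure.map_prod_map (Measure.pi fun _ : Fin b => ρ) ℙ measurable_id hVmeas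
  rw [Measure.map_id] at h4
  rw [h4, Measure.map_map (by fun_prop) (by fun_prop)]
  congr 1
  funext q
  simp [Function.comp, add_assoc]

theorem aux_prod {ι : Type*} (s : Finset ι) (x y : ι → ℂ) (hx : ∀ i, ‖x i‖ ≤ 1)
    (hy : ∀ i, ‖y i‖ ≤ 1) : ‖∏ i ∈ s, x i - ∏ i ∈ s, y i‖ ≤ ∑ i ∈ s, ‖x i - y i‖ := by
  classical
  induction s using Finset.induction_on with
  | empty => simp
  | insert a s ha ih =>
    rw [Finset.prod_insert ha, Finset.prod_insert ha, Finset.sum_insert ha]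
    have h1 : ‖∏ i ∈ s, x i‖ ≤ 1 := by
      rw [norm_prod]; exact Finset.prod_le_one (fun i _ => norm_nonneg _) fun i _ => hx i
    calc ‖x a * ∏ i ∈ s, x i - y a * ∏ i ∈ s, y i‖
        = ‖(x a - y a) * ∏ i ∈ s, x i + y a * (∏ i ∈ s, x i - ∏ i ∈ s, y i)‖ := by congr 1; ring
      _ ≤ ‖x a - y a‖ * ‖∏ i ∈ s, x i‖ + ‖y a‖ * ‖∏ i ∈ s, x i - ∏ i ∈ s, y i‖ := by
        rw [← norm_mul, ← norm_mul]; exact norm_add_le _ _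
      _ ≤ ‖x a - y a‖ * 1 + 1 * ‖∏ i ∈ s, x i - ∏ i ∈ s, y i‖ := by
        gcongr
        exact hy a
      _ ≤ _ := by linarith

theorem aux_char {b : ℕ} {Ω : Type*} [MeasurableSpace Ω] (ℙ : Measure Ω)
    [IsProbabilityMeasure ℙ] (V : Ω → Fin b → ℝ) (hVmeas : Measurable V)
    (C : Ω → ℝ) (hC : Measurable C) (ρ : Measure ℝ) [IsProbabilityMeasure ρ]
    (h : Measure.map (fun q : (Fin b → ℝ) × Ω => (∑ k, V q.2 k * q.1 k) + C q.2)
          ((Measure.pi fun _ : Fin b => ρ).prod ℙ) = ρ) (t : ℝ) :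
    charFun ρ t = ∫ ω, (∏ k, charFun ρ (V ω k * t)) * Complex.exp (t * C ω * Complex.I) ∂ℙ := by
  conv_lhs => rw [← h, charFun_apply_real]
  rw [integral_map (by fun_prop) (by fun_prop)]
  rw [integral_prod_symm]
  · congr 1
    funext ω
    have : ∀ x : Fin b → ℝ, Complex.exp (t * ((∑ k, V ω k * x k) + C ω : ℝ) * Complex.I) =
      (∏ k, Complex.exp ((V ω k * t : ℝ) * x k * Complex.I)) * Complex.exp (t * C ω * Complex.I) := by
      intro x
      rw [← Complex.exp_sum, ← Complex.exp_add]
      congr 1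
      push_cast
      rw [← Finset.sum_mul, mul_add, add_mul, Finset.mul_sum]
      congr 3
      ext k; ring
    simp only [this]
    rw [integral_mul_const]
    congr 1
    rw [integral_fintype_prod_eq_prod (𝕜 := ℂ) (fun k (x : ℝ) => Complex.exp ((V ω k * t : ℝ) * x * Complex.I))]
    simp [charFun_apply_real]
  · refine Integrable.of_bound (by fun_prop) 1 (ae_of_all _ fun q => ?_)
    rw [← Complex.ofReal_mul, Complex.norm_exp_ofReal_mul_I]

theorem aux_exp (y : ℝ) : ‖Complex.exp (y * Complex.I) - 1 - y * Complex.I‖ ≤ 3 * y ^ 2 := by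
  by_cases hy : |y| ≤ 1
  · have := Complex.norm_exp_sub_one_sub_id_le (x := y * Complex.I) (by simpa using hy)
    simp at this
    nlinarith [sq_nonneg y]
  · push Not at hy
    have h1 : ‖Complex.exp (y * Complex.I) - 1 - y * Complex.I‖ ≤ 1 + 1 + |y| := by
      refine (norm_sub_le _ _).trans (add_le_add ((norm_sub_le _ _).trans ?_) (by simp))
      rw [Complex.norm_exp_ofReal_mul_I]; simp
    rw [← sq_abs]
    nlinarith

theorem aux_quad (ρ : Measure ℝ) [IsProbabilityMeasure ρ] (h0 : ∫ x, x ∂ρ = 0)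
    (h2 : Integrable (fun x => x ^ 2) ρ) (t : ℝ) :
    ‖charFun ρ t - 1‖ ≤ (3 * ∫ x, x ^ 2 ∂ρ) * t ^ 2 := by
  have hi : Integrable (fun x : ℝ => x) ρ :=
    ((memLp_two_iff_integrable_sq (by fun_prop)).2 h2).integrable (by norm_num)
  have hic : Integrable (fun x : ℝ => (x : ℂ)) ρ := hi.ofReal
  have he : Integrable (fun x : ℝ => Complex.exp ((t * x : ℝ) * Complex.I)) ρ := by
    refine Integrable.of_bound (by fun_prop) 1 (ae_of_all _ fun q => ?_)
    rw [Complex.norm_exp_ofReal_mul_I]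
  have h0c : ∫ x : ℝ, (x : ℂ) ∂ρ = 0 := by
    have := integral_ofReal (𝕜 := ℂ) (μ := ρ) (f := fun x : ℝ => x)
    rw [h0] at this; simpa using this
  have e : charFun ρ t - 1 =
      ∫ x : ℝ, (Complex.exp ((t * x : ℝ) * Complex.I) - 1 - (t * x : ℝ) * Complex.I) ∂ρ := by
    have e2 : ∫ x : ℝ, ((t * x : ℝ) : ℂ) * Complex.I ∂ρ = 0 := by
      push_cast
      rw [integral_mul_const, integral_const_mul, h0c]; simp
    have he1 : Integrable (fun x : ℝ => Complex.exp ((t * x : ℝ) * Complex.I) - 1) ρ :=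
      he.sub (integrable_const _)
    rw [integral_sub he1, e2, integral_sub he (integrable_const _)]
    · simp [charFun_apply_real]
    · push_cast
      exact (hic.const_mul _).mul_const _
  rw [e]
  refine (norm_integral_le_integral_norm _).trans ?_
  rw [mul_assoc, ← integral_mul_const, ← integral_const_mul]
  refine integral_mono_of_nonneg (ae_of_all _ fun x => norm_nonneg _) ((h2.mul_const _).const_mul _)
    (ae_of_all _ fun x => ?_)
  refine (aux_exp _).trans (le_of_eq ?_)
  ring

theorem aux_unique {b : ℕ} {Ω : Type*} [MeasurableSpace Ω] (ℙ : Measure Ω)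
    [IsProbabilityMeasure ℙ] (V : Ω → Fin b → ℝ) (hVmeas : Measurable V)
    (hV01 : ∀ ω i, V ω i ∈ Set.Icc (0:ℝ) 1)
    (hc : ∫ ω, ∑ k, V ω k ^ 2 ∂ℙ < 1)
    (C : Ω → ℝ) (hC : Measurable C) (ρ σ : Measure ℝ) [IsProbabilityMeasure ρ]
    [IsProbabilityMeasure σ]
    (hρ0 : ∫ x, x ∂ρ = 0) (hρ2 : Integrable (fun x => x ^ 2) ρ)
    (hσ0 : ∫ x, x ∂σ = 0) (hσ2 : Integrable (fun x => x ^ 2) σ)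
    (hρ : Measure.map (fun q : (Fin b → ℝ) × Ω => (∑ k, V q.2 k * q.1 k) + C q.2)
          ((Measure.pi fun _ : Fin b => ρ).prod ℙ) = ρ)
    (hσ : Measure.map (fun q : (Fin b → ℝ) × Ω => (∑ k, V q.2 k * q.1 k) + C q.2)
          ((Measure.pi fun _ : Fin b => σ).prod ℙ) = σ) : ρ = σ := by
  set c := ∫ ω, ∑ k, V ω k ^ 2 ∂ℙ with hcdef
  have hc0 : 0 ≤ c := integral_nonneg fun ω => Finset.sum_nonneg fun k _ => sq_nonneg _
  have hint : ∀ (τ : Measure ℝ) [IsProbabilityMeasure τ] (t : ℝ), Integrable (fun ω =>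
      (∏ k, charFun τ (V ω k * t)) * Complex.exp (t * C ω * Complex.I)) ℙ := by
    intro τ _ t
    have hm : Measurable (charFun τ) := (stronglyMeasurable_charFun).measurable
    refine Integrable.of_bound (by fun_prop) 1 (ae_of_all _ fun ω => ?_)
    rw [norm_mul, ← Complex.ofReal_mul, Complex.norm_exp_ofReal_mul_I, mul_one, norm_prod]
    exact Finset.prod_le_one (fun i _ => norm_nonneg _) fun i _ => norm_charFun_le_one _
  have hVi : Integrable (fun ω => ∑ k, V ω k ^ 2) ℙ := by
    refine integrable_finsetSum _ fun k _ => ?_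
    refine Integrable.of_bound (by fun_prop) 1 (ae_of_all _ fun ω => ?_)
    have := hV01 ω k
    rw [Real.norm_eq_abs, abs_of_nonneg (sq_nonneg _)]
    nlinarith [this.1, this.2]
  have step : ∀ D : ℝ, (∀ t, ‖charFun ρ t - charFun σ t‖ ≤ D * t ^ 2) →
      ∀ t, ‖charFun ρ t - charFun σ t‖ ≤ (c * D) * t ^ 2 := by
    intro D hD t
    rw [aux_char ℙ V hVmeas C hC ρ hρ, aux_char ℙ V hVmeas C hC σ hσ,
      ← integral_sub (hint ρ t) (hint σ t)]
    refine (norm_integral_le_integral_norm _).trans ?_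
    rw [mul_assoc, hcdef, ← integral_mul_const]
    refine integral_mono_of_nonneg (ae_of_all _ fun x => norm_nonneg _) (hVi.mul_const _)
      (ae_of_all _ fun ω => ?_)
    simp only
    rw [← sub_mul, norm_mul, ← Complex.ofReal_mul, Complex.norm_exp_ofReal_mul_I, mul_one]
    refine (aux_prod _ _ _ (fun i => norm_charFun_le_one _)
      (fun i => norm_charFun_le_one _)).trans ?_
    rw [Finset.sum_mul]
    refine Finset.sum_le_sum fun k _ => (hD _).trans (le_of_eq ?_)
    ring
  obtain ⟨K, hK⟩ : ∃ K : ℝ, ∀ t, ‖charFun ρ t - charFun σ t‖ ≤ K * t ^ 2 := by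
    refine ⟨3 * (∫ x, x ^ 2 ∂ρ) + 3 * ∫ x, x ^ 2 ∂σ, fun t => ?_⟩
    have h1 := aux_quad ρ hρ0 hρ2 t
    have h2 := aux_quad σ hσ0 hσ2 t
    have h3 : ‖charFun ρ t - charFun σ t‖ ≤ ‖charFun ρ t - 1‖ + ‖charFun σ t - 1‖ := by
      have := norm_sub_le (charFun ρ t - 1) (charFun σ t - 1)
      simpa using this
    linarith
  have hn : ∀ n : ℕ, ∀ t, ‖charFun ρ t - charFun σ t‖ ≤ (c ^ n * K) * t ^ 2 := by
    intro n
    induction n with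
    | zero => simpa using hK
    | succ n ih =>
      have := step _ ih
      rw [pow_succ', mul_assoc]; exact this
  apply Measure.ext_of_charFun
  funext t
  have hlim : Tendsto (fun n : ℕ => (c ^ n * K) * t ^ 2) atTop (𝓝 0) := by
    have := ((tendsto_pow_atTop_nhds_zero_of_lt_one hc0 hc).mul_const K).mul_const (t ^ 2)
    simpa using this
  have := ge_of_tendsto' hlim fun n => hn n t
  exact sub_eq_zero.1 (norm_le_zero_iff.1 this)

theorem aux_c {b : ℕ} {Ω : Type*} [MeasurableSpace Ω] (ℙ : Measure Ω)
    [IsProbabilityMeasure ℙ] (V : Ω → Fin b → ℝ) (hVmeas : Measurable V)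
    (hV01 : ∀ ω i, V ω i ∈ Set.Icc (0:ℝ) 1)
    (hVsum : ∀ ω, ∑ i, V ω i = 1) (i₀ : Fin b)
    (hVdens : ℙ.map (fun ω => V ω i₀) ≪ (volume : Measure ℝ)) :
    ∫ ω, ∑ k, V ω k ^ 2 ∂ℙ < 1 := by
  have hVi : Integrable (fun ω => ∑ k, V ω k ^ 2) ℙ := by
    refine integrable_finsetSum _ fun k _ => ?_
    refine Integrable.of_bound (by fun_prop) 1 (ae_of_all _ fun ω => ?_)
    have := hV01 ω k
    rw [Real.norm_eq_abs, abs_of_nonneg (sq_nonneg _)]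
    nlinarith [this.1, this.2]
  have hle : ∀ ω k, 0 ≤ V ω k - V ω k ^ 2 := fun ω k => by
    have := hV01 ω k
    nlinarith [this.1, this.2]
  have hnn : ∀ ω, 0 ≤ 1 - ∑ k, V ω k ^ 2 := fun ω => by
    rw [← hVsum ω, ← Finset.sum_sub_distrib]
    exact Finset.sum_nonneg fun k _ => hle ω k
  have hI : ∫ ω, (1 - ∑ k, V ω k ^ 2) ∂ℙ = 1 - ∫ ω, ∑ k, V ω k ^ 2 ∂ℙ := by
    rw [integral_sub (integrable_const _) hVi]; simp
  have h0 : 0 ≤ ∫ ω, (1 - ∑ k, V ω k ^ 2) ∂ℙ := integral_nonneg hnn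
  by_contra hcon
  have hz : ∫ ω, (1 - ∑ k, V ω k ^ 2) ∂ℙ = 0 := by linarith
  rw [integral_eq_zero_iff_of_nonneg hnn ((integrable_const _).sub hVi)] at hz
  have hm : ℙ.map (fun ω => V ω i₀) ({0, 1} : Set ℝ) = 0 :=
    hVdens (Set.Finite.measure_zero (by simp) _)
  rw [Measure.map_apply (by fun_prop) (by measurability)] at hm
  have hz2 : ∀ᵐ ω ∂ℙ, ω ∈ (fun ω => V ω i₀) ⁻¹' ({0, 1} : Set ℝ) := by
    filter_upwards [hz] with ω hω
    have h1 : ∑ k, (V ω k - V ω k ^ 2) = 0 := by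
      rw [Finset.sum_sub_distrib, hVsum ω]; exact hω
    have h2 := (Finset.sum_eq_zero_iff_of_nonneg fun k _ => hle ω k).1 h1 i₀ (Finset.mem_univ _)
    have h3 : V ω i₀ * (1 - V ω i₀) = 0 := by linarith
    rcases mul_eq_zero.1 h3 with h | h
    · simp [h]
    · right; simp; linarith
  have hfalse : ∀ᵐ ω ∂ℙ, False := by
    filter_upwards [hz2, measure_eq_zero_iff_ae_notMem.1 hm] with ω h1 h2
    exact h2 h1
  obtain ⟨ω, hω⟩ := hfalse.exists
  exact hω

theorem aux_exists {b : ℕ} (hb : 0 < b) {Ω : Type*} [MeasurableSpace Ω] (ℙ : Measure Ω)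
    [IsProbabilityMeasure ℙ] (V : Ω → Fin b → ℝ) (hVmeas : Measurable V)
    (hV01 : ∀ ω i, V ω i ∈ Set.Icc (0:ℝ) 1)
    (hc : ∫ ω, ∑ k, V ω k ^ 2 ∂ℙ < 1)
    (C : Ω → ℝ) (hCm : Measurable C) (hC : MemLp C 2 ℙ) (hC0 : ∫ ω, C ω ∂ℙ = 0) :
    ∃ ρ : Measure ℝ, IsProbabilityMeasure ρ ∧ (∫ x, x ∂ρ) = 0 ∧ Integrable (fun x => x ^ 2) ρ ∧
      Measure.map (fun q : (Fin b → ℝ) × Ω => (∑ k, V q.2 k * q.1 k) + C q.2)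
          ((Measure.pi fun _ : Fin b => ρ).prod ℙ) = ρ := by
  obtain ⟨P, hP, G, hG⟩ := exists_selfsim b hb ℙ
  obtain ⟨f, hfm, hf2, hf0, hfG⟩ := exists_fix ℙ P V hVmeas hV01 hc C hC hC0 G hG
  have hprob : IsProbabilityMeasure (P.map f) := Measure.isProbabilityMeasure_map hfm.aemeasurable
  refine ⟨P.map f, hprob, ?_, ?_, ?_⟩
  · rw [integral_map hfm.aemeasurable (by fun_prop)]; exact hf0
  · rw [integrable_map_measure (by fun_prop) hfm.aemeasurable]
    exact hf2.integrable_sq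
  · have h1 : (Measure.pi fun _ : Fin b => P.map f) =
        (Measure.pi fun _ : Fin b => P).map (fun x k => f (x k)) :=
      (Measure.pi_map_pi (fun _ => hfm.aemeasurable)).symm
    have hfm' : Measurable (fun (x : Fin b → ℕ → Ω) k => f (x k)) := by fun_prop
    have h4 := Measure.map_prod_map (Measure.pi fun _ : Fin b => P) ℙ hfm' measurable_id
    rw [Measure.map_id] at h4
    rw [h1, h4, Measure.map_map (by fun_prop) (by fun_prop), ← hG.map_eq,
      Measure.map_map (by fun_prop) hG.measurable]
    exact Measure.map_congr hfG.symm

theorem aux_xlogx (x : ℝ) (hx : x ∈ Set.Icc (0:ℝ) 1) : |x * Real.log x| ≤ 1 := by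
  rcases hx.1.eq_or_lt with h | h
  · simp [← h]
  · rw [mul_comm]; exact (Real.abs_log_mul_self_lt x h hx.2).le

theorem aux_C0 {b : ℕ} {Ω : Type*} [MeasurableSpace Ω] (ℙ : Measure Ω)
    [IsProbabilityMeasure ℙ] (V : Ω → Fin b → ℝ) (hVmeas : Measurable V)
    (hV01 : ∀ ω i, V ω i ∈ Set.Icc (0:ℝ) 1) (i₀ : Fin b)
    (hVid : ∀ i : Fin b, ℙ.map (fun ω => V ω i) = ℙ.map (fun ω => V ω i₀))
    (μ : ℝ) (hμ : μ = -(b : ℝ) * ∫ ω, V ω i₀ * Real.log (V ω i₀) ∂ℙ) (hμpos : 0 < μ) :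
    ∫ ω, (1 + (1 / μ) * ∑ k, V ω k * Real.log (V ω k)) ∂ℙ = 0 := by
  have hI : ∀ k, Integrable (fun ω => V ω k * Real.log (V ω k)) ℙ := fun k =>
    Integrable.of_bound (by fun_prop) 1 (ae_of_all _ fun ω => aux_xlogx _ (hV01 ω k))
  have e : ∀ j, ∫ ω, V ω j * Real.log (V ω j) ∂ℙ =
      ∫ x, x * Real.log x ∂(ℙ.map (fun ω => V ω j)) := fun j => by
    rw [integral_map (by fun_prop) (by fun_prop)]
  have hk : ∀ k, ∫ ω, V ω k * Real.log (V ω k) ∂ℙ = ∫ ω, V ω i₀ * Real.log (V ω i₀) ∂ℙ := by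
    intro k
    rw [e k, e i₀, hVid k]
  have hS : Integrable (fun ω => ∑ k, V ω k * Real.log (V ω k)) ℙ :=
    integrable_finsetSum _ fun k _ => hI k
  rw [integral_add (integrable_const _) (hS.const_mul _),
    integral_const_mul, integral_finsetSum _ fun k _ => hI k, Finset.sum_congr rfl fun k _ => hk k]
  simp only [integral_const, probReal_univ, smul_eq_mul, Finset.sum_const, Finset.card_univ,
    Fintype.card_fin, nsmul_eq_mul]
  have : (b : ℝ) * ∫ ω, V ω i₀ * Real.log (V ω i₀) ∂ℙ = -μ := by
    rw [hμ]; ring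
  rw [this]
  field_simp
  ring

/-- There is exactly one centered probability measure `ρ` on `ℝ` with finite
second moment such that if `X⁽¹⁾, …, X⁽ᵇ⁾` are i.i.d. with law `ρ` and independent of
`(V_1, …, V_b)`, then `Σ_k V_k·X⁽ᵏ⁾ + 1 + (1/μ)·Σ_k V_k·log V_k` also has law `ρ`
(the law of the right-hand side is the pushforward of `ρ^⊗b ⊗ law(V)` under the map `Φ`). -/
theorem stmt2
    (b : ℕ) (hb : 2 ≤ b)
    {Ω : Type*} [MeasurableSpace Ω] (ℙ : Measure Ω) [IsProbabilityMeasure ℙ]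
    (V : Ω → Fin b → ℝ) (hVmeas : Measurable V)
    (hV01 : ∀ ω i, V ω i ∈ Set.Icc (0:ℝ) 1)
    (hVsum : ∀ ω, ∑ i, V ω i = 1)
    (hVid : ∀ i : Fin b, ℙ.map (fun ω => V ω i) = ℙ.map (fun ω => V ω ⟨0, by omega⟩))
    (hVdens : ℙ.map (fun ω => V ω ⟨0, by omega⟩) ≪ (volume : Measure ℝ))
    (hVtail : ∀ x : ℝ, x < 1 → ℙ {ω | V ω ⟨0, by omega⟩ ≤ x} < 1)
    (μ : ℝ) (hμ : μ = -(b : ℝ) * ∫ ω, V ω ⟨0, by omega⟩ * Real.log (V ω ⟨0, by omega⟩) ∂ℙ)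
    (hμpos : 0 < μ) :
    ∃! ρ : Measure ℝ,
      IsProbabilityMeasure ρ ∧ (∫ x, x ∂ρ) = 0 ∧ Integrable (fun x => x ^ 2) ρ ∧
        Measure.map
          (fun q : (Fin b → ℝ) × (Fin b → ℝ) =>
            (∑ k, q.2 k * q.1 k) + 1 + (1 / μ) * ∑ k, q.2 k * Real.log (q.2 k))
          ((Measure.pi fun _ : Fin b => ρ).prod (ℙ.map V)) = ρ := by
  have hc := aux_c ℙ V hVmeas hV01 hVsum ⟨0, by omega⟩ hVdens
  let C : Ω → ℝ := fun ω => 1 + (1 / μ) * ∑ k, V ω k * Real.log (V ω k)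
  have hCm : Measurable C := by fun_prop
  have hk : ∀ k, MemLp (fun ω => V ω k * Real.log (V ω k)) 2 ℙ := fun k =>
    MemLp.of_bound (by fun_prop) 1 (ae_of_all _ fun ω => aux_xlogx _ (hV01 ω k))
  have hS : MemLp (fun ω => ∑ k, V ω k * Real.log (V ω k)) 2 ℙ :=
    memLp_finsetSum _ fun k _ => hk k
  have hS2 : MemLp (fun ω => (1 / μ) * ∑ k, V ω k * Real.log (V ω k)) 2 ℙ := hS.const_mul (1 / μ)
  have hC : MemLp C 2 ℙ := (memLp_const (1 : ℝ)).add hS2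
  have hC0 : ∫ ω, C ω ∂ℙ = 0 := aux_C0 ℙ V hVmeas hV01 ⟨0, by omega⟩ hVid μ hμ hμpos
  obtain ⟨ρ, hρ, hρ0, hρ2, hρf⟩ := aux_exists (by omega) ℙ V hVmeas hV01 hc C hCm hC hC0
  refine ⟨ρ, ⟨hρ, hρ0, hρ2, ?_⟩, ?_⟩
  · rw [aux_conv ℙ V hVmeas μ ρ]; exact hρf
  · rintro σ ⟨hσ, hσ0, hσ2, hσf⟩
    rw [aux_conv ℙ V hVmeas μ σ] at hσf
    exact aux_unique ℙ V hVmeas hV01 hc C hCm σ ρ hσ0 hσ2 hρ0 hρ2 hσf hρf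
end

section
/- Let (S_t) be an AR-process with discrete (countable) state space that fulfills the integrability condition, and suppose τ(d) is P_x-almost surely finite for all x ∈ E and d ∈ ℝ. Assume there exist ε > 0, x₀ < 0 and K > 0 such that for all x, y ≤ x₀ in E with |x − y| ≤ K one has d_TV(P_x^{S_1}, P_y^{S_1}) < 2(1−ε), and assume lim_{x₀ → −∞} inf_{z < y ≤ x₀} P_z(S_{τ(y)} − y ≤ K) > 0. Then for every a ∈ ℝ with a < 0, lim_{x₀ → −∞} sup_{x, y ≤ x₀} d_TV(P_x^{S_{τ(a)}}, P_y^{S_{τ(a)}}) = 0. -/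
open MeasureTheory Filter Topology

attribute [local instance] Classical.propDecidable

/-- An AR-process (approximate renewal process) in the sense of Bruhn: a time-homogeneous
Markov chain `(S_t)` on a countable state space `E ⊆ ℝ` without lower bound, given by a
family of path measures `P x` (the chain started at `x`, realized as coordinate process on
`ℕ → E`) with transition probabilities `κ`, whose increments are strictly positive a.s., and
whose one-step distribution functions `F_x(y) = P_x(S_1 - x ≤ y)` converge weakly, as
`x → -∞`, to a distribution function `F` with `0 < ∫ t dF(t) < ∞` (the mean is expressed as
`∫_0^∞ (1 - F(t)) dt`, `F` being supported on `[0,∞)` since the increments are positive). -/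
structure ARProcess where
  E : Set ℝ
  countable : E.Countable
  nobound : ¬ BddBelow E
  P : ↥E → Measure (ℕ → ↥E)
  prob : ∀ x, IsProbabilityMeasure (P x)
  κ : ↥E → ↥E → ENNReal
  κprob : ∀ x, ∑' y, κ x y = 1
  init : ∀ x : ↥E, P x {ω | ω 0 = x} = 1
  markov : ∀ (x : ↥E) (t : ℕ) (path : ℕ → ↥E),
    P x {ω | ∀ i ≤ t + 1, ω i = path i}
      = P x {ω | ∀ i ≤ t, ω i = path i} * κ (path t) (path (t + 1))
  inc_pos : ∀ (x : ↥E) (t : ℕ), P x {ω | ((ω (t + 1) : ℝ)) ≤ ((ω t : ℝ))} = 0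
  F : ℝ → ℝ
  F_mono : Monotone F
  F_bot : Tendsto F atBot (nhds 0)
  F_top : Tendsto F atTop (nhds 1)
  F_conv : ∀ y : ℝ, ContinuousAt F y →
    Tendsto (fun x : ↥E => ((P x) {ω | ((ω 1 : ℝ)) - ((x : ℝ)) ≤ y}).toReal)
      (comap (fun x : ↥E => (x : ℝ)) atBot) (nhds (F y))
  mean_int : IntegrableOn (fun t => 1 - F t) (Set.Ioi (0 : ℝ))
  mean_pos : 0 < ∫ t in Set.Ioi (0 : ℝ), (1 - F t)

/-- `F̄_a(t) = inf_{x ≤ a} F_x(t)`, where `F_x(y) = P_x(S_1 - x ≤ y)`. -/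
noncomputable def Fbar (C : ARProcess) (a t : ℝ) : ℝ :=
  ⨅ x : {x : ↥C.E // (x : ℝ) ≤ a},
    ((C.P x.1) {ω | ((ω 1 : ℝ)) - ((x.1 : ℝ)) ≤ t}).toReal

/-- `F̲_a(t) = sup_{x ≤ a} F_x(t)`, where `F_x(y) = P_x(S_1 - x ≤ y)`. -/
noncomputable def Funder (C : ARProcess) (a t : ℝ) : ℝ :=
  ⨆ x : {x : ↥C.E // (x : ℝ) ≤ a},
    ((C.P x.1) {ω | ((ω 1 : ℝ)) - ((x.1 : ℝ)) ≤ t}).toReal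

/-- The integrability condition: `∫ t dF̄_a(t) < ∞` for some `a`, expressed (via Fubini, `F̄_a`
vanishing on the negative half-line) as integrability of `1 - F̄_a` on `(0, ∞)`. -/
def IntegrabilityCondition (C : ARProcess) : Prop :=
  ∃ a : ℝ, IntegrableOn (fun t => 1 - Fbar C a t) (Set.Ioi (0 : ℝ))

/-- The hitting time `τ(d) = inf{t : S_t ≥ d}` of `[d, ∞)` (junk value `0` if the path never
reaches `[d, ∞)`). -/
noncomputable def hitTime {E : Set ℝ} (d : ℝ) (ω : ℕ → ↥E) : ℕ :=
  sInf {t : ℕ | d ≤ ((ω t : ℝ))}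

/-- Total variation distance `Σ_z |P({z}) - Q({z})|` between two measures on a countable
(state) space. -/
noncomputable def dTV {α : Type*} [MeasurableSpace α] (μ ν : Measure α) : ℝ :=
  ∑' z : α, |(μ {z}).toReal - (ν {z}).toReal|

namespace ARProcess

instance instCountableE (C : ARProcess) : Countable ↥C.E := C.countable.to_subtype

instance instProbP (C : ARProcess) (x : ↥C.E) : IsProbabilityMeasure (C.P x) := C.prob x

/-- Cylinder sets. -/
def cyl {E : Set ℝ} (t : ℕ) (p : ℕ → ↥E) : Set (ℕ → ↥E) := {ω | ∀ i ≤ t, ω i = p i}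

/-- The collection of all cylinder sets. -/
def cyls (E : Set ℝ) : Set (Set (ℕ → ↥E)) := {s | ∃ t p, s = cyl t p}

lemma measurableSet_cyl (C : ARProcess) (t : ℕ) (p : ℕ → ↥C.E) : MeasurableSet (cyl t p) := by
  have : cyl t p = ⋂ i : ℕ, ⋂ _ : i ≤ t, (fun ω : ℕ → ↥C.E => ω i) ⁻¹' {p i} := by
    ext ω; simp [cyl]
  rw [this]
  exact MeasurableSet.iInter fun i => MeasurableSet.iInter fun _ =>
    (measurable_pi_apply i) (measurableSet_singleton _)

lemma cyl_inter_aux {E : Set ℝ} {t s : ℕ} (hst : s ≤ t) {p q : ℕ → ↥E}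
    (h : (cyl t p ∩ cyl s q).Nonempty) : cyl t p ∩ cyl s q = cyl t p := by
  obtain ⟨ω, h1, h2⟩ := h
  ext ω'
  simp only [Set.mem_inter_iff, and_iff_left_iff_imp]
  intro h' i hi
  rw [h' i (hi.trans hst), ← h1 i (hi.trans hst), h2 i hi]

lemma isPiSystem_cyls (E : Set ℝ) : IsPiSystem (cyls E) := by
  rintro _ ⟨t, p, rfl⟩ _ ⟨s, q, rfl⟩ h
  rcases le_total s t with hst | hst
  · rw [cyl_inter_aux hst h]; exact ⟨t, p, rfl⟩
  · rw [Set.inter_comm] at h ⊢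
    rw [cyl_inter_aux hst h]; exact ⟨s, q, rfl⟩

lemma generate_cyls (C : ARProcess) :
    (MeasurableSpace.pi : MeasurableSpace (ℕ → ↥C.E))
      = MeasurableSpace.generateFrom (cyls C.E) := by
  apply le_antisymm
  · refine iSup_le fun n => ?_
    rw [← measurable_iff_comap_le]
    refine @measurable_to_countable' _ _ _ _ (MeasurableSpace.generateFrom (cyls C.E)) _ ?_
    intro x
    have : (fun ω : ℕ → ↥C.E => ω n) ⁻¹' {x}
        = ⋃ p : (Fin (n + 1) → ↥C.E), ⋃ _ : p (Fin.last n) = x,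
          cyl n (fun i => p ⟨min i n, by omega⟩) := by
      ext ω
      simp only [Set.mem_preimage, Set.mem_singleton_iff, Set.mem_iUnion, exists_prop]
      constructor
      · intro h
        refine ⟨fun i => ω i, by simpa using h, fun i hi => ?_⟩
        simp [min_eq_left hi]
      · rintro ⟨p, hp, h⟩
        have := h n le_rfl
        rw [this, ← hp]
        simp [Fin.last]
    rw [this]
    refine MeasurableSet.iUnion fun p => MeasurableSet.iUnion fun _ => ?_
    exact MeasurableSpace.measurableSet_generateFrom ⟨_, _, rfl⟩
  · apply MeasurableSpace.generateFrom_le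
    rintro _ ⟨t, p, rfl⟩
    exact measurableSet_cyl C t p

/-- One-step law. -/
noncomputable def stepL (C : ARProcess) (x : ↥C.E) : Measure ↥C.E := (C.P x).map fun ω => ω 1

instance instProbStep (C : ARProcess) (x : ↥C.E) : IsProbabilityMeasure (C.stepL x) :=
  Measure.isProbabilityMeasure_map (measurable_pi_apply 1).aemeasurable

lemma ae_start (C : ARProcess) (x : ↥C.E) : ∀ᵐ ω ∂C.P x, ω 0 = x := by
  have hm : MeasurableSet {ω : ℕ → ↥C.E | ω 0 = x} :=
    measurableSet_preimage (f := fun ω : ℕ → ↥C.E => ω 0) (measurable_pi_apply 0)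
      (measurableSet_singleton x)
  exact (prob_compl_eq_zero_iff hm).2 (C.init x)

lemma P_cyl (C : ARProcess) (x : ↥C.E) (t : ℕ) (p : ℕ → ↥C.E) :
    C.P x (cyl t p) = (if p 0 = x then 1 else 0) *
      ∏ i ∈ Finset.range t, C.κ (p i) (p (i + 1)) := by
  induction t with
  | zero =>
    simp only [Finset.range_zero, Finset.prod_empty, mul_one]
    split_ifs with h
    · rw [← C.init x]
      congr 1
      ext ω; simp [cyl, h]
    · refine measure_mono_null (t := {ω | ¬ ω 0 = x}) ?_ (C.ae_start x)
      intro ω hω h'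
      exact h (by rw [← h', hω 0 le_rfl])
  | succ t ih =>
    rw [Finset.prod_range_succ, ← mul_assoc, ← ih]
    exact C.markov x t p

lemma stepL_singleton (C : ARProcess) (x w : ↥C.E) : C.stepL x {w} = C.κ x w := by
  have h1 : C.P x (cyl 1 (fun i => if i = 0 then x else w)) = C.κ x w := by
    rw [P_cyl]; simp
  rw [stepL, Measure.map_apply (measurable_pi_apply 1) (measurableSet_singleton w), ← h1]
  apply measure_congr
  filter_upwards [C.ae_start x] with ω hω
  apply propext
  constructor
  · intro (h : ω 1 = w) i hi
    interval_cases i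
    · simpa using hω
    · simpa using h
  · intro (h : ω ∈ cyl 1 _)
    have h2 : ω 1 = w := by simpa using h 1 le_rfl
    exact h2

/-- The chain kernel on paths. -/
noncomputable def pathK (C : ARProcess) : ProbabilityTheory.Kernel ↥C.E (ℕ → ↥C.E) :=
  ⟨C.P, Measurable.of_discrete⟩

instance instMarkovPath (C : ARProcess) : ProbabilityTheory.IsMarkovKernel C.pathK :=
  ⟨fun x => C.prob x⟩

/-- The one-step kernel. -/
noncomputable def stepK (C : ARProcess) : ProbabilityTheory.Kernel ↥C.E ↥C.E :=
  ⟨C.stepL, Measurable.of_discrete⟩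

/-- Shift of paths. -/
def shift {E : Set ℝ} (ω : ℕ → ↥E) : ℕ → ↥E := fun i => ω (i + 1)

lemma measurable_shift (C : ARProcess) : Measurable (shift : (ℕ → ↥C.E) → (ℕ → ↥C.E)) :=
  measurable_pi_lambda _ fun i => measurable_pi_apply (i + 1)

lemma map_shift (C : ARProcess) (x : ↥C.E) :
    (C.P x).map shift = (C.stepL x).bind C.pathK := by
  have := Measure.isProbabilityMeasure_map (μ := C.P x) (C.measurable_shift).aemeasurable
  refine ext_of_generate_finite (cyls C.E) C.generate_cyls (isPiSystem_cyls _) ?_ ?_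
  · rintro _ ⟨t, p, rfl⟩
    rw [Measure.map_apply C.measurable_shift (C.measurableSet_cyl t p),
      Measure.bind_apply (C.measurableSet_cyl t p) C.pathK.aemeasurable, lintegral_countable']
    have h1 : C.P x (shift ⁻¹' cyl t p)
        = C.P x (cyl (t + 1) (fun i => if i = 0 then x else p (i - 1))) := by
      apply measure_congr
      filter_upwards [C.ae_start x] with ω hω
      apply propext
      constructor
      · intro (h : shift ω ∈ cyl t p) i hi
        rcases i with _ | i
        · simpa using hω
        · have h2 : ω (i + 1) = p i := h i (by omega)
          simpa using h2
      · intro (h : ω ∈ cyl (t + 1) _) i hi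
        have h2 : ω (i + 1) = p i := by simpa using h (i + 1) (by omega)
        exact h2
    rw [h1, P_cyl, Finset.prod_range_succ']
    rw [tsum_eq_single (p 0)]
    · rw [stepL_singleton]
      change _ = C.P (p 0) (cyl t p) * _
      rw [P_cyl]
      simp
    · intro w hw
      change C.P w (cyl t p) * _ = 0
      rw [P_cyl, if_neg (fun h => hw h.symm)]
      simp
  · rw [measure_univ, Measure.bind_apply MeasurableSet.univ C.pathK.aemeasurable]
    simp

lemma integral_shift (C : ARProcess) (x : ↥C.E) (f : (ℕ → ↥C.E) → ℝ) (hf : Measurable f)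
    (B : ℝ) (hB : ∀ ω, |f ω| ≤ B) :
    ∫ ω, f (shift ω) ∂C.P x = ∫ w, (∫ ω, f ω ∂C.P w) ∂C.stepL x := by
  rw [← integral_map (φ := shift) C.measurable_shift.aemeasurable
    hf.aestronglyMeasurable, map_shift]
  have : IsProbabilityMeasure ((C.stepL x).bind C.pathK) := by
    rw [← map_shift]
    exact Measure.isProbabilityMeasure_map (C.measurable_shift).aemeasurable
  exact ProbabilityTheory.Kernel.integral_comp (κ := C.stepK) (η := C.pathK) (a := x)
    (Integrable.of_bound (μ := (C.stepL x).bind C.pathK) hf.aestronglyMeasurable B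
      (ae_of_all _ hB))

lemma stepL_pos (C : ARProcess) (x : ↥C.E) : ∀ᵐ w : ↥C.E ∂C.stepL x, (x : ℝ) < (w : ℝ) := by
  rw [stepL, ae_map_iff (f := fun ω : ℕ → ↥C.E => ω 1) (measurable_pi_apply 1).aemeasurable (MeasurableSet.of_discrete)]
  have h : ∀ᵐ ω ∂C.P x, (ω 0 : ℝ) < ω 1 := by
    rw [ae_iff]
    simpa using C.inc_pos x 0
  filter_upwards [h, C.ae_start x] with ω h1 h2
  rwa [h2] at h1

lemma integrable_bdd {α : Type*} [MeasurableSpace α] [DiscreteMeasurableSpace α] [Countable α]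
    (μ : Measure α) [IsProbabilityMeasure μ] (f : α → ℝ) (B : ℝ) (hB : ∀ w, |f w| ≤ B) :
    Integrable f μ :=
  Integrable.of_bound (Measurable.of_discrete).aestronglyMeasurable B (ae_of_all _ hB)

lemma hitTime_spec {E : Set ℝ} {d : ℝ} {ω : ℕ → ↥E} (h : ∃ t, d ≤ (ω t : ℝ)) :
    d ≤ (ω (hitTime d ω) : ℝ) := Nat.sInf_mem (s := {t : ℕ | d ≤ ((ω t : ℝ))}) h

lemma hitTime_le {E : Set ℝ} {d : ℝ} {ω : ℕ → ↥E} {t : ℕ} (h : d ≤ (ω t : ℝ)) :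
    hitTime d ω ≤ t := Nat.sInf_le (s := {t : ℕ | d ≤ ((ω t : ℝ))}) h

lemma hitTime_shift {E : Set ℝ} {d : ℝ} {ω : ℕ → ↥E} (h : ∃ t, d ≤ (ω t : ℝ))
    (h0 : (ω 0 : ℝ) < d) : hitTime d ω = hitTime d (shift ω) + 1 := by
  have h1 := hitTime_spec h
  have h2 : hitTime d ω ≠ 0 := fun h' => by rw [h'] at h1; linarith
  obtain ⟨n, hn⟩ := Nat.exists_eq_succ_of_ne_zero h2
  have h3 : d ≤ (shift ω n : ℝ) := by rw [hn] at h1; exact h1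
  have h4 := hitTime_le h3
  have h5 : d ≤ (ω (hitTime d (shift ω) + 1) : ℝ) := hitTime_spec (ω := shift ω) ⟨n, h3⟩
  have h6 := hitTime_le h5
  omega

lemma measurable_hitTime (C : ARProcess) (d : ℝ) :
    Measurable (hitTime d : (ℕ → ↥C.E) → ℕ) := by
  have hm : ∀ n : ℕ, MeasurableSet {ω : ℕ → ↥C.E | d ≤ (ω n : ℝ)} := fun n =>
    measurableSet_preimage (f := fun ω : ℕ → ↥C.E => ω n) (measurable_pi_apply n)
      (MeasurableSet.of_discrete (s := {w : ↥C.E | d ≤ (w : ℝ)}))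
  refine measurable_of_Iic fun n => ?_
  have : hitTime d ⁻¹' Set.Iic n = (⋃ m : ℕ, ⋃ _ : m ≤ n, {ω : ℕ → ↥C.E | d ≤ (ω m : ℝ)}) ∪
      (⋂ m : ℕ, {ω : ℕ → ↥C.E | d ≤ (ω m : ℝ)}ᶜ) := by
    ext ω
    simp only [Set.mem_preimage, Set.mem_Iic, Set.mem_union, Set.mem_iUnion, Set.mem_iInter,
      Set.mem_compl_iff, Set.mem_ofPred_eq, exists_prop]
    constructor
    · intro h
      by_cases h' : ∃ t, d ≤ (ω t : ℝ)
      · exact Or.inl ⟨_, h, hitTime_spec h'⟩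
      · exact Or.inr (not_exists.1 h')
    · rintro (⟨m, h1, h2⟩ | h)
      · exact (hitTime_le h2).trans h1
      · have : {t : ℕ | d ≤ ((ω t : ℝ))} = ∅ := by
          ext t; simpa using h t
        simp [hitTime, this]
  rw [this]
  exact (MeasurableSet.iUnion fun m => MeasurableSet.iUnion fun _ => hm m).union
    (MeasurableSet.iInter fun m => (hm m).compl)

lemma measurable_hit (C : ARProcess) (d : ℝ) :
    Measurable (fun ω : ℕ → ↥C.E => ω (hitTime d ω)) := by
  refine measurable_to_countable' fun x => ?_
  have : (fun ω : ℕ → ↥C.E => ω (hitTime d ω)) ⁻¹' {x}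
      = ⋃ n : ℕ, (hitTime d ⁻¹' {n}) ∩ ((fun ω : ℕ → ↥C.E => ω n) ⁻¹' {x}) := by
    ext ω; simp
  rw [this]
  exact MeasurableSet.iUnion fun n => ((C.measurable_hitTime d) (measurableSet_singleton n)).inter
    ((measurable_pi_apply n) (measurableSet_singleton x))

/-- Law of the hitting position. -/
noncomputable def hitL (C : ARProcess) (d : ℝ) (x : ↥C.E) : Measure ↥C.E :=
  (C.P x).map fun ω => ω (hitTime d ω)

instance instProbHit (C : ARProcess) (d : ℝ) (x : ↥C.E) : IsProbabilityMeasure (C.hitL d x) :=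
  Measure.isProbabilityMeasure_map (C.measurable_hit d).aemeasurable

/-- Expectation of a function of the hitting position. -/
noncomputable def Hf (C : ARProcess) (d : ℝ) (φ : ↥C.E → ℝ) (x : ↥C.E) : ℝ :=
  ∫ w, φ w ∂C.hitL d x

lemma Hf_eq (C : ARProcess) (d : ℝ) (φ : ↥C.E → ℝ) (x : ↥C.E) :
    C.Hf d φ x = ∫ ω, φ (ω (hitTime d ω)) ∂C.P x :=
  integral_map (C.measurable_hit d).aemeasurable (Measurable.of_discrete).aestronglyMeasurable

lemma Hf_bdd (C : ARProcess) (d : ℝ) (φ : ↥C.E → ℝ) (B : ℝ) (hB : ∀ w, |φ w| ≤ B) (x : ↥C.E) :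
    |C.Hf d φ x| ≤ B := by
  have := norm_integral_le_of_norm_le_const (μ := C.hitL d x) (f := φ) (C := B) (ae_of_all _ hB)
  simpa [Hf] using this

lemma Hf_ge (C : ARProcess) (d : ℝ) (φ : ↥C.E → ℝ) (x : ↥C.E) (hx : d ≤ (x : ℝ)) :
    C.Hf d φ x = φ x := by
  rw [Hf_eq]
  have : ∫ ω, φ (ω (hitTime d ω)) ∂C.P x = ∫ _ω, φ x ∂C.P x := by
    apply integral_congr_ae
    filter_upwards [C.ae_start x] with ω hω
    have h0 : d ≤ (ω 0 : ℝ) := by rw [hω]; exact hx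
    have h1 := hitTime_le h0
    rw [Nat.le_zero.1 h1, hω]
  rw [this]; simp

/-- Almost sure finiteness of hitting times. -/
def FinHit (C : ARProcess) : Prop :=
  ∀ (x : ↥C.E) (d : ℝ), C.P x {ω | ∀ t : ℕ, ((ω t : ℝ)) < d} = 0

lemma ae_hit {C : ARProcess} (hfin : C.FinHit) (x : ↥C.E) (d : ℝ) :
    ∀ᵐ ω ∂C.P x, ∃ t, d ≤ (ω t : ℝ) := by
  rw [ae_iff]
  simpa using hfin x d

lemma ae_hitL {C : ARProcess} (hfin : C.FinHit) (x : ↥C.E) (d : ℝ) :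
    ∀ᵐ w : ↥C.E ∂C.hitL d x, d ≤ (w : ℝ) := by
  rw [hitL, ae_map_iff (C.measurable_hit d).aemeasurable (MeasurableSet.of_discrete)]
  filter_upwards [ae_hit hfin x d] with ω hω
  exact hitTime_spec hω

lemma Hf_lt {C : ARProcess} (hfin : C.FinHit) (d : ℝ) (φ : ↥C.E → ℝ) (B : ℝ)
    (hB : ∀ w, |φ w| ≤ B) (x : ↥C.E) (hx : (x : ℝ) < d) :
    C.Hf d φ x = ∫ w, C.Hf d φ w ∂C.stepL x := by
  have h := C.integral_shift x (fun ω => φ (ω (hitTime d ω)))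
    ((Measurable.of_discrete (f := φ)).comp (C.measurable_hit d)) B (fun ω => hB _)
  simp only [← Hf_eq] at h
  rw [← h, Hf_eq]
  apply integral_congr_ae
  filter_upwards [ae_hit hfin x d, C.ae_start x] with ω h1 h2
  have h3 := hitTime_shift h1 (by rw [h2]; exact hx)
  rw [h3]; rfl

/-- Probability of staying below `d` up to time `n`. -/
noncomputable def stay (C : ARProcess) (d : ℝ) (n : ℕ) (x : ↥C.E) : ℝ :=
  (C.P x).real {ω | ∀ t ≤ n, (ω t : ℝ) < d}

lemma measurableSet_stay (C : ARProcess) (d : ℝ) (n : ℕ) :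
    MeasurableSet {ω : ℕ → ↥C.E | ∀ t ≤ n, (ω t : ℝ) < d} := by
  have : {ω : ℕ → ↥C.E | ∀ t ≤ n, (ω t : ℝ) < d}
      = ⋂ t : ℕ, ⋂ _ : t ≤ n, (fun ω => ω t) ⁻¹' {w : ↥C.E | (w : ℝ) < d} := by
    ext ω; simp
  rw [this]
  exact MeasurableSet.iInter fun t => MeasurableSet.iInter fun _ =>
    (measurable_pi_apply t) MeasurableSet.of_discrete

lemma stay_succ (C : ARProcess) (d : ℝ) (n : ℕ) (x : ↥C.E) (hx : (x : ℝ) < d) :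
    C.stay d (n + 1) x = ∫ w, C.stay d n w ∂C.stepL x := by
  have h := C.integral_shift x
    (Set.indicator {ω : ℕ → ↥C.E | ∀ t ≤ n, (ω t : ℝ) < d} (fun _ => (1 : ℝ)))
    (measurable_const.indicator (C.measurableSet_stay d n)) 1 (fun ω => by
      by_cases h : ω ∈ {ω : ℕ → ↥C.E | ∀ t ≤ n, (ω t : ℝ) < d} <;> simp [Set.indicator, h])
  have h1 : ∀ w, ∫ ω, (Set.indicator {ω : ℕ → ↥C.E | ∀ t ≤ n, (ω t : ℝ) < d}
      (fun _ => (1 : ℝ))) ω ∂C.P w = C.stay d n w := fun w => by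
    rw [integral_indicator_const _ (C.measurableSet_stay d n)]; simp [stay]
  simp only [h1] at h
  rw [← h, stay, ← mul_one (Measure.real _ _), ← smul_eq_mul,
    ← integral_indicator_const _ (C.measurableSet_stay d (n + 1))]
  apply integral_congr_ae
  filter_upwards [C.ae_start x] with ω hω
  have : (∀ t ≤ n + 1, (ω t : ℝ) < d) ↔ (∀ t ≤ n, (shift ω t : ℝ) < d) := by
    constructor
    · intro h t ht; exact h (t + 1) (by omega)
    · intro h t ht
      rcases t with _ | t
      · rw [hω]; exact hx
      · exact h t (by omega)
  simp only [Set.indicator, Set.mem_ofPred_eq, this]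

lemma stay_nonneg (C : ARProcess) (d : ℝ) (n : ℕ) (x : ↥C.E) : 0 ≤ C.stay d n x :=
  measureReal_nonneg

lemma stay_le_one (C : ARProcess) (d : ℝ) (n : ℕ) (x : ↥C.E) : C.stay d n x ≤ 1 :=
  measureReal_le_one

lemma stay_zero (C : ARProcess) (d : ℝ) (x : ↥C.E) (hx : (x : ℝ) < d) : C.stay d 0 x = 1 := by
  have h : ∀ᵐ ω ∂C.P x, ω ∈ {ω : ℕ → ↥C.E | ∀ t ≤ 0, (ω t : ℝ) < d} := by
    filter_upwards [C.ae_start x] with ω hω t ht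
    rw [Nat.le_zero.1 ht, hω]; exact hx
  rw [stay, measureReal_def, (prob_compl_eq_zero_iff (C.measurableSet_stay d 0)).1 h]
  simp

lemma stay_tendsto {C : ARProcess} (hfin : C.FinHit) (d : ℝ) (x : ↥C.E) :
    Tendsto (fun n => C.stay d n x) atTop (nhds 0) := by
  have h := tendsto_measure_iInter_atTop (μ := C.P x)
    (s := fun n : ℕ => {ω : ℕ → ↥C.E | ∀ t ≤ n, (ω t : ℝ) < d})
    (fun n => (C.measurableSet_stay d n).nullMeasurableSet)
    (fun m n hmn ω hω t ht => hω t (ht.trans hmn)) ⟨0, measure_ne_top _ _⟩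
  have h2 : (⋂ n : ℕ, {ω : ℕ → ↥C.E | ∀ t ≤ n, (ω t : ℝ) < d})
      = {ω | ∀ t : ℕ, ((ω t : ℝ)) < d} := by
    ext ω
    simp only [Set.mem_iInter, Set.mem_ofPred_eq]
    exact ⟨fun h t => h t t le_rfl, fun h n t _ => h t⟩
  rw [h2, hfin x d] at h
  have := (ENNReal.tendsto_toReal ENNReal.zero_ne_top).comp h
  exact this

/-- Maximum principle. -/
lemma max_principle {C : ARProcess} (hfin : C.FinHit) (d : ℝ) (g : ↥C.E → ℝ) (B : ℝ)
    (hB : ∀ w, |g w| ≤ B) (h0 : ∀ w : ↥C.E, d ≤ (w : ℝ) → g w ≤ 0)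
    (h1 : ∀ w : ↥C.E, (w : ℝ) < d → g w ≤ ∫ v, g v ∂C.stepL w) (x : ↥C.E) : g x ≤ 0 := by
  have hB0 : 0 ≤ B := (abs_nonneg _).trans (hB x)
  have key : ∀ n : ℕ, ∀ w, g w ≤ B * C.stay d n w := by
    intro n
    induction n with
    | zero =>
      intro w
      rcases le_or_gt d (w : ℝ) with hw | hw
      · exact (h0 w hw).trans (mul_nonneg hB0 (C.stay_nonneg _ _ _))
      · rw [C.stay_zero d w hw, mul_one]; exact (le_abs_self _).trans (hB w)
    | succ n ih =>
      intro w
      rcases le_or_gt d (w : ℝ) with hw | hw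
      · exact (h0 w hw).trans (mul_nonneg hB0 (C.stay_nonneg _ _ _))
      · rw [C.stay_succ d n w hw, ← integral_const_mul]
        refine (h1 w hw).trans (integral_mono (integrable_bdd _ _ B hB)
          (integrable_bdd _ _ B fun v => ?_) ih)
        rw [abs_mul, abs_of_nonneg hB0, abs_of_nonneg (C.stay_nonneg _ _ _)]
        exact mul_le_of_le_one_right hB0 (C.stay_le_one _ _ _)
  have h2 : Tendsto (fun n => B * C.stay d n x) atTop (nhds (B * 0)) :=
    (stay_tendsto hfin d x).const_mul B
  rw [mul_zero] at h2
  exact ge_of_tendsto' h2 (fun n => key n x)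

/-- Strong Markov property for hitting positions. -/
lemma Hf_Hf {C : ARProcess} (hfin : C.FinHit) (d a : ℝ) (hda : d ≤ a) (φ : ↥C.E → ℝ) (B : ℝ)
    (hB : ∀ w, |φ w| ≤ B) (x : ↥C.E) : C.Hf a φ x = C.Hf d (C.Hf a φ) x := by
  have b1 := C.Hf_bdd a φ B hB
  have b2 := C.Hf_bdd d _ B b1
  apply le_antisymm
  · have := max_principle hfin d (fun w => C.Hf a φ w - C.Hf d (C.Hf a φ) w) (B + B)
      (fun w => (abs_sub _ _).trans (add_le_add (b1 w) (b2 w)))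
      (fun w hw => by simp [C.Hf_ge d _ w hw])
      (fun w hw => by
        rw [integral_sub (integrable_bdd _ _ B b1) (integrable_bdd _ _ B b2),
          ← Hf_lt hfin a φ B hB w (hw.trans_le hda), ← Hf_lt hfin d _ B b1 w hw]) x
    linarith
  · have := max_principle hfin d (fun w => C.Hf d (C.Hf a φ) w - C.Hf a φ w) (B + B)
      (fun w => (abs_sub _ _).trans (add_le_add (b2 w) (b1 w)))
      (fun w hw => by simp [C.Hf_ge d _ w hw])
      (fun w hw => by
        rw [integral_sub (integrable_bdd _ _ B b2) (integrable_bdd _ _ B b1),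
          ← Hf_lt hfin a φ B hB w (hw.trans_le hda), ← Hf_lt hfin d _ B b1 w hw]) x
    linarith

lemma real_tail (G : ℝ → ℝ) (hG : Antitone G) (hG0 : ∀ t, 0 ≤ G t)
    (hi : IntegrableOn G (Set.Ioi (0 : ℝ))) :
    ∃ T : ℝ → ℝ, (∀ s t, 0 ≤ s → s ≤ t → T t ≤ T s) ∧ (∀ t, 0 ≤ T t) ∧
      Tendsto T atTop (nhds 0) ∧ ∀ η t, 0 < η → η ≤ t → η * G t ≤ T (t - η) - T t := by
  have sub : ∀ s t, 0 ≤ s → s ≤ t → (t - s) * G t ≤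
      (∫ x in Set.Ioi s, G x) - ∫ x in Set.Ioi t, G x := by
    intro s t hs hst
    have i1 : IntegrableOn G (Set.Ioi s) := hi.mono_set (Set.Ioi_subset_Ioi hs)
    have i2 : IntegrableOn G (Set.Ioi t) := hi.mono_set (Set.Ioi_subset_Ioi (hs.trans hst))
    have h := intervalIntegral.integral_interval_add_Ioi i1 i2
    have h2 : (t - s) * G t ≤ ∫ x in s..t, G x := by
      have := intervalIntegral.integral_mono_on (μ := volume) (f := fun _ => G t) (g := G) hst
        (by simp) (hG.intervalIntegrable) (fun x hx => hG hx.2)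
      simpa using this
    linarith
  refine ⟨fun t => ∫ x in Set.Ioi t, G x, ?_, ?_, ?_, ?_⟩
  · intro s t hs hst
    have := sub s t hs hst
    have h2 := mul_nonneg (sub_nonneg.2 hst) (hG0 t)
    simp only
    linarith
  · intro t
    exact integral_nonneg hG0
  · exact tendsto_integral_Ioi_zero tendsto_id
  · intro η t hη hηt
    have := sub (t - η) t (by linarith) (by linarith)
    simpa using this

lemma exists_state_lt (C : ARProcess) (b : ℝ) : ∃ x : ↥C.E, (x : ℝ) < b := by
  obtain ⟨x, hx, h⟩ := not_bddBelow_iff.1 C.nobound b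
  exact ⟨⟨x, hx⟩, h⟩

lemma stepL_real_le (C : ARProcess) (x : ↥C.E) (t : ℝ) :
    (C.stepL x).real {w : ↥C.E | (x : ℝ) + t < (w : ℝ)}
      = 1 - ((C.P x) {ω | ((ω 1 : ℝ)) - ((x : ℝ)) ≤ t}).toReal := by
  have h1 : ((C.P x) {ω | ((ω 1 : ℝ)) - ((x : ℝ)) ≤ t}).toReal
      = (C.stepL x).real {w : ↥C.E | (x : ℝ) + t < (w : ℝ)}ᶜ := by
    rw [measureReal_def, stepL, Measure.map_apply (measurable_pi_apply 1) MeasurableSet.of_discrete]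
    congr 2
    ext ω
    simp [add_comm]
  rw [h1, probReal_compl_eq_one_sub MeasurableSet.of_discrete]
  ring

lemma exists_tail {C : ARProcess} (hIC : IntegrabilityCondition C) :
    ∃ b : ℝ, ∃ G : ℝ → ℝ, Antitone G ∧ (∀ t, 0 ≤ G t) ∧ IntegrableOn G (Set.Ioi (0 : ℝ)) ∧
      ∀ (x : ↥C.E) (t : ℝ), (x : ℝ) ≤ b →
        (C.stepL x).real {w : ↥C.E | (x : ℝ) + t < (w : ℝ)} ≤ G t := by
  obtain ⟨b, hb⟩ := hIC
  obtain ⟨x₁, hx₁⟩ := C.exists_state_lt b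
  have hne : Nonempty {x : ↥C.E // (x : ℝ) ≤ b} := ⟨⟨x₁, hx₁.le⟩⟩
  have hbd : ∀ t, BddBelow (Set.range fun x : {x : ↥C.E // (x : ℝ) ≤ b} =>
      ((C.P x.1) {ω | ((ω 1 : ℝ)) - ((x.1 : ℝ)) ≤ t}).toReal) := fun t =>
    ⟨0, by rintro _ ⟨x, rfl⟩; exact ENNReal.toReal_nonneg⟩
  have hle : ∀ (x : ↥C.E) (t : ℝ), (x : ℝ) ≤ b →
      (C.stepL x).real {w : ↥C.E | (x : ℝ) + t < (w : ℝ)} ≤ 1 - Fbar C b t := by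
    intro x t hx
    rw [stepL_real_le]
    have := ciInf_le (hbd t) ⟨x, hx⟩
    unfold Fbar
    linarith
  refine ⟨b, fun t => 1 - Fbar C b t, ?_, ?_, hb, hle⟩
  · intro s t hst
    have : Fbar C b s ≤ Fbar C b t := by
      refine ciInf_mono (hbd s) fun x => ?_
      refine ENNReal.toReal_mono (measure_ne_top _ _) (measure_mono fun ω hω => ?_)
      have h' : ((ω 1 : ℝ)) - ((x.1 : ℝ)) ≤ s := hω
      exact le_trans h' hst
    simp only
    linarith
  · intro t
    exact measureReal_nonneg.trans (hle x₁ t hx₁.le)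

lemma exists_inc (C : ARProcess) : ∃ η p xp : ℝ, 0 < η ∧ 0 < p ∧ ∀ x : ↥C.E, (x : ℝ) ≤ xp →
    p ≤ (C.stepL x).real {w : ↥C.E | (x : ℝ) + η < (w : ℝ)} := by
  have h1 : ∃ t : ℝ, 0 < t ∧ C.F t < 1 := by
    by_contra! hcon
    have h2 : ∀ t, C.F t ≤ 1 := fun t => C.F_mono.ge_of_tendsto C.F_top t
    have : ∫ t in Set.Ioi (0 : ℝ), (1 - C.F t) = ∫ t in Set.Ioi (0 : ℝ), (0 : ℝ) := by
      apply setIntegral_congr_fun measurableSet_Ioi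
      intro t ht
      have := hcon t ht
      have := h2 t
      simp only
      linarith
    have h3 := C.mean_pos
    rw [this] at h3
    simp at h3
  obtain ⟨t, ht, hFt⟩ := h1
  have hc := C.F_mono.countable_not_continuousAt
  have hdense := hc.dense_compl ℝ
  obtain ⟨η, hη, hη0, hηt⟩ := hdense.exists_between ht
  have hcont : ContinuousAt C.F η := by simpa using hη
  have hFη : C.F η < 1 := (C.F_mono hηt.le).trans_lt hFt
  have hlim := C.F_conv η hcont
  have hev := hlim.eventually (gt_mem_nhds (show C.F η < (1 + C.F η) / 2 by linarith))
  rw [eventually_comap] at hev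
  obtain ⟨xp, hxp⟩ := eventually_atBot.1 hev
  refine ⟨η, (1 - C.F η) / 2, xp, hη0, by linarith, fun x hx => ?_⟩
  rw [stepL_real_le]
  have := hxp x hx x rfl
  linarith

/-- Indicator of the half line above `v`. -/
noncomputable def above (C : ARProcess) (v : ℝ) : ↥C.E → ℝ :=
  Set.indicator {w : ↥C.E | v < (w : ℝ)} fun _ => 1

lemma above_of_lt {C : ARProcess} {v : ℝ} {w : ↥C.E} (h : v < (w : ℝ)) : C.above v w = 1 := by
  simp [above, Set.indicator, h]

lemma above_of_le {C : ARProcess} {v : ℝ} {w : ↥C.E} (h : (w : ℝ) ≤ v) : C.above v w = 0 := by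
  simp [above, Set.indicator, not_lt.2 h]

lemma above_nonneg (C : ARProcess) (v : ℝ) (w : ↥C.E) : 0 ≤ C.above v w := by
  rcases le_or_gt (w : ℝ) v with h | h
  · rw [above_of_le h]
  · rw [above_of_lt h]; norm_num

lemma above_bdd (C : ARProcess) (v : ℝ) (w : ↥C.E) : |C.above v w| ≤ 1 := by
  rcases le_or_gt (w : ℝ) v with h | h
  · rw [above_of_le h]; norm_num
  · rw [above_of_lt h]; norm_num

lemma integral_above (C : ARProcess) (v : ℝ) (μ : Measure ↥C.E) :
    ∫ w, C.above v w ∂μ = μ.real {w : ↥C.E | v < (w : ℝ)} := by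
  unfold above
  rw [integral_indicator_const _ MeasurableSet.of_discrete]; simp

lemma overshoot {C : ARProcess} (hfin : C.FinHit) (hIC : IntegrabilityCondition C) (v δ : ℝ)
    (hδ : 0 < δ) : ∃ u : ℝ, (∀ x : ↥C.E, (x : ℝ) ≤ u →
        (C.stepL x).real {w : ↥C.E | v < (w : ℝ)} ≤ δ) ∧
      ∀ y : ℝ, y ≤ u → ∀ z : ↥C.E, (z : ℝ) < y →
        (C.hitL y z).real {w : ↥C.E | v < (w : ℝ)} ≤ δ := by
  obtain ⟨b, G, hGa, hG0, hGi, hG⟩ := exists_tail hIC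
  obtain ⟨η, p, xp, hη, hp, hinc⟩ := C.exists_inc
  obtain ⟨T, hTa, hT0, hTlim, hTG⟩ := real_tail G hGa hG0 hGi
  set c : ℝ := 1 / (p * η) with hc
  have hc0 : 0 < c := by positivity
  have hev : ∀ᶠ t in atTop, T t < min (δ * η) (δ / c) :=
    hTlim.eventually (gt_mem_nhds (lt_min (by positivity) (by positivity)))
  obtain ⟨t₀, ht₀⟩ := eventually_atTop.1 hev
  have hstep : ∀ z : ↥C.E, (z : ℝ) ≤ b →
      (C.stepL z).real {w : ↥C.E | v < (w : ℝ)} ≤ G (v - z) := by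
    intro z hz
    have := hG z (v - z) hz
    simpa using this
  refine ⟨min (min b xp) (v - η - max t₀ 0), ?_, ?_⟩
  · intro x hx
    have hxb : (x : ℝ) ≤ b := hx.trans ((min_le_left _ _).trans (min_le_left _ _))
    have hxv : (x : ℝ) ≤ v - η - max t₀ 0 := hx.trans (min_le_right _ _)
    refine (hstep x hxb).trans ?_
    have m1 := le_max_left t₀ 0
    have m2 := le_max_right t₀ 0
    have h1 := hTG η (v - x) hη (by linarith)
    have h2 := (ht₀ (v - x - η) (by linarith)).trans_le (min_le_left _ _)
    have h3 := hT0 (v - x)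
    have : η * G (v - x) ≤ η * δ := by linarith
    exact le_of_mul_le_mul_left this hη
  · intro y hy z hz
    have hyb : y ≤ b := hy.trans ((min_le_left _ _).trans (min_le_left _ _))
    have hyp : y ≤ xp := hy.trans ((min_le_left _ _).trans (min_le_right _ _))
    have hyv : y ≤ v - η - max t₀ 0 := hy.trans (min_le_right _ _)
    have m1 := le_max_left t₀ 0
    have m2 := le_max_right t₀ 0
    have hTA := (ht₀ (v - y - η) (by linarith)).trans_le (min_le_right _ _)
    have hcT : c * T (v - y - η) < δ := by
      rw [lt_div_iff₀ hc0] at hTA; linarith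
    set V : ↥C.E → ℝ := fun w =>
      if (w : ℝ) < y then c * (T (v - y - η) - T (v - w)) else C.above v w with hV
    have Vlt : ∀ w : ↥C.E, (w : ℝ) < y → V w = c * (T (v - y - η) - T (v - w)) := fun w hw => by
      simp [hV, hw]
    have Vge : ∀ w : ↥C.E, y ≤ (w : ℝ) → V w = C.above v w := fun w hw => by
      simp [hV, not_lt.2 hw]
    have Vbd : ∀ w, |V w| ≤ δ + 1 := by
      intro w
      rcases le_or_gt y (w : ℝ) with hw | hw
      · rw [Vge w hw]; have := C.above_bdd v w; linarith
      · rw [Vlt w hw]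
        have h1 := hTa (v - y - η) (v - w) (by linarith) (by linarith)
        rw [abs_of_nonneg (mul_nonneg hc0.le (by linarith))]
        have := mul_nonneg hc0.le (hT0 (v - w))
        nlinarith
    have hH := C.Hf_bdd y (C.above v) 1 (C.above_bdd v)
    have key := max_principle hfin y (fun w => C.Hf y (C.above v) w - V w) (1 + (δ + 1))
      (fun w => (abs_sub _ _).trans (add_le_add (hH w) (Vbd w)))
      (fun w hw => by simp [C.Hf_ge y _ w hw, Vge w hw])
      (fun w hw => by
        rw [integral_sub (integrable_bdd _ _ _ hH) (integrable_bdd _ _ _ Vbd),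
          ← Hf_lt hfin y _ 1 (C.above_bdd v) w hw]
        suffices h : ∫ w', V w' ∂C.stepL w ≤ V w by linarith
        have hpt : ∀ᵐ w' : ↥C.E ∂C.stepL w, V w' ≤
            V w + C.above v w' - c * η * G (v - w) * C.above (w + η) w' := by
          filter_upwards [C.stepL_pos w] with w' hw'
          have a0 := C.above_nonneg v w'
          have e1 := hTG η (v - w) hη (by linarith)
          have e1' := mul_le_mul_of_nonneg_left e1 hc0.le
          have e2 : 0 ≤ c * (η * G (v - w)) := by have := hG0 (v - w); positivity
          have main : V w' ≤ V w + C.above v w' - c * (η * G (v - w)) * C.above (w + η) w' := by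
            rw [Vlt w hw]
            rcases le_or_gt y (w' : ℝ) with hy' | hy'
            · rw [Vge w' hy']
              have b1 : c * (η * G (v - w)) * C.above (w + η) w' ≤ c * (η * G (v - w)) :=
                mul_le_of_le_one_right e2 ((le_abs_self _).trans (C.above_bdd _ _))
              have b2 := hTa (v - y - η) (v - w - η) (by linarith) (by linarith)
              have b3 := mul_le_mul_of_nonneg_left b2 hc0.le
              linarith
            · rw [Vlt w' hy']
              rcases le_or_gt (w' : ℝ) (w + η) with hww | hww
              · rw [above_of_le hww]
                have b2 := hTa (v - w') (v - w) (by linarith) (by linarith)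
                have b3 := mul_le_mul_of_nonneg_left b2 hc0.le
                linarith
              · rw [above_of_lt hww]
                have b2 := hTa (v - w') (v - w - η) (by linarith) (by linarith)
                have b3 := mul_le_mul_of_nonneg_left b2 hc0.le
                linarith
          linarith
        have ia : ∀ r, Integrable (C.above r) (C.stepL w) := fun r =>
          integrable_bdd _ _ 1 (C.above_bdd r)
        have hint := integral_mono_ae (integrable_bdd _ _ _ Vbd)
          (((integrable_const (V w)).add (ia v)).sub ((ia (w + η)).const_mul
            (c * η * G (v - w)))) hpt
        have heq : ∫ w', (V w + C.above v w' - c * η * G (v - w) * C.above (w + η) w') ∂C.stepL w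
            = V w + (C.stepL w).real {w' : ↥C.E | v < (w' : ℝ)}
              - c * η * G (v - w) * (C.stepL w).real {w' : ↥C.E | (w : ℝ) + η < (w' : ℝ)} := by
          rw [integral_sub (f := fun w' => V w + C.above v w')
            ((integrable_const (V w)).add (ia v)) ((ia (w + η)).const_mul _),
            integral_add (integrable_const (V w)) (ia v), integral_const_mul, integral_above,
            integral_above]
          simp
        have hint' := hint.trans_eq heq
        have f1 := hstep w (by linarith)
        have f2 := hinc w (by linarith)
        have f3 : 0 ≤ c * η * G (v - w) := by have := hG0 (v - w); positivity
        have f4 := mul_le_mul_of_nonneg_left f2 f3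
        have f5 : c * η * G (v - w) * p = G (v - w) := by
          rw [hc]; field_simp
        linarith) z
    have h1 : C.Hf y (C.above v) z ≤ V z := by linarith
    rw [Hf, integral_above, Vlt z hz] at h1
    have := mul_nonneg hc0.le (hT0 (v - z))
    linarith

section TV

variable {α : Type*} [MeasurableSpace α] [DiscreteMeasurableSpace α] [Countable α]

lemma summable_real (μ : Measure α) [IsProbabilityMeasure μ] :
    Summable fun w => (μ {w}).toReal := by
  apply ENNReal.summable_toReal
  have h := lintegral_countable' (μ := μ) (fun _ => 1)
  simp only [lintegral_const, measure_univ, one_mul] at h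
  rw [← h]; simp

lemma summable_real_mul (μ : Measure α) [IsProbabilityMeasure μ] (f : α → ℝ) (B : ℝ)
    (hB : ∀ w, |f w| ≤ B) : Summable fun w => (μ {w}).toReal * f w := by
  refine Summable.of_norm_bounded ((summable_real μ).mul_right B) fun w => ?_
  rw [Real.norm_eq_abs, abs_mul, abs_of_nonneg ENNReal.toReal_nonneg]
  exact mul_le_mul_of_nonneg_left (hB w) ENNReal.toReal_nonneg

lemma integral_tsum_real (μ : Measure α) [IsProbabilityMeasure μ] (f : α → ℝ) (B : ℝ)
    (hB : ∀ w, |f w| ≤ B) : ∫ w, f w ∂μ = ∑' w, (μ {w}).toReal * f w := by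
  rw [integral_countable (integrable_bdd μ f B hB)]
  rfl

lemma integral_sub_tsum (μ ν : Measure α) [IsProbabilityMeasure μ] [IsProbabilityMeasure ν]
    (f : α → ℝ) (B : ℝ) (hB : ∀ w, |f w| ≤ B) :
    ∫ w, f w ∂μ - ∫ w, f w ∂ν = ∑' w, ((μ {w}).toReal - (ν {w}).toReal) * f w := by
  rw [integral_tsum_real μ f B hB, integral_tsum_real ν f B hB,
    ← (summable_real_mul μ f B hB).tsum_sub (summable_real_mul ν f B hB)]
  simp only [sub_mul]

lemma summable_dTV (μ ν : Measure α) [IsProbabilityMeasure μ] [IsProbabilityMeasure ν] :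
    Summable fun w => |(μ {w}).toReal - (ν {w}).toReal| :=
  ((summable_real μ).sub (summable_real ν)).abs

lemma dTV_bound (μ ν : Measure α) [IsProbabilityMeasure μ] [IsProbabilityMeasure ν]
    (f g : α → ℝ) (R : ℝ) (hR : 0 ≤ R) (B : ℝ) (hg0 : ∀ w, 0 ≤ g w) (hg : ∀ w, |g w| ≤ B)
    (hf : ∀ w, |f w| ≤ R + g w) :
    |∫ w, f w ∂μ - ∫ w, f w ∂ν| ≤ R * dTV μ ν + (∫ w, g w ∂μ + ∫ w, g w ∂ν) := by
  have hfB : ∀ w, |f w| ≤ R + B := fun w =>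
    (hf w).trans (by have := (le_abs_self _).trans (hg w); linarith)
  rw [integral_sub_tsum μ ν f (R + B) hfB, integral_tsum_real μ g B hg,
    integral_tsum_real ν g B hg, dTV, ← tsum_mul_left]
  have s1 := (summable_dTV μ ν).mul_left R
  have s2 := (summable_real_mul μ g B hg)
  have s3 := (summable_real_mul ν g B hg)
  rw [← s2.tsum_add s3, ← s1.tsum_add (s2.add s3), ← Real.norm_eq_abs]
  refine tsum_of_norm_bounded (s1.add (s2.add s3)).hasSum fun w => ?_
  rw [Real.norm_eq_abs, abs_mul]
  have m0 : 0 ≤ (μ {w}).toReal := ENNReal.toReal_nonneg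
  have n0 : 0 ≤ (ν {w}).toReal := ENNReal.toReal_nonneg
  have h1 : |(μ {w}).toReal - (ν {w}).toReal| ≤ (μ {w}).toReal + (ν {w}).toReal := by
    rw [abs_le]; constructor <;> linarith
  have h2 := mul_le_mul_of_nonneg_left (hf w) (abs_nonneg ((μ {w}).toReal - (ν {w}).toReal))
  have h3 := mul_le_mul_of_nonneg_right h1 (hg0 w)
  linarith

lemma dTV_le (μ ν : Measure α) [IsProbabilityMeasure μ] [IsProbabilityMeasure ν] (D : ℝ)
    (h : ∀ φ : α → ℝ, (∀ w, |φ w| ≤ 1) → |∫ w, φ w ∂μ - ∫ w, φ w ∂ν| ≤ D) : dTV μ ν ≤ D := by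
  have hφ : ∀ w, |(SignType.sign ((μ {w}).toReal - (ν {w}).toReal) : ℝ)| ≤ 1 := by
    intro w
    rcases lt_trichotomy ((μ {w}).toReal - (ν {w}).toReal) 0 with h | h | h <;> simp [h]
  have h1 := h _ hφ
  rw [integral_sub_tsum μ ν _ 1 hφ] at h1
  have h2 := (le_abs_self _).trans h1
  refine le_trans (le_of_eq ?_) h2
  unfold dTV
  congr 1
  ext w
  exact (self_mul_sign _).symm

end TV

/-- Oscillation bound for the hitting expectations started below `v`. -/
def Osc (C : ARProcess) (a v D : ℝ) : Prop :=
  ∀ φ : ↥C.E → ℝ, (∀ w, |φ w| ≤ 1) → ∀ x y : ↥C.E, (x : ℝ) ≤ v → (y : ℝ) ≤ v →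
    |C.Hf a φ x - C.Hf a φ y| ≤ D

lemma step_contract (C : ARProcess) (h : ↥C.E → ℝ) (hh : ∀ w, |h w| ≤ 1) (v D δ ε : ℝ)
    (hD0 : 0 ≤ D) (hD2 : D ≤ 2)
    (hosc : ∀ x y : ↥C.E, (x : ℝ) ≤ v → (y : ℝ) ≤ v → |h x - h y| ≤ D) (x y : ↥C.E)
    (hx : (C.stepL x).real {w : ↥C.E | v < (w : ℝ)} ≤ δ)
    (hy : (C.stepL y).real {w : ↥C.E | v < (w : ℝ)} ≤ δ)
    (hTV : dTV (C.stepL x) (C.stepL y) < 2 * (1 - ε)) :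
    |∫ w, h w ∂C.stepL x - ∫ w, h w ∂C.stepL y| ≤ (1 - ε) * D + 6 * δ := by
  obtain ⟨z, hz⟩ := C.exists_state_lt v
  have hne : Nonempty {w : ↥C.E // (w : ℝ) ≤ v} := ⟨⟨z, hz.le⟩⟩
  set I : ℝ := ⨅ w : {w : ↥C.E // (w : ℝ) ≤ v}, h w.1 with hI
  have hbd : BddBelow (Set.range fun w : {w : ↥C.E // (w : ℝ) ≤ v} => h w.1) :=
    ⟨-1, by rintro _ ⟨w, rfl⟩; exact (abs_le.1 (hh w.1)).1⟩
  have hI1 : ∀ w : ↥C.E, (w : ℝ) ≤ v → I ≤ h w := fun w hw => ciInf_le hbd ⟨w, hw⟩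
  have hI2 : ∀ w : ↥C.E, (w : ℝ) ≤ v → h w ≤ I + D := by
    intro w hw
    have : h w - D ≤ I := le_ciInf fun w' => by
      have := (abs_le.1 (hosc w w'.1 hw w'.2)).2
      linarith
    linarith
  have hI3 : -1 ≤ I := le_ciInf fun w' => (abs_le.1 (hh w'.1)).1
  have hI4 : I ≤ 1 := (hI1 z hz.le).trans (abs_le.1 (hh z)).2
  have hb := dTV_bound (C.stepL x) (C.stepL y) (fun w => h w - (I + D / 2))
    (fun w => 3 * C.above v w) (D / 2) (by linarith) 3
    (fun w => by have := C.above_nonneg v w; linarith)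
    (fun w => by
      rw [abs_mul, abs_of_pos (by norm_num : (0 : ℝ) < 3)]
      have := C.above_bdd v w; linarith)
    (fun w => by
      rcases le_or_gt (w : ℝ) v with hw | hw
      · rw [above_of_le hw, abs_le]
        have := hI1 w hw
        have := hI2 w hw
        constructor <;> linarith
      · rw [above_of_lt hw, abs_le]
        have := abs_le.1 (hh w)
        constructor <;> linarith [this.1, this.2])
  rw [integral_sub (integrable_bdd _ _ 1 hh) (integrable_const _),
    integral_sub (integrable_bdd _ _ 1 hh) (integrable_const _), integral_const_mul,
    integral_const_mul, integral_above, integral_above] at hb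
  simp only [integral_const, probReal_univ, one_smul, sub_sub_sub_cancel_right] at hb
  have := mul_le_mul_of_nonneg_left hTV.le (by linarith : 0 ≤ D / 2)
  linarith

lemma improve {C : ARProcess} (hIC : IntegrabilityCondition C) (hfin : C.FinHit)
    (ε x₀ K : ℝ) (hε : 0 < ε) (hK : 0 < K)
    (hTV : ∀ x y : ↥C.E, (x : ℝ) ≤ x₀ → (y : ℝ) ≤ x₀ → |(x : ℝ) - (y : ℝ)| ≤ K →
      dTV (C.stepL x) (C.stepL y) < 2 * (1 - ε))
    (c x₁ : ℝ) (hhit : ∀ z y : ↥C.E, (z : ℝ) < (y : ℝ) → (y : ℝ) ≤ x₁ →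
      c ≤ (C.hitL y z).real {w : ↥C.E | (w : ℝ) - (y : ℝ) ≤ K})
    (hcε : c * ε ≤ 1)
    (a v D : ℝ) (hD0 : 0 ≤ D) (hD2 : D ≤ 2) (hosc : C.Osc a v D) (η : ℝ) (hη : 0 < η) :
    ∃ u, C.Osc a u ((1 - c * ε) * D + η) := by
  obtain ⟨u₁, hu1, hu2⟩ := overshoot hfin hIC v (η / 8) (by positivity)
  obtain ⟨u, hu⟩ : ∃ u : ℝ, u ≤ u₁ - K ∧ u ≤ x₀ - K ∧ u ≤ v - K ∧ u ≤ x₁ ∧ u ≤ a - K - 1 :=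
    ⟨min (u₁ - K) (min (x₀ - K) (min (v - K) (min x₁ (a - K - 1)))), by simp⟩
  obtain ⟨h1, h2, h3, h4, h5⟩ := hu
  have hnn : 0 ≤ (1 - c * ε) * D + η := by
    have := mul_nonneg (sub_nonneg.2 hcε) hD0
    linarith
  refine ⟨u, fun φ hφ => ?_⟩
  set h := C.Hf a φ with hh
  have hb : ∀ w, |h w| ≤ 1 := C.Hf_bdd a φ 1 hφ
  have main : ∀ x y : ↥C.E, (x : ℝ) < y → (y : ℝ) ≤ u → |h x - h y| ≤ (1 - c * ε) * D + η := by
    intro x y hxy hy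
    have near : ∀ w : ↥C.E, (y : ℝ) ≤ w → (w : ℝ) - y ≤ K →
        |h w - h y| ≤ (1 - ε) * D + 6 * (η / 8) := by
      intro w hw1 hw2
      rw [hh, Hf_lt hfin a φ 1 hφ w (by linarith), Hf_lt hfin a φ 1 hφ y (by linarith)]
      exact C.step_contract h hb v D (η / 8) ε hD0 hD2 (hosc φ hφ) w y (hu1 w (by linarith))
        (hu1 y (by linarith)) (hTV w y (by linarith) (by linarith)
          (by rw [abs_of_nonneg (by linarith)]; exact hw2))
    set N : ↥C.E → ℝ := Set.indicator {w : ↥C.E | (w : ℝ) - (y : ℝ) ≤ K} fun _ => 1 with hN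
    have hNb : ∀ w, |N w| ≤ 1 := fun w => by
      by_cases hw : (w : ℝ) - (y : ℝ) ≤ K <;> simp [hN, Set.indicator, -tsub_le_iff_right, hw]
    have hpt : ∀ᵐ w : ↥C.E ∂C.hitL y x, |h w - h y| ≤
        (D + 6 * (η / 8)) + 2 * C.above v w - ε * D * N w := by
      filter_upwards [ae_hitL hfin x y] with w hw
      have a0 := C.above_nonneg v w
      by_cases hwK : (w : ℝ) - (y : ℝ) ≤ K
      · have n1 : N w = 1 := by simp [hN, Set.indicator, -tsub_le_iff_right, hwK]
        have := near w hw hwK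
        rw [n1]; linarith
      · have n1 : N w = 0 := by simp [hN, Set.indicator, -tsub_le_iff_right, hwK]
        rw [n1]
        rcases le_or_gt (w : ℝ) v with hv | hv
        · have := hosc φ hφ w y hv (by linarith)
          linarith
        · rw [above_of_lt hv]
          have := (abs_sub (h w) (h y)).trans (add_le_add (hb w) (hb y))
          linarith
    have e0 : h x = ∫ w, h w ∂C.hitL y x := Hf_Hf hfin y a (by linarith) φ 1 hφ x
    have e1 : h x - h y = ∫ w, (h w - h y) ∂C.hitL y x := by
      rw [integral_sub (integrable_bdd _ _ 1 hb) (integrable_const _), ← e0]; simp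
    have ia : Integrable (C.above v) (C.hitL y x) := integrable_bdd _ _ 1 (C.above_bdd v)
    have iN : Integrable N (C.hitL y x) := integrable_bdd _ _ 1 hNb
    have e2 := norm_integral_le_of_norm_le (f := fun w => h w - h y) (((integrable_const (D + 6 * (η / 8))).add
      (ia.const_mul 2)).sub (iN.const_mul (ε * D))) hpt
    have e3 : ∫ w, ((D + 6 * (η / 8)) + 2 * C.above v w - ε * D * N w) ∂C.hitL y x
        = (D + 6 * (η / 8)) + 2 * (C.hitL y x).real {w : ↥C.E | v < (w : ℝ)}
          - ε * D * (C.hitL y x).real {w : ↥C.E | (w : ℝ) - (y : ℝ) ≤ K} := by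
      rw [integral_sub (f := fun w => (D + 6 * (η / 8)) + 2 * C.above v w)
        ((integrable_const _).add (ia.const_mul 2)) (iN.const_mul _),
        integral_add (integrable_const _) (ia.const_mul 2), integral_const_mul,
        integral_const_mul, integral_above, hN,
        integral_indicator_const _ MeasurableSet.of_discrete]
      simp
    have e4 := e2.trans_eq e3
    rw [← e1, Real.norm_eq_abs] at e4
    have f1 := hu2 y (by linarith) x hxy
    have f2 := mul_le_mul_of_nonneg_left (hhit x y hxy (by linarith)) (mul_nonneg hε.le hD0)
    linarith
  intro x y hx hy
  rcases lt_trichotomy (x : ℝ) y with hxy | hxy | hxy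
  · exact main x y hxy hy
  · rw [Subtype.ext hxy]; simpa using hnn
  · rw [abs_sub_comm]; exact main y x hxy hx

end ARProcess

/-- (Key coupling lemma, after Rösler.)  Let `(S_t)` be an AR-process with
discrete (countable) state space satisfying the integrability condition, with `τ(d)` a.s.
finite for every starting point and every `d`.  If there are `ε > 0`, `x₀ < 0`, `K > 0` such
that `d_TV(P_x^{S_1}, P_y^{S_1}) < 2(1-ε)` for all states `x, y ≤ x₀` with `|x - y| ≤ K`,
and if `lim_{x₀ → -∞} inf_{z < y ≤ x₀} P_z(S_{τ(y)} - y ≤ K) > 0`, then for every `a < 0`,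
`lim_{x₀ → -∞} sup_{x,y ≤ x₀} d_TV(P_x^{S_{τ(a)}}, P_y^{S_{τ(a)}}) = 0`. -/
theorem stmt6 (C : ARProcess)
    (hIC : IntegrabilityCondition C)
    (hfin : ∀ (x : ↥C.E) (d : ℝ), C.P x {ω | ∀ t : ℕ, ((ω t : ℝ)) < d} = 0)
    (ε x₀ K : ℝ) (hε : 0 < ε) (hx₀ : x₀ < 0) (hK : 0 < K)
    (hTV : ∀ x y : ↥C.E, (x : ℝ) ≤ x₀ → (y : ℝ) ≤ x₀ → |(x : ℝ) - (y : ℝ)| ≤ K →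
      dTV ((C.P x).map fun ω => ω 1) ((C.P y).map fun ω => ω 1) < 2 * (1 - ε))
    (hhit : ∃ c : ℝ, 0 < c ∧ ∃ x₁ : ℝ, ∀ z y : ↥C.E, (z : ℝ) < (y : ℝ) → (y : ℝ) ≤ x₁ →
      c ≤ ((C.P z) {ω | ((ω (hitTime (y : ℝ) ω) : ℝ)) - (y : ℝ) ≤ K}).toReal) :
    ∀ a : ℝ, a < 0 → ∀ δ : ℝ, 0 < δ → ∃ x₂ : ℝ, ∀ x y : ↥C.E,
      (x : ℝ) ≤ x₂ → (y : ℝ) ≤ x₂ →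
      dTV ((C.P x).map fun ω => ω (hitTime a ω))
          ((C.P y).map fun ω => ω (hitTime a ω)) < δ := by
  
  intro a _ δ hδ
  obtain ⟨c', hc', x₁, hhit⟩ := hhit
  have hTV' : ∀ x y : ↥C.E, (x : ℝ) ≤ x₀ → (y : ℝ) ≤ x₀ → |(x : ℝ) - (y : ℝ)| ≤ K →
      dTV (C.stepL x) (C.stepL y) < 2 * (1 - ε) := hTV
  have hε1 : ε < 1 := by
    obtain ⟨z, hz⟩ := C.exists_state_lt x₀
    have h1 := hTV' z z hz.le hz.le (by simpa using hK.le)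
    have h2 : 0 ≤ dTV (C.stepL z) (C.stepL z) := tsum_nonneg fun _ => abs_nonneg _
    linarith
  obtain ⟨c, hc, hc1, hcc'⟩ : ∃ c : ℝ, 0 < c ∧ c ≤ 1 ∧ c ≤ c' :=
    ⟨min c' 1, lt_min hc' one_pos, min_le_right _ _, min_le_left _ _⟩
  have hhit' : ∀ z y : ↥C.E, (z : ℝ) < (y : ℝ) → (y : ℝ) ≤ x₁ →
      c ≤ (C.hitL y z).real {w : ↥C.E | (w : ℝ) - (y : ℝ) ≤ K} := by
    intro z y hzy hy
    refine hcc'.trans ((hhit z y hzy hy).trans_eq ?_)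
    rw [measureReal_def, ARProcess.hitL,
      Measure.map_apply (C.measurable_hit y) MeasurableSet.of_discrete]
    rfl
  have hr0 : 0 < c * ε := mul_pos hc hε
  have hr1 : c * ε ≤ 1 := mul_le_one₀ hc1 hε.le hε1.le
  set r := c * ε with hr
  set S : Set ℝ := {D | 0 ≤ D ∧ D ≤ 2 ∧ ∃ v, C.Osc a v D} with hS
  have h2S : (2 : ℝ) ∈ S := ⟨by norm_num, le_rfl, 0, fun φ hφ x y _ _ => by
    have h1 := C.Hf_bdd a φ 1 hφ x
    have h2 := C.Hf_bdd a φ 1 hφ y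
    exact (abs_sub _ _).trans (by linarith)⟩
  have hbd : BddBelow S := ⟨0, fun D hD => hD.1⟩
  have hL0 : 0 ≤ sInf S := le_csInf ⟨2, h2S⟩ fun D hD => hD.1
  have hL : sInf S = 0 := by
    by_contra hne
    have hLpos : 0 < sInf S := lt_of_le_of_ne hL0 (Ne.symm hne)
    have hq : 0 < r * sInf S / 4 := by positivity
    obtain ⟨D, hDS, hD⟩ := exists_lt_of_csInf_lt ⟨2, h2S⟩
      (show sInf S < sInf S + r * sInf S / 4 by linarith)
    obtain ⟨hD0, hD2, v, hv⟩ := hDS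
    obtain ⟨u, hu⟩ := ARProcess.improve hIC hfin ε x₀ K hε hK hTV' c x₁ hhit' hr1 a v D hD0 hD2 hv
      (r * sInf S / 4) hq
    have hLD : sInf S ≤ D := csInf_le hbd ⟨hD0, hD2, v, hv⟩
    have hrD : r * sInf S ≤ r * D := mul_le_mul_of_nonneg_left hLD hr0.le
    have hn : 0 ≤ (1 - r) * D := mul_nonneg (by linarith) hD0
    have hlt : (1 - r) * D + r * sInf S / 4 < sInf S := by linarith
    have h2 : sInf S ≤ 2 := csInf_le hbd h2S
    have := csInf_le hbd (show (1 - r) * D + r * sInf S / 4 ∈ S from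
      ⟨by linarith, by linarith, u, hu⟩)
    linarith
  obtain ⟨D, ⟨hD0, hD2, v, hv⟩, hD⟩ := exists_lt_of_csInf_lt ⟨2, h2S⟩ (show sInf S < δ by
    rw [hL]; exact hδ)
  refine ⟨v, fun x y hx hy => lt_of_le_of_lt ?_ hD⟩
  exact ARProcess.dTV_le (C.hitL a x) (C.hitL a y) D fun φ hφ => hv φ hφ x y hx hy
end
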